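/- Fix a prime p. For an integer j ≥ 2 and m ∈ ℕ put k_m = j − (p−1)·p^m (so k_m < 0 for large m) and let ζ(k_m) = −B_{1−k_m}/(1−k_m) ∈ ℚ be the value of the Riemann zeta function at the negative integer k_m, where B_n are the Bernoulli numbers; view these rationals in ℚ_p and say that 'ζ_p(j) exists and is irrational' if there exists x ∈ ℚ_p, not in the image of ℚ ↪ ℚ_p, with ζ(k_m) → x in ℚ_p as m → ∞. Then for every ε > 0 there exists S such that for every odd integer s ≥ S, the number of odd integers j with 3 ≤ j ≤ s for which ζ_p(j) exists and is irrational is at least (c_p − ε)·√(s/log s), where c_p = √( (4ζ(2)ζ(3)/ζ(6)) · ( (l_p + 1/(p−1))·log p − 1 − log 2 ) / ( p^{l_p−2}(p² − p + 1) ) ) and l_p = 1 if p ≥ 5, l_p = 2 if p = 3, l_p = 3 if p = 2. -/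

import Mathlib

open Filter

/-- The integer `l_p`: `1` if `p ≥ 5`, `2` if `p = 3`, `3` if `p = 2`. -/
def ellp (p : ℕ) : ℕ := if 5 ≤ p then 1 else if p = 3 then 2 else 3

/-- The value `ζ(s) = ∑_{n≥1} 1/n^s` of the Riemann zeta function at a
natural number `s`, as a real number. -/
noncomputable def zetaR (s : ℕ) : ℝ := ∑' n : ℕ, 1 / ((n : ℝ) + 1) ^ s

/-- The constant
`c_p = √( (4ζ(2)ζ(3)/ζ(6)) · ((l_p + 1/(p-1)) log p - 1 - log 2) / (p^{l_p-2}(p²-p+1)) )`. -/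
noncomputable def cp (p : ℕ) : ℝ :=
  Real.sqrt ((4 * zetaR 2 * zetaR 3 / zetaR 6) *
    (((ellp p : ℝ) + 1 / ((p : ℝ) - 1)) * Real.log p - 1 - Real.log 2) /
    ((p : ℝ) ^ ((ellp p : ℤ) - 2) * ((p : ℝ) ^ 2 - (p : ℝ) + 1)))

/-- The rational number `ζ(k) = -B_{1-k}/(1-k)` for `k = j - (p-1)p^m < 0`,
written via the index `1 - k = (p-1)p^m + 1 - j` (a natural number for large `m`). -/
noncomputable def zetaNegVal (p j m : ℕ) : ℚ :=
  -(bernoulli ((p - 1) * p ^ m + 1 - j)) / (((p - 1) * p ^ m + 1 - j : ℕ) : ℚ)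

/-- `ζ_p(j)` exists and is irrational: the classical zeta values
`ζ(j - (p-1)p^m)` converge `p`-adically, as `m → ∞`, to some `x ∈ ℚ_p` which is
not in the image of `ℚ ↪ ℚ_p`. -/
def ZetaPIrrational (p : ℕ) [Fact p.Prime] (j : ℕ) : Prop :=
  ∃ x : ℚ_[p], x ∉ Set.range ((↑) : ℚ → ℚ_[p]) ∧
    Tendsto (fun m : ℕ => ((zetaNegVal p j m : ℚ) : ℚ_[p])) atTop (nhds x)

namespace PZ

/-- rearrangement of a double sum along antidiagonals -/
lemma hasSum_antidiag {E : Type*} [NormedAddCommGroup E] [CompleteSpace E]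
    {f : ℕ × ℕ → E} (hf : Summable f) :
    ∑' n, ∑ q ∈ Finset.HasAntidiagonal.antidiagonal n, f q = ∑' r, ∑' q, f (r, q) := by
  rw [← hf.tsum_prod, ← Finset.HasAntidiagonal.sigmaAntidiagonalEquivProd.tsum_eq f]
  have hs := (Finset.HasAntidiagonal.sigmaAntidiagonalEquivProd (A := ℕ)).summable_iff.mpr hf
  refine Eq.trans ?_ (Summable.tsum_sigma' (fun n => (hasSum_fintype _).summable) hs).symm
  refine tsum_congr fun n => ?_
  rw [tsum_fintype]
  rw [Finset.univ_eq_attach]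
  simp only [Function.comp, Finset.HasAntidiagonal.sigmaAntidiagonalEquivProd_apply]
  exact (Finset.sum_attach (Finset.HasAntidiagonal.antidiagonal n) f).symm

lemma hasSum_antidiag_summable {E : Type*} [NormedAddCommGroup E] [CompleteSpace E]
    {f : ℕ × ℕ → E} (hf : Summable f) :
    Summable fun n => ∑ q ∈ Finset.HasAntidiagonal.antidiagonal n, f q := by
  have hs := (Finset.HasAntidiagonal.sigmaAntidiagonalEquivProd (A := ℕ)).summable_iff.mpr hf
  have := hs.sigma
  refine this.congr fun n => ?_
  rw [tsum_fintype]
  rw [Finset.univ_eq_attach]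
  simp only [Function.comp, Finset.HasAntidiagonal.sigmaAntidiagonalEquivProd_apply]
  exact (Finset.sum_attach (Finset.HasAntidiagonal.antidiagonal n) f)

variable {p : ℕ} [hp : Fact p.Prime]

lemma norm_nat_le_one (n : ℕ) : ‖(n : ℚ_[p])‖ ≤ 1 := by
  simpa using Padic.norm_int_le_one (p := p) (n : ℤ)

lemma one_le_mul_norm_nat {n : ℕ} (hn : n ≠ 0) : 1 ≤ (n : ℝ) * ‖(n : ℚ_[p])‖ := by
  have h0 : (n : ℚ_[p]) ≠ 0 := by exact_mod_cast hn
  rw [Padic.norm_eq_zpow_neg_valuation h0, Padic.valuation_natCast]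
  have hp0 : (0 : ℝ) < p := by exact_mod_cast hp.1.pos
  rw [zpow_neg, zpow_natCast, ← div_eq_mul_inv, one_le_div (by positivity)]
  exact_mod_cast Nat.le_of_dvd (Nat.pos_of_ne_zero hn) pow_padicValNat_dvd

lemma norm_bernoulli_le (q : ℕ) : ‖((bernoulli q : ℚ) : ℚ_[p])‖ ≤ p := by
  have hp1 : (1 : ℝ) ≤ p := by exact_mod_cast hp.1.one_lt.le
  rcases Nat.even_or_odd' q with ⟨k, rfl | rfl⟩
  · obtain ⟨z, hz⟩ := Bernoulli.vonStaudt_clausen k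
    have h1 : ((bernoulli (2 * k) : ℚ) : ℚ_[p]) = (z : ℚ_[p]) + -
       ∑ r ∈ Finset.range (2 * k + 2) with r.Prime ∧ (r - 1) ∣ 2 * k, (1 : ℚ_[p]) / r := by
      have : bernoulli (2 * k) = (z : ℚ) -
       ∑ r ∈ Finset.range (2 * k + 2) with r.Prime ∧ (r - 1) ∣ 2 * k, (1 : ℚ) / r := by
        rw [hz]; ring
      rw [this]; push_cast; ring
    rw [h1]
    refine (Padic.nonarchimedean _ _).trans (max_le ((Padic.norm_int_le_one z).trans hp1) ?_)
    rw [norm_neg]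
    refine IsUltrametricDist.norm_sum_le_of_forall_le_of_nonneg (by linarith) ?_
    intro r hr
    simp only [Finset.mem_filter] at hr
    rw [norm_div, norm_one]
    by_cases hrp : r = p
    · subst hrp; simp
    · have : ‖(r : ℚ_[p])‖ = 1 := by
        rw [Padic.norm_natCast_eq_one_iff]
        exact (Nat.coprime_primes hp.1 hr.2.1).mpr (Ne.symm hrp)
      rw [this]; simpa using hp1
  · rcases Nat.eq_zero_or_pos k with rfl | hk
    · have h2 : ((bernoulli 1 : ℚ) : ℚ_[p]) = -1 / ((2 : ℕ) : ℚ_[p]) := by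
        rw [bernoulli_one]; push_cast; ring
      simp only [mul_zero, zero_add]
      rw [h2, norm_div, norm_neg, norm_one]
      by_cases hrp : 2 = p
      · subst hrp; rw [Padic.norm_p]; simp
      · have : ‖((2 : ℕ) : ℚ_[p])‖ = 1 := by
          rw [Padic.norm_natCast_eq_one_iff]
          exact (Nat.coprime_primes hp.1 Nat.prime_two).mpr (Ne.symm hrp)
        rw [this]; simpa using hp1
    · rw [bernoulli_eq_zero_of_odd ⟨k, rfl⟩ (by omega)]
      simp

/-- terms of `hh` -/
noncomputable def hterm (y : ℚ_[p]) (a q : ℕ) : ℚ_[p] :=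
  (-1) ^ q * (((a + q - 1).choose q : ℕ) / (a : ℚ_[p])) * ((bernoulli q : ℚ) : ℚ_[p]) * y ^ (a + q)

/-- the `p`-adic Hurwitz-type function -/
noncomputable def hh (y : ℚ_[p]) (a : ℕ) : ℚ_[p] := ∑' q, hterm y a q

lemma hh_zero (y : ℚ_[p]) : hh y 0 = 0 := by
  simp [hh, hterm]

lemma norm_inv_nat_le (a : ℕ) : ‖(a : ℚ_[p])‖⁻¹ ≤ a := by
  rcases Nat.eq_zero_or_pos a with rfl | ha
  · simp
  · have := one_le_mul_norm_nat (p := p) ha.ne'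
    have h0 : 0 < ‖(a : ℚ_[p])‖ := by
      rw [norm_pos_iff]; exact_mod_cast ha.ne'
    rwa [inv_le_iff_one_le_mul₀ h0]

lemma norm_hterm_le (y : ℚ_[p]) (a q : ℕ) : ‖hterm y a q‖ ≤ p * a * ‖y‖ ^ (a + q) := by
  unfold hterm
  simp only [norm_mul, norm_pow, norm_neg, norm_one, one_pow, one_mul, norm_div]
  have h1 := norm_nat_le_one (p := p) ((a + q - 1).choose q)
  have h2 := norm_inv_nat_le (p := p) a
  have h3 := norm_bernoulli_le (p := p) q
  have h4 : ‖(((a + q - 1).choose q : ℕ) : ℚ_[p])‖ / ‖(a : ℚ_[p])‖ *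
      ‖((bernoulli q : ℚ) : ℚ_[p])‖ ≤ p * a := by
    calc _ ≤ (1 * a) * (p : ℝ) := by
          rw [div_eq_mul_inv]; gcongr
      _ = _ := by ring
  exact mul_le_mul_of_nonneg_right h4 (by positivity)

lemma summable_norm_hterm {y : ℚ_[p]} (hy : ‖y‖ < 1) (a : ℕ) : Summable (fun q => ‖hterm y a q‖) := by
  refine Summable.of_nonneg_of_le (fun _ => norm_nonneg _) (fun q => norm_hterm_le y a q) ?_
  simp_rw [pow_add]
  exact ((summable_geometric_of_lt_one (norm_nonneg _) hy).mul_left _).mul_left _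

lemma norm_hh_le {y : ℚ_[p]} (hy : ‖y‖ < 1) (a : ℕ) : ‖hh y a‖ ≤ p * a * ‖y‖ ^ a := by
  refine IsUltrametricDist.norm_tsum_le_of_forall_le_of_nonneg (by positivity) fun q => ?_
  refine (norm_hterm_le y a q).trans ?_
  gcongr _ * ?_
  exact pow_le_pow_of_le_one (norm_nonneg _) hy.le (by omega)

lemma choose_aux (a N r q : ℕ) (h : r + q = N) :
    ((a + r + 1).choose (r + 1) : ℚ) * (((a + r + 1 + q - 1).choose q : ℕ) / ((a + r + 1 : ℕ) : ℚ)) =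
    ((a + N).factorial / (a.factorial * (N + 1).factorial) : ℚ) * (N + 1).choose q := by
  subst h
  have e1 : (a + r + 1).choose (r + 1) = ((a + (r + 1)).choose (a)) := by
    rw [add_assoc, Nat.choose_symm_add]
  have e2 : a + r + 1 + q - 1 = (a + r) + q := by omega
  have e3 : ((a + r) + q).choose q = ((a + r) + q).choose (a + r) := by
    rw [Nat.choose_symm_add]
  have e4 : (r + q + 1).choose q = ((r + 1) + q).choose (r + 1) := by
    rw [Nat.choose_symm_add]; congr 1; ring
  rw [e1, e2, e3, e4, Nat.cast_add_choose, Nat.cast_add_choose, Nat.cast_add_choose]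
  have f1 : (a + (r + 1)).factorial = (a + r + 1) * (a + r).factorial := by
    rw [← add_assoc, Nat.factorial_succ]
  have f2 : (r + 1 + q) = r + q + 1 := by ring
  have f3 : a + (r + q) = a + r + q := by ring
  rw [f1, f2, f3]
  have := Nat.factorial_ne_zero
  have h1 : ((a + r).factorial : ℚ) ≠ 0 := by exact_mod_cast this _
  have h2 : ((r + 1).factorial : ℚ) ≠ 0 := by exact_mod_cast this _
  have h3 : ((r + q + 1).factorial : ℚ) ≠ 0 := by exact_mod_cast this _
  have h4 : ((a).factorial : ℚ) ≠ 0 := by exact_mod_cast this _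
  have h5 : ((q).factorial : ℚ) ≠ 0 := by exact_mod_cast this _
  have h6 : (a + r + 1 : ℚ) ≠ 0 := by positivity
  push_cast
  field_simp

lemma summable_key {y : ℚ_[p]} (hy : ‖y‖ < 1) (c : ℕ → ℚ_[p]) (hc : ∀ r, ‖c r‖ ≤ 1) (a : ℕ) :
    Summable (fun rq : ℕ × ℕ => c rq.1 * hterm y (a + rq.1 + 1) rq.2) := by
  refine Summable.of_norm ?_
  have h1 : Summable fun r : ℕ => (p * (a + r + 1 : ℕ) : ℝ) * ‖y‖ ^ (a + r + 1) := by
    have := summable_pow_mul_geometric_of_norm_lt_one (R := ℝ) 1 (r := ‖y‖) (by simpa using hy)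
    have h2 := (summable_nat_add_iff (a + 1)).mpr this
    refine (h2.mul_left (p : ℝ)).congr fun r => ?_
    have : r + (a + 1) = a + r + 1 := by ring
    rw [this]; ring
  have h2 := summable_geometric_of_lt_one (norm_nonneg _) hy
  have h3 := h1.mul_of_nonneg h2 (fun r => by positivity) (fun r => by positivity)
  refine Summable.of_nonneg_of_le (fun _ => norm_nonneg _) (fun rq => ?_) h3
  rw [norm_mul]
  calc _ ≤ 1 * (p * (a + rq.1 + 1 : ℕ) * ‖y‖ ^ (a + rq.1 + 1 + rq.2)) := by
        gcongr
        · exact hc _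
        · exact norm_hterm_le _ _ _
    _ = _ := by rw [pow_add]; ring

lemma key_identity {y : ℚ_[p]} (hy : ‖y‖ < 1) (a : ℕ) :
    ∑' r : ℕ, (-1) ^ r * ((a + r).choose r : ℚ_[p]) * hh y (a + r) = hh y a - y ^ (a + 1) := by
  have hs := summable_key hy (fun r => (-1) ^ (r + 1) * ((a + r + 1).choose (r + 1) : ℚ_[p]))
    (fun r => by
      rw [norm_mul, norm_pow, norm_neg, norm_one, one_pow, one_mul]
      exact norm_nat_le_one _) a
  have h1 := hasSum_antidiag hs
  have hs2 := hs.prod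
  simp only [tsum_mul_left] at h1 hs2
  have e : ∀ r, (-1) ^ (r + 1) * ((a + r + 1).choose (r + 1) : ℚ_[p]) * hh y (a + r + 1) =
      (-1) ^ (r + 1) * ((a + (r + 1)).choose (r + 1) : ℚ_[p]) * hh y (a + (r + 1)) :=
    fun r => by rw [add_assoc]
  have hsum : Summable fun r : ℕ => (-1) ^ r * ((a + r).choose r : ℚ_[p]) * hh y (a + r) := by
    rw [← summable_nat_add_iff 1]
    exact hs2.congr fun r => (e r)
  rw [hsum.tsum_eq_zero_add]
  have h2 : ∑' r : ℕ, (-1) ^ (r + 1) * ((a + (r + 1)).choose (r + 1) : ℚ_[p]) * hh y (a + (r + 1))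
      = - y ^ (a + 1) := by
    rw [← tsum_congr e]
    refine h1.symm.trans ?_
    rw [tsum_eq_single 0]
    · simp [hterm]
      have : ((a : ℚ_[p]) + 1) ≠ 0 := by exact_mod_cast (Nat.succ_ne_zero a)
      field_simp
      ring
    · intro N hN
      have : ∀ rq ∈ Finset.HasAntidiagonal.antidiagonal N,
        (-1) ^ (rq.1 + 1) * ((a + rq.1 + 1).choose (rq.1 + 1) : ℚ_[p]) *
          hterm y (a + rq.1 + 1) rq.2 =
        ((-1) ^ (N + 1) * y ^ (a + N + 1) *
         (((a + N).factorial / (a.factorial * (N + 1).factorial) : ℚ) : ℚ_[p])) *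
         (((N + 1).choose rq.2 * bernoulli rq.2 : ℚ) : ℚ_[p]) := by
        intro rq hrq
        rw [Finset.HasAntidiagonal.mem_antidiagonal] at hrq
        have h3 := choose_aux a N rq.1 rq.2 hrq
        have h4 := congrArg (fun z : ℚ => (z : ℚ_[p])) h3
        push_cast at h4
        unfold hterm
        push_cast
        have e5 : a + rq.1 + 1 + rq.2 = a + N + 1 := by omega
        have e6 : (-1 : ℚ_[p]) ^ (N + 1) = (-1) ^ (rq.1 + 1) * (-1) ^ rq.2 := by
          rw [← pow_add]; congr 1; omega
        rw [e6]
        rw [e5] at h4 ⊢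
        calc _ = (-1) ^ (rq.1 + 1) * (-1) ^ rq.2 * y ^ (a + N + 1) * (bernoulli rq.2 : ℚ_[p]) *
            (((a + rq.1 + 1).choose (rq.1 + 1) : ℚ_[p]) * (((a + N + 1 - 1).choose rq.2 : ℕ) / ((a : ℚ_[p]) + rq.1 + 1))) := by ring
          _ = _ := by rw [h4]; ring
      rw [Finset.sum_congr rfl this, ← Finset.mul_sum]
      have h5 : ∑ rq ∈ Finset.HasAntidiagonal.antidiagonal N, ((N + 1).choose rq.2 * bernoulli rq.2 : ℚ) = 0 := by
        rw [Finset.Nat.sum_antidiagonal_eq_sum_range_succ_mk]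
        simp only
        rw [← Finset.sum_range_reflect]
        have := sum_bernoulli (N + 1)
        rw [if_neg (by omega)] at this
        rw [← this]
        refine Finset.sum_congr rfl fun k hk => ?_
        have : N - (N + 1 - 1 - k) = k := by
          rw [Finset.mem_range] at hk; omega
        simp only [Nat.succ_eq_add_one]
        rw [this]
      have h6 := congrArg (fun z : ℚ => (z : ℚ_[p])) h5
      push_cast at h6 ⊢
      rw [h6, mul_zero]
  rw [h2]
  simp; ring

end PZ

namespace PZ
variable {p : ℕ} [hp : Fact p.Prime]

/-- bounded Laurent series -/
def bddSub (p : ℕ) [Fact p.Prime] : Submodule ℚ_[p] (LaurentSeries ℚ_[p]) where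
  carrier := {F | ∃ c : ℝ, ∀ m, ‖F.coeff m‖ ≤ c}
  zero_mem' := ⟨0, fun m => by simp⟩
  add_mem' := by
    rintro F G ⟨c, hc⟩ ⟨d, hd⟩
    refine ⟨c + d, fun m => ?_⟩
    rw [HahnSeries.coeff_add]
    exact (norm_add_le _ _).trans (add_le_add (hc m) (hd m))
  smul_mem' := by
    rintro r F ⟨c, hc⟩
    refine ⟨‖r‖ * c, fun m => ?_⟩
    rw [HahnSeries.coeff_smul, smul_eq_mul, norm_mul]
    exact mul_le_mul_of_nonneg_left (hc m) (norm_nonneg _)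

lemma summable_mul_hh {y : ℚ_[p]} (hy : ‖y‖ < 1) {c : ℝ} {f : ℕ → ℚ_[p]} (hf : ∀ m, ‖f m‖ ≤ c) :
    Summable fun m => f m * hh y m := by
  refine Summable.of_norm ?_
  have h1 : Summable fun r : ℕ => c * ((p * (r : ℕ) : ℝ) * ‖y‖ ^ r) := by
    have := summable_pow_mul_geometric_of_norm_lt_one (R := ℝ) 1 (r := ‖y‖) (by simpa using hy)
    refine ((this.mul_left (p : ℝ)).mul_left c).congr fun r => ?_
    ring
  refine Summable.of_nonneg_of_le (fun _ => norm_nonneg _) (fun r => ?_) h1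
  rw [norm_mul]
  have := norm_hh_le hy r
  have h0 : 0 ≤ c := (norm_nonneg _).trans (hf 0)
  gcongr
  exact hf r

lemma exists_T {y : ℚ_[p]} (hy : ‖y‖ < 1) : ∃ T : LaurentSeries ℚ_[p] →ₗ[ℚ_[p]] ℚ_[p],
    ∀ F : LaurentSeries ℚ_[p], (∃ c : ℝ, ∀ m, ‖F.coeff m‖ ≤ c) →
      T F = ∑' m : ℕ, F.coeff ((m : ℤ) + 1) * hh y m := by
  let T0 : bddSub p →ₗ[ℚ_[p]] ℚ_[p] :=
    { toFun := fun F => ∑' m : ℕ, F.1.coeff ((m : ℤ) + 1) * hh y m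
      map_add' := by
        rintro ⟨F, c, hc⟩ ⟨G, d, hd⟩
        simp only [Submodule.coe_add, HahnSeries.coeff_add, add_mul]
        exact Summable.tsum_add (summable_mul_hh hy fun m => hc _)
          (summable_mul_hh hy fun m => hd _)
      map_smul' := by
        rintro r ⟨F, c, hc⟩
        simp only [Submodule.coe_smul, HahnSeries.coeff_smul, smul_eq_mul, mul_assoc,
          tsum_mul_left, RingHom.id_apply] }
  obtain ⟨T, hT⟩ := T0.exists_extend
  refine ⟨T, fun F hF => ?_⟩
  exact LinearMap.congr_fun hT ⟨F, hF⟩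

open Classical in
/-- the functional -/
noncomputable def TT (y : ℚ_[p]) : LaurentSeries ℚ_[p] →ₗ[ℚ_[p]] ℚ_[p] :=
  if hy : ‖y‖ < 1 then (exists_T hy).choose else 0

lemma TT_apply {y : ℚ_[p]} (hy : ‖y‖ < 1) {F : LaurentSeries ℚ_[p]} {c : ℝ}
    (hF : ∀ m, ‖F.coeff m‖ ≤ c) : TT y F = ∑' m : ℕ, F.coeff ((m : ℤ) + 1) * hh y m := by
  rw [TT, dif_pos hy]
  exact (exists_T hy).choose_spec F ⟨c, hF⟩

/-- the variable `t` -/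
noncomputable def tau (p : ℕ) [Fact p.Prime] : LaurentSeries ℚ_[p] := HahnSeries.single (-1 : ℤ) 1

lemma geom_inv (k : ℚ_[p]) :
    (1 + PowerSeries.C k * PowerSeries.X) * PowerSeries.mk (fun n => (-k) ^ n) = 1 := by
  ext n
  rw [add_mul, one_mul, map_add, mul_assoc, PowerSeries.coeff_C_mul]
  rcases n with _ | n
  · simp
  · rw [PowerSeries.coeff_succ_X_mul]
    simp [PowerSeries.coeff_one]
    ring

lemma tau_mul_X : tau p * HahnSeries.ofPowerSeries ℤ ℚ_[p] PowerSeries.X = 1 := by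
  rw [tau, HahnSeries.ofPowerSeries_X, HahnSeries.single_mul_single]
  simp

lemma tau_add_inv (k : ℚ_[p]) : (tau p + HahnSeries.C k)⁻¹ =
    HahnSeries.ofPowerSeries ℤ ℚ_[p] (PowerSeries.X * PowerSeries.mk (fun n => (-k) ^ n)) := by
  refine inv_eq_of_mul_eq_one_right ?_
  rw [map_mul, ← mul_assoc, add_mul, tau_mul_X]
  have : (1 : LaurentSeries ℚ_[p]) + HahnSeries.C k * HahnSeries.ofPowerSeries ℤ ℚ_[p] PowerSeries.X =
     HahnSeries.ofPowerSeries ℤ ℚ_[p] (1 + PowerSeries.C k * PowerSeries.X) := by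
    rw [map_add, map_mul, map_one, HahnSeries.ofPowerSeries_C]
  rw [this, ← map_mul, geom_inv, map_one]

lemma tau_add_ne_zero (k : ℚ_[p]) : tau p + HahnSeries.C k ≠ 0 := by
  intro h
  have := congrArg (fun F : LaurentSeries ℚ_[p] => F.coeff (-1)) h
  simp [tau, HahnSeries.C_apply] at this

lemma geom_pow (k : ℚ_[p]) (a : ℕ) : (PowerSeries.mk (fun n => (-k) ^ n)) ^ (a + 1) =
    PowerSeries.mk (fun n => ((a + n).choose n : ℚ_[p]) * (-k) ^ n) := by
  have h1 : PowerSeries.mk (fun n => (-k) ^ n) = PowerSeries.rescale (-k) (PowerSeries.mk 1) := by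
    ext n; simp
  rw [h1, ← map_pow, PowerSeries.mk_one_pow_eq_mk_choose_add]
  ext n
  simp only [PowerSeries.coeff_rescale, PowerSeries.coeff_mk]
  rw [Nat.choose_symm_add]; ring

lemma tau_inv_pow (k : ℚ_[p]) (a : ℕ) : ((tau p + HahnSeries.C k)⁻¹) ^ (a + 1) =
    HahnSeries.ofPowerSeries ℤ ℚ_[p] (PowerSeries.X ^ (a + 1) *
      PowerSeries.mk (fun n => ((a + n).choose n : ℚ_[p]) * (-k) ^ n)) := by
  rw [tau_add_inv, ← map_pow, mul_pow, geom_pow]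

lemma ofPS_coeff_nat (f : PowerSeries ℚ_[p]) (m : ℕ) :
    (HahnSeries.ofPowerSeries ℤ ℚ_[p] f).coeff (m : ℤ) = PowerSeries.coeff m f :=
  HahnSeries.ofPowerSeries_apply_coeff f m

lemma ofPS_coeff_neg (f : PowerSeries ℚ_[p]) (m : ℤ) (hm : m < 0) :
    (HahnSeries.ofPowerSeries ℤ ℚ_[p] f).coeff m = 0 := by
  rw [HahnSeries.ofPowerSeries_apply]
  apply HahnSeries.embDomain_of_notMem_range
  rintro ⟨n, hn⟩
  simp at hn
  omega

lemma ofPS_bdd {f : PowerSeries ℚ_[p]} {c : ℝ} (hc : 0 ≤ c) (hf : ∀ m, ‖PowerSeries.coeff m f‖ ≤ c)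
    (m : ℤ) : ‖(HahnSeries.ofPowerSeries ℤ ℚ_[p] f).coeff m‖ ≤ c := by
  rcases lt_or_ge m 0 with h | h
  · rw [ofPS_coeff_neg _ _ h]; simpa
  · lift m to ℕ using h
    rw [ofPS_coeff_nat]; exact hf m

lemma TT_ofPS {y : ℚ_[p]} (hy : ‖y‖ < 1) {f : PowerSeries ℚ_[p]} {c : ℝ} (hc : 0 ≤ c)
    (hf : ∀ m, ‖PowerSeries.coeff m f‖ ≤ c) :
    TT y (HahnSeries.ofPowerSeries ℤ ℚ_[p] f) = ∑' m : ℕ, PowerSeries.coeff (m + 1) f * hh y m := by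
  rw [TT_apply hy (ofPS_bdd hc hf)]
  refine tsum_congr fun m => ?_
  rw [← ofPS_coeff_nat]; push_cast; rfl

lemma TT_pole_eq {y : ℚ_[p]} (hy : ‖y‖ < 1) (k : ℚ_[p]) (hk : ‖k‖ ≤ 1) (a : ℕ) :
    TT y (((tau p + HahnSeries.C k)⁻¹) ^ (a + 1)) =
      ∑' e : ℕ, ((a + e).choose e : ℚ_[p]) * (-k) ^ e * hh y (a + e) := by
  have hb : ∀ n, ‖((a + n).choose n : ℚ_[p]) * (-k) ^ n‖ ≤ 1 := by
    intro n
    rw [norm_mul, norm_pow, norm_neg]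
    exact mul_le_one₀ (norm_nat_le_one _) (by positivity) (pow_le_one₀ (norm_nonneg _) hk)
  rw [tau_inv_pow, TT_ofPS hy zero_le_one]
  · have h1 : ∀ m < a, PowerSeries.coeff (m + 1) (PowerSeries.X ^ (a + 1) *
      PowerSeries.mk (fun n => ((a + n).choose n : ℚ_[p]) * (-k) ^ n)) = 0 := by
      intro m hm
      rw [PowerSeries.coeff_X_pow_mul', if_neg (by omega)]
    have hs := summable_mul_hh hy (c := 1) (f := fun m => PowerSeries.coeff (m + 1) (PowerSeries.X ^ (a + 1) *
      PowerSeries.mk (fun n => ((a + n).choose n : ℚ_[p]) * (-k) ^ n))) (by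
        intro m
        rw [PowerSeries.coeff_X_pow_mul']
        split_ifs
        · rw [PowerSeries.coeff_mk]; exact hb _
        · simp)
    rw [← hs.sum_add_tsum_nat_add a, Finset.sum_eq_zero, zero_add]
    · refine tsum_congr fun e => ?_
      rw [PowerSeries.coeff_X_pow_mul', if_pos (by omega)]
      have : e + a + 1 - (a + 1) = e := by omega
      rw [this, PowerSeries.coeff_mk, add_comm e a]
    · intro m hm
      rw [h1 m (Finset.mem_range.mp hm), zero_mul]
  · intro m
    rw [PowerSeries.coeff_X_pow_mul']
    split_ifs
    · rw [PowerSeries.coeff_mk]; exact hb _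
    · simp

lemma choose_aux2 (a e r : ℕ) : (a + e).choose e * (a + e + r).choose r =
    (a + (e + r)).choose (e + r) * (e + r).choose e := by
  have h1 : ((a + e).choose e : ℚ) * (a + e + r).choose r =
    (a + (e + r)).choose (e + r) * (e + r).choose e := by
    rw [← Nat.choose_symm_add, ← Nat.choose_symm_add, ← Nat.choose_symm_add (a := a)]
    rw [Nat.cast_add_choose, Nat.cast_add_choose, Nat.cast_add_choose, Nat.cast_add_choose]
    have := Nat.factorial_ne_zero
    have h1 : ((a + e).factorial : ℚ) ≠ 0 := by exact_mod_cast this _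
    have h2 : ((e + r).factorial : ℚ) ≠ 0 := by exact_mod_cast this _
    have h3 : ((r).factorial : ℚ) ≠ 0 := by exact_mod_cast this _
    have h4 : ((a).factorial : ℚ) ≠ 0 := by exact_mod_cast this _
    have h5 : ((e).factorial : ℚ) ≠ 0 := by exact_mod_cast this _
    rw [← add_assoc a e r]
    field_simp
  exact_mod_cast h1

lemma hasSum_geom_pow {x : ℚ_[p]} (hx : 1 < ‖x‖) (k : ℚ_[p]) (hk : ‖k‖ ≤ 1) (a : ℕ) :
    ∑' e : ℕ, ((a + e).choose e : ℚ_[p]) * (-k) ^ e * (x⁻¹) ^ (a + e + 1) = ((x + k)⁻¹) ^ (a + 1) := by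
  have hx0 : x ≠ 0 := by rintro rfl; simp at hx; linarith
  have h1 : ‖-k * x⁻¹‖ < 1 := by
    rw [norm_mul, norm_neg, norm_inv]
    calc _ ≤ 1 * ‖x‖⁻¹ := by gcongr
      _ < 1 := by rw [one_mul]; exact inv_lt_one_of_one_lt₀ hx
  have h2 := tsum_choose_mul_geometric_of_norm_lt_one a h1
  have h3 : (x + k) ≠ 0 := by
    intro h
    have : x = -k := by linear_combination h
    rw [this, norm_neg] at hx
    linarith
  calc _ = ∑' e : ℕ, (x⁻¹) ^ (a + 1) * (((e + a).choose a : ℚ_[p]) * (-k * x⁻¹) ^ e) := by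
        refine tsum_congr fun e => ?_
        rw [← Nat.choose_symm_add, mul_pow, add_comm e a]
        ring
    _ = _ := by
      rw [tsum_mul_left, h2]
      have h4 : 1 - -k * x⁻¹ = (x + k) * x⁻¹ := by field_simp; ring
      rw [h4, mul_pow, one_div, mul_inv, ← inv_pow, ← inv_pow, inv_inv]
      have h5 : x ^ (a + 1) ≠ 0 := pow_ne_zero _ hx0
      rw [inv_pow x]; field_simp

/-- the shift identity -/
lemma TT_shift {x : ℚ_[p]} (hx : 1 < ‖x‖) (k : ℚ_[p]) (hk : ‖k‖ ≤ 1) (a : ℕ) :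
    TT x⁻¹ (((tau p + HahnSeries.C (k + 1))⁻¹) ^ (a + 1)) =
    TT x⁻¹ (((tau p + HahnSeries.C k)⁻¹) ^ (a + 1)) - ((x + k)⁻¹) ^ (a + 1) := by
  have hy : ‖x⁻¹‖ < 1 := by rw [norm_inv]; exact inv_lt_one_of_one_lt₀ hx
  have hk1 : ‖k + 1‖ ≤ 1 := (Padic.nonarchimedean _ _).trans (max_le hk (by simp))
  rw [TT_pole_eq hy _ hk1, TT_pole_eq hy _ hk, ← hasSum_geom_pow hx k hk]
  set y := x⁻¹
  -- double family
  let f : ℕ × ℕ → ℚ_[p] := fun er => ((a + er.1).choose er.1 : ℚ_[p]) * (-k) ^ er.1 *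
    ((-1) ^ er.2 * ((a + er.1 + er.2).choose er.2 : ℚ_[p]) * hh y (a + er.1 + er.2))
  have hb : ∀ n, ‖((a + n).choose n : ℚ_[p]) * (-k) ^ n‖ ≤ 1 := by
    intro n
    rw [norm_mul, norm_pow, norm_neg]
    exact mul_le_one₀ (norm_nat_le_one _) (by positivity) (pow_le_one₀ (norm_nonneg _) hk)
  have hs : Summable f := by
    refine Summable.of_norm ?_
    have h1 : Summable fun r : ℕ => ((a + r + 1 : ℕ) : ℝ) * ‖y‖ ^ r := by
      have := summable_pow_mul_geometric_of_norm_lt_one (R := ℝ) 1 (r := ‖y‖) (by simpa using hy)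
      have h2 := (summable_geometric_of_lt_one (norm_nonneg _) hy).mul_left (a + 1 : ℝ)
      refine (this.add h2).congr fun r => ?_
      push_cast; ring
    have h3 := (h1.mul_of_nonneg h1 (fun r => by positivity) (fun r => by positivity)).mul_left (p : ℝ)
    refine Summable.of_nonneg_of_le (fun _ => norm_nonneg _) (fun er => ?_) h3
    simp only [f]
    rw [norm_mul, norm_mul ((-1) ^ er.2 * _), norm_mul ((-1) ^ er.2), norm_pow, norm_neg, norm_one, one_pow, one_mul]
    calc _ ≤ 1 * (1 * (p * (a + er.1 + er.2 : ℕ) * ‖y‖ ^ (a + er.1 + er.2))) := by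
          gcongr
          · exact hb _
          · exact norm_nat_le_one _
          · exact norm_hh_le hy _
      _ ≤ p * ((((a + er.1 + 1 : ℕ) : ℝ) * ((a + er.2 + 1 : ℕ) : ℝ)) * (‖y‖ ^ (er.1 + er.2))) := by
          rw [one_mul, one_mul, mul_assoc]
          gcongr _ * (?_ * ?_)
          · rw [← Nat.cast_mul]
            norm_cast
            nlinarith [Nat.zero_le (a*a), Nat.zero_le (a * er.1), Nat.zero_le (a * er.2), Nat.zero_le (er.1 * er.2)]
          · exact pow_le_pow_of_le_one (norm_nonneg _) hy.le (by omega)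
      _ = _ := by rw [pow_add]; ring
  have h1 := hasSum_antidiag hs
  have hL : ∀ n, ∑ q ∈ Finset.HasAntidiagonal.antidiagonal n, f q =
      ((a + n).choose n : ℚ_[p]) * (-(k + 1)) ^ n * hh y (a + n) := by
    intro n
    have h2 : -(k + 1) = -k + -1 := by ring
    rw [h2, Commute.add_pow' (Commute.all _ _), Finset.mul_sum, Finset.sum_mul]
    refine Finset.sum_congr rfl fun q hq => ?_
    have hq : q.1 + q.2 = n := Finset.HasAntidiagonal.mem_antidiagonal.mp hq
    have h3 := congrArg (fun z : ℕ => (z : ℚ_[p])) (choose_aux2 a q.1 q.2)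
    push_cast at h3
    subst hq
    simp only [f, nsmul_eq_mul]
    rw [← add_assoc a q.1 q.2] at *
    linear_combination ((-k) ^ q.1 * (-1) ^ q.2 * hh y (a + q.1 + q.2)) * h3
  have hR : ∀ e, ∑' r, f (e, r) = ((a + e).choose e : ℚ_[p]) * (-k) ^ e * hh y (a + e) -
      ((a + e).choose e : ℚ_[p]) * (-k) ^ e * y ^ (a + e + 1) := by
    intro e
    simp only [f]
    rw [tsum_mul_left, key_identity hy]
    ring
  rw [tsum_congr hL, tsum_congr hR] at h1
  rw [h1, Summable.tsum_sub]
  · have := summable_mul_hh (p := p) hy (c := 1) (f := fun m => if a ≤ m then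
       (((a + (m - a)).choose (m - a) : ℚ_[p]) * (-k) ^ (m - a)) else 0) (by
        intro m; split_ifs
        · exact hb _
        · simp)
    refine ((summable_nat_add_iff a).mpr this).congr fun e => ?_
    rw [if_pos (by omega)]
    simp [add_comm]
  · refine Summable.of_norm ?_
    refine Summable.of_nonneg_of_le (fun _ => norm_nonneg _) (fun e => ?_)
      (summable_geometric_of_lt_one (norm_nonneg _) hy)
    rw [norm_mul, norm_pow]
    calc _ ≤ 1 * ‖y‖ ^ e := by
          gcongr ?_ * ?_
          · exact hb e
          · exact pow_le_pow_of_le_one (norm_nonneg _) hy.le (by omega)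
      _ = _ := one_mul _

/-- value at `t^{-i}` -/
lemma TT_tau_pow {y : ℚ_[p]} (hy : ‖y‖ < 1) (a : ℕ) : TT y ((tau p)⁻¹ ^ (a + 1)) = hh y a := by
  have := TT_pole_eq hy (0 : ℚ_[p]) (by simp) a
  rw [map_zero, add_zero] at this
  rw [this, tsum_eq_single 0]
  · simp
  · intro b hb; simp [hb]

lemma TT_pole_nat {x : ℚ_[p]} (hx : 1 < ‖x‖) (k : ℕ) (a : ℕ) :
    TT x⁻¹ (((tau p + HahnSeries.C (k : ℚ_[p]))⁻¹) ^ (a + 1)) =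
    hh x⁻¹ a - ∑ l ∈ Finset.range k, ((x + l)⁻¹) ^ (a + 1) := by
  have hy : ‖x⁻¹‖ < 1 := by rw [norm_inv]; exact inv_lt_one_of_one_lt₀ hx
  induction k with
  | zero => simpa using TT_tau_pow hy a
  | succ k ih =>
    rw [Finset.sum_range_succ]
    push_cast
    rw [TT_shift hx _ (norm_nat_le_one k), ih]
    ring

/-- bound -/
lemma norm_TT_le {y : ℚ_[p]} {l : ℕ} (hl : 1 ≤ l) (hy : ‖y‖ ≤ ((p : ℝ) ^ l)⁻¹) {c : ℝ}
    {f : PowerSeries ℚ_[p]} (M : ℕ) (hf : ∀ m, ‖PowerSeries.coeff m f‖ ≤ c) :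
    ‖TT y (HahnSeries.ofPowerSeries ℤ ℚ_[p] (PowerSeries.X ^ (M + 1) * f))‖ ≤
     c * (p * ((M + 1) * (((p : ℝ) ^ l)⁻¹) ^ M)) := by
  have hc : 0 ≤ c := (norm_nonneg _).trans (hf 0)
  have hp2 : (2 : ℝ) ≤ p := by exact_mod_cast hp.1.two_le
  have hpl : (2 : ℝ) ≤ (p : ℝ) ^ l := by
    calc (2 : ℝ) ≤ (p : ℝ) ^ 1 := by rw [pow_one]; exact hp2
      _ ≤ _ := pow_le_pow_right₀ (by linarith) hl
  set z := ((p : ℝ) ^ l)⁻¹ with hz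
  have hz0 : 0 < z := by positivity
  have hz2 : z ≤ 1 / 2 := by rw [hz, one_div]; gcongr
  have hy1 : ‖y‖ < 1 := by linarith
  rw [TT_ofPS hy1 hc]
  · refine IsUltrametricDist.norm_tsum_le_of_forall_le_of_nonneg (by positivity) fun m => ?_
    rw [PowerSeries.coeff_X_pow_mul']
    split_ifs with h
    · rw [norm_mul]
      have h1 : ‖hh y m‖ ≤ p * m * z ^ m := (norm_hh_le hy1 m).trans (by gcongr)
      have h2 : ∀ d : ℕ, ((M + d : ℕ) : ℝ) * z ^ (M + d) ≤ (M + 1) * z ^ M := by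
        intro d
        rcases d with _ | d
        · simp only [add_zero]
          gcongr; linarith
        · induction d with
          | zero =>
            push_cast
            rw [pow_succ]
            have : 0 ≤ (M + 1) * z ^ M := by positivity
            nlinarith
          | succ d ih =>
            refine le_trans ?_ ih
            rw [← add_assoc, pow_succ]
            push_cast
            have h3 : (0 : ℝ) ≤ z ^ (M + (d + 1)) := by positivity
            have : ((M : ℝ) + (d + 1) + 1) * z ≤ M + (d + 1) := by
              have : (0 : ℝ) ≤ M := by positivity
              have : (0 : ℝ) ≤ d := by positivity
              nlinarith
            nlinarith
      obtain ⟨d, rfl⟩ : ∃ d, m = M + d := ⟨m - M, by omega⟩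
      have h3 := h2 d
      calc _ ≤ c * (p * (M + d : ℕ) * z ^ (M + d)) := by
            gcongr
            exact hf _
        _ = c * (p * (((M + d : ℕ) : ℝ) * z ^ (M + d))) := by ring
        _ ≤ _ := by gcongr
    · simp only [zero_mul, norm_zero]; positivity
  · intro m
    rw [PowerSeries.coeff_X_pow_mul']
    split_ifs
    · exact hf _
    · simpa
end PZ

namespace PZ

/-- `b^n B_n(a/b)` -/
noncomputable def EE (n a b : ℕ) : ℚ :=
  ∑ i ∈ Finset.range (n + 1), (n.choose i : ℚ) * bernoulli i * (b : ℚ) ^ i * (a : ℚ) ^ (n - i)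

lemma EE_coeff (n a b : ℕ) : PowerSeries.coeff n (PowerSeries.rescale (b : ℚ) (bernoulliPowerSeries ℚ) *
    (PowerSeries.exp ℚ) ^ a) = EE n a b / n.factorial := by
  rw [PowerSeries.exp_pow_eq_rescale_exp, PowerSeries.coeff_mul,
    Finset.Nat.sum_antidiagonal_eq_sum_range_succ_mk, EE, Finset.sum_div]
  refine Finset.sum_congr rfl fun i hi => ?_
  have hi : i ≤ n := by rw [Finset.mem_range] at hi; omega
  simp only [PowerSeries.coeff_rescale, bernoulliPowerSeries, PowerSeries.coeff_mk,
    PowerSeries.coeff_exp, Algebra.algebraMap_self, RingHom.id_apply]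
  rw [Nat.cast_choose ℚ hi]
  have h1 : (n.factorial : ℚ) ≠ 0 := by exact_mod_cast n.factorial_ne_zero
  have h2 : (i.factorial : ℚ) ≠ 0 := by exact_mod_cast i.factorial_ne_zero
  have h3 : ((n - i).factorial : ℚ) ≠ 0 := by exact_mod_cast (n - i).factorial_ne_zero
  field_simp

lemma sum_EE (n b : ℕ) : ∑ a ∈ Finset.range b, EE n a b = b * bernoulli n := by
  have hne : PowerSeries.exp ℚ - 1 ≠ 0 := by
    intro h
    have := congrArg (PowerSeries.coeff 1) h
    simp [PowerSeries.coeff_exp, PowerSeries.coeff_one] at this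
  have h1 : (∑ a ∈ Finset.range b, PowerSeries.rescale (b : ℚ) (bernoulliPowerSeries ℚ) *
    (PowerSeries.exp ℚ) ^ a) = (b : PowerSeries ℚ) * bernoulliPowerSeries ℚ := by
    apply mul_right_cancel₀ hne
    rw [mul_assoc, bernoulliPowerSeries_mul_exp_sub_one, ← Finset.mul_sum, mul_assoc,
      geom_sum_mul, PowerSeries.exp_pow_eq_rescale_exp]
    have h2 : PowerSeries.rescale (b : ℚ) (PowerSeries.exp ℚ) - 1 =
      PowerSeries.rescale (b : ℚ) (PowerSeries.exp ℚ - 1) := by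
      rw [map_sub, map_one]
    rw [h2, ← map_mul, bernoulliPowerSeries_mul_exp_sub_one, PowerSeries.rescale_X]
    simp
  have h2 := congrArg (PowerSeries.coeff n) h1
  rw [map_sum, Finset.sum_congr rfl (fun a _ => EE_coeff n a b), ← Finset.sum_div] at h2
  have h3 : PowerSeries.coeff n ((b : PowerSeries ℚ) * bernoulliPowerSeries ℚ) =
     b * bernoulli n / n.factorial := by
    have : (b : PowerSeries ℚ) = PowerSeries.C (b : ℚ) := by simp
    rw [this, PowerSeries.coeff_C_mul]
    simp [bernoulliPowerSeries]; ring
  rw [h3] at h2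
  have h1 : (n.factorial : ℚ) ≠ 0 := by exact_mod_cast n.factorial_ne_zero
  field_simp at h2
  exact h2

lemma EE_mul (n a b c : ℕ) : EE n (c * a) (c * b) = c ^ n * EE n a b := by
  unfold EE
  rw [Finset.mul_sum]
  refine Finset.sum_congr rfl fun i hi => ?_
  have hi : i ≤ n := by rw [Finset.mem_range] at hi; omega
  have : (c : ℚ) ^ n = c ^ i * c ^ (n - i) := by rw [← pow_add]; congr 1; omega
  rw [this]; push_cast; rw [mul_pow, mul_pow]; ring

lemma sum_EE_coprime (p : ℕ) (hp : p ≠ 0) (n b : ℕ) (hn : 1 ≤ n) (hb : p ∣ b) :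
    ∑ a ∈ Finset.range b with ¬ p ∣ a, EE n a b = b * (1 - (p : ℚ) ^ (n - 1)) * bernoulli n := by
  obtain ⟨c, rfl⟩ := hb
  have h1 := sum_EE n (p * c)
  rw [← Finset.sum_filter_add_sum_filter_not _ (fun a => p ∣ a)] at h1
  have h2 : ∑ a ∈ Finset.range (p * c) with p ∣ a, EE n a (p * c) =
      ∑ a ∈ Finset.range c, EE n (p * a) (p * c) := by
    symm
    refine Finset.sum_bij (fun a _ => p * a) ?_ ?_ ?_ ?_
    · intro a ha
      simp only [Finset.mem_filter, Finset.mem_range] at *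
      exact ⟨Nat.mul_lt_mul_of_pos_left ha (Nat.pos_of_ne_zero hp), dvd_mul_right _ _⟩
    · intro a _ b _ h
      exact Nat.eq_of_mul_eq_mul_left (Nat.pos_of_ne_zero hp) h
    · intro a ha
      simp only [Finset.mem_filter, Finset.mem_range] at ha
      obtain ⟨hac, d, rfl⟩ := ha
      exact ⟨d, Finset.mem_range.mpr (lt_of_mul_lt_mul_left hac (Nat.zero_le _)), rfl⟩
    · intros; rfl
  rw [h2, Finset.sum_congr rfl (fun a _ => EE_mul n a c p), ← Finset.mul_sum, sum_EE] at h1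
  have h3 : (p : ℚ) ^ n = p * p ^ (n - 1) := by rw [← pow_succ']; congr 1; omega
  rw [h3] at h1
  push_cast at h1 ⊢
  linear_combination h1


lemma pow_ge {p : ℕ} (hpp : p.Prime) (m : ℕ) : m < (p - 1) * p ^ m := by
  have h1 : 1 ≤ p - 1 := by have := hpp.two_le; omega
  calc m < p ^ m := Nat.lt_pow_self hpp.one_lt
    _ ≤ _ := Nat.le_mul_of_pos_left _ h1

variable {p : ℕ} [hp : Fact p.Prime]

lemma tendsto_pow_one (a : ℕ) (ha : ¬ p ∣ a) :
    Tendsto (fun m : ℕ => (a : ℚ_[p]) ^ ((p - 1) * p ^ m)) atTop (nhds 1) := by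
  rw [tendsto_iff_norm_sub_tendsto_zero]
  have hp1 : (1 : ℝ) < p := by exact_mod_cast hp.1.one_lt
  refine squeeze_zero (fun _ => norm_nonneg _) (g := fun m : ℕ => ((p : ℝ)⁻¹) ^ (m + 1)) ?_ ?_
  · intro m
    have h1 : a ^ (Nat.totient (p ^ (m + 1))) ≡ 1 [MOD p ^ (m + 1)] :=
      Nat.ModEq.pow_totient ((Nat.Coprime.pow_left _ ((Nat.Prime.coprime_iff_not_dvd hp.1).mpr ha)).symm)
    rw [Nat.totient_prime_pow_succ hp.1] at h1
    have h2 := (Nat.modEq_iff_dvd.mp h1.symm)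
    have h3 := (Padic.norm_int_le_pow_iff_dvd (p := p) _ (m + 1)).mpr (by exact_mod_cast h2)
    have e : (p - 1) * p ^ m = p ^ m * (p - 1) := mul_comm _ _
    rw [e]
    push_cast at h3
    rw [zpow_neg] at h3
    rw [inv_pow]
    exact_mod_cast h3
  · exact (tendsto_pow_atTop_nhds_zero_of_lt_one (by positivity) (inv_lt_one_of_one_lt₀ hp1)).comp
      (tendsto_add_atTop_nat 1)

/-- the index -/
def nm (p j m : ℕ) : ℕ := (p - 1) * p ^ m + 1 - j

lemma nm_add (j m : ℕ) (h : j ≤ m) : nm p j m + j = (p - 1) * p ^ m + 1 := by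
  have := pow_ge hp.1 m
  unfold nm; omega

lemma nm_ge (j m : ℕ) (h : j ≤ m) : m ≤ nm p j m + j := by
  have := pow_ge hp.1 m
  unfold nm; omega

lemma tendsto_p_pow : Tendsto (fun m : ℕ => (p : ℚ_[p]) ^ m) atTop (nhds 0) :=
  tendsto_pow_atTop_nhds_zero_of_norm_lt_one Padic.norm_p_lt_one

lemma tendsto_nm (j : ℕ) : Tendsto (fun m : ℕ => ((nm p j m : ℕ) : ℚ_[p])) atTop (nhds (1 - j)) := by
  have h1 : Tendsto (fun m : ℕ => ((p - 1 : ℕ) : ℚ_[p]) * (p : ℚ_[p]) ^ m + 1 - j) atTop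
      (nhds (((p - 1 : ℕ) : ℚ_[p]) * 0 + 1 - j)) :=
    ((tendsto_p_pow.const_mul _).add_const _).sub_const _
  simp only [mul_zero, zero_add] at h1
  refine h1.congr' ?_
  filter_upwards [eventually_ge_atTop j] with m hm
  have h2 := congrArg (fun z : ℕ => (z : ℚ_[p])) (nm_add (p := p) j m hm)
  push_cast at h2 ⊢
  linear_combination -h2

lemma choose_eq_prod (n i : ℕ) : ((n.choose i : ℕ) : ℚ_[p]) =
    (∏ r ∈ Finset.range i, ((n : ℚ_[p]) - r)) / i.factorial := by
  have h1 : (i.factorial : ℚ_[p]) ≠ 0 := by exact_mod_cast i.factorial_ne_zero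
  rw [eq_div_iff h1, ← descPochhammer_eval_eq_prod_range, descPochhammer_eval_eq_descFactorial,
    Nat.descFactorial_eq_factorial_mul_choose]
  push_cast; ring

lemma tendsto_choose (j i : ℕ) (hj : 1 ≤ j) : Tendsto (fun m : ℕ => (((nm p j m).choose i : ℕ) : ℚ_[p])) atTop
    (nhds ((-1) ^ i * ((j - 1 + i - 1).choose i : ℕ))) := by
  have h1 : Tendsto (fun m : ℕ => (∏ r ∈ Finset.range i, (((nm p j m : ℕ) : ℚ_[p]) - r)) / i.factorial) atTop
     (nhds ((∏ r ∈ Finset.range i, ((1 - j : ℚ_[p]) - r)) / i.factorial)) := by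
    refine Tendsto.div_const ?_ _
    exact tendsto_finsetProd _ fun r _ => (tendsto_nm j).sub_const _
  have h2 : (∏ r ∈ Finset.range i, ((1 - j : ℚ_[p]) - r)) / i.factorial =
      (-1) ^ i * ((j - 1 + i - 1).choose i : ℕ) := by
    have h1 : (i.factorial : ℚ_[p]) ≠ 0 := by exact_mod_cast i.factorial_ne_zero
    rw [div_eq_iff h1, mul_assoc, mul_comm _ (i.factorial : ℚ_[p]), ← Nat.cast_mul,
      ← Nat.ascFactorial_eq_factorial_mul_choose', Nat.ascFactorial_eq_prod_range, Nat.cast_prod]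
    have : (-1 : ℚ_[p]) ^ i = ∏ r ∈ Finset.range i, (-1) := by simp
    rw [this, ← Finset.prod_mul_distrib]
    refine Finset.prod_congr rfl fun r _ => ?_
    push_cast [hj]
    ring
  rw [h2] at h1
  exact h1.congr fun m => (choose_eq_prod _ _).symm

lemma tendsto_EE (j a b : ℕ) (hj : 2 ≤ j) (hb0 : b ≠ 0) (hb : p ∣ b) (ha : ¬ p ∣ a) :
    Tendsto (fun m : ℕ => ((EE (nm p j m) a b : ℚ) : ℚ_[p])) atTop
      (nhds (((j : ℚ_[p]) - 1) * ((b : ℚ_[p]) ^ (j - 1))⁻¹ * hh ((b : ℚ_[p]) / (a : ℚ_[p])) (j - 1))) := by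
  have hp1 : (1 : ℝ) < p := by exact_mod_cast hp.1.one_lt
  have han : ‖(a : ℚ_[p])‖ = 1 := by
    rw [Padic.norm_natCast_eq_one_iff]; exact (Nat.Prime.coprime_iff_not_dvd hp.1).mpr ha
  have ha0 : (a : ℚ_[p]) ≠ 0 := by intro h; rw [h] at han; simp at han
  have hb1 : (b : ℚ_[p]) ≠ 0 := by exact_mod_cast hb0
  have hbn : ‖(b : ℚ_[p])‖ ≤ (p : ℝ)⁻¹ := by
    have := (Padic.norm_int_le_pow_iff_dvd (p := p) (b : ℤ) 1).mpr (by exact_mod_cast (by simpa using hb))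
    simpa using this
  have hE : ∀ m, ((EE (nm p j m) a b : ℚ) : ℚ_[p]) = ∑' i : ℕ, (((nm p j m).choose i : ℕ) : ℚ_[p]) *
      ((bernoulli i : ℚ) : ℚ_[p]) * (b : ℚ_[p]) ^ i * ((a : ℚ_[p]) ^ (nm p j m) * (a : ℚ_[p])⁻¹ ^ i) := by
    intro m
    rw [tsum_eq_sum (s := Finset.range (nm p j m + 1)), EE]
    · push_cast
      refine Finset.sum_congr rfl fun i hi => ?_
      have hi : i ≤ nm p j m := by rw [Finset.mem_range] at hi; omega
      rw [pow_sub₀ _ ha0 hi, inv_pow]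
    · intro i hi
      rw [Finset.mem_range, not_lt] at hi
      rw [Nat.choose_eq_zero_of_lt (by omega)]; simp
  have hlim : ((j : ℚ_[p]) - 1) * ((b : ℚ_[p]) ^ (j - 1))⁻¹ * hh ((b : ℚ_[p]) / (a : ℚ_[p])) (j - 1) =
     ∑' i : ℕ, ((-1) ^ i * ((j - 1 + i - 1).choose i : ℕ)) *
      ((bernoulli i : ℚ) : ℚ_[p]) * (b : ℚ_[p]) ^ i * ((a : ℚ_[p])⁻¹ ^ (j - 1) * (a : ℚ_[p])⁻¹ ^ i) := by
    rw [hh, ← tsum_mul_left]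
    refine tsum_congr fun i => ?_
    rw [hterm]
    have : ((j - 1 : ℕ) : ℚ_[p]) = j - 1 := by push_cast [show 1 ≤ j by omega]; rfl
    have h1 : ((j : ℚ_[p]) - 1) ≠ 0 := by
      rw [← this]; exact_mod_cast (by omega)
    rw [this, div_pow, pow_add, pow_add, inv_pow, inv_pow]
    field_simp
  rw [hlim]
  simp_rw [hE]
  refine tendsto_tsum_of_dominated_convergence (bound := fun i : ℕ => (p : ℝ) * ((p : ℝ)⁻¹) ^ i) ?_ ?_ ?_
  · exact (summable_geometric_of_lt_one (by positivity) (inv_lt_one_of_one_lt₀ hp1)).mul_left _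
  · intro i
    refine ((tendsto_choose j i (by omega)).mul_const _ |>.mul_const _).mul (Tendsto.mul_const _ ?_)
    have h1 := (tendsto_pow_one (p := p) a ha).mul_const ((a : ℚ_[p])⁻¹ ^ (j - 1))
    rw [one_mul] at h1
    refine h1.congr' ?_
    filter_upwards [eventually_ge_atTop j] with m hm
    have h2 : nm p j m + (j - 1) = (p - 1) * p ^ m := by
      have := nm_add (p := p) j m hm; omega
    rw [← h2, pow_add, inv_pow, mul_assoc, mul_inv_cancel₀ (pow_ne_zero _ ha0), mul_one]
  · refine Eventually.of_forall fun m i => ?_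
    simp only [norm_mul, norm_pow, norm_inv, han, one_pow, inv_one, mul_one]
    calc _ ≤ 1 * (p : ℝ) * ((p : ℝ)⁻¹) ^ i := by
          gcongr
          · exact norm_nat_le_one _
          · exact norm_bernoulli_le _
      _ = _ := by ring

/-- the limit defining `ζ_p(j)` -/
theorem tendsto_zeta (j b : ℕ) (hj : 2 ≤ j) (hb0 : b ≠ 0) (hb : p ∣ b) :
    Tendsto (fun m : ℕ => ((zetaNegVal p j m : ℚ) : ℚ_[p])) atTop
      (nhds (((b : ℚ_[p]) ^ j)⁻¹ * ∑ a ∈ Finset.range b with ¬ p ∣ a, hh ((b : ℚ_[p]) / (a : ℚ_[p])) (j - 1))) := by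
  have h1 : Tendsto (fun m : ℕ => ∑ a ∈ Finset.range b with ¬ p ∣ a, ((EE (nm p j m) a b : ℚ) : ℚ_[p])) atTop
    (nhds (∑ a ∈ Finset.range b with ¬ p ∣ a,
      (((j : ℚ_[p]) - 1) * ((b : ℚ_[p]) ^ (j - 1))⁻¹ * hh ((b : ℚ_[p]) / (a : ℚ_[p])) (j - 1)))) :=
    tendsto_finsetSum _ fun a ha => tendsto_EE j a b hj hb0 hb (Finset.mem_filter.mp ha).2
  have hb1 : (b : ℚ_[p]) ≠ 0 := by exact_mod_cast hb0
  have hq : Tendsto (fun m => nm p j m - 1) atTop atTop := by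
    refine tendsto_atTop.mpr fun k => ?_
    filter_upwards [eventually_ge_atTop (j + k + 1)] with m hm
    have := nm_ge (p := p) j m (by omega)
    omega
  have h2 : Tendsto (fun m : ℕ => -((b : ℚ_[p]) * (1 - (p : ℚ_[p]) ^ (nm p j m - 1)) * (nm p j m : ℕ))) atTop
      (nhds (-((b : ℚ_[p]) * (1 - 0) * (1 - j)))) :=
    (((tendsto_const_nhds.sub (tendsto_p_pow.comp hq)).const_mul _).mul (tendsto_nm j)).neg
  have hj1 : ((j : ℚ_[p]) - 1) ≠ 0 := by
    have : ((j - 1 : ℕ) : ℚ_[p]) = j - 1 := by push_cast [show 1 ≤ j by omega]; rfl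
    rw [← this]; exact_mod_cast (by omega)
  have h3 : -((b : ℚ_[p]) * (1 - 0) * (1 - j)) = b * (j - 1) := by ring
  rw [h3] at h2
  have h4 := h1.div h2 (mul_ne_zero hb1 hj1)
  have h5 : (∑ a ∈ Finset.range b with ¬ p ∣ a,
      (((j : ℚ_[p]) - 1) * ((b : ℚ_[p]) ^ (j - 1))⁻¹ * hh ((b : ℚ_[p]) / (a : ℚ_[p])) (j - 1))) / (b * (j - 1)) =
      (((b : ℚ_[p]) ^ j)⁻¹ * ∑ a ∈ Finset.range b with ¬ p ∣ a, hh ((b : ℚ_[p]) / (a : ℚ_[p])) (j - 1)) := by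
    rw [← Finset.mul_sum]
    have : (b : ℚ_[p]) ^ j = b ^ (j - 1) * b := by rw [← pow_succ]; congr 1; omega
    rw [this]
    field_simp
  rw [h5] at h4
  refine h4.congr' ?_
  filter_upwards [eventually_ge_atTop (j + 2)] with m hm
  have hn : 2 ≤ nm p j m := by
    have := nm_ge (p := p) j m (by omega)
    omega
  have h6 := congrArg (fun z : ℚ => (z : ℚ_[p])) (sum_EE_coprime p hp.1.ne_zero (nm p j m) b (by omega) hb)
  push_cast at h6
  rw [Pi.div_apply, h6, zetaNegVal]
  have hnz : ((nm p j m : ℕ) : ℚ_[p]) ≠ 0 := by exact_mod_cast (by omega)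
  have h7 : (1 - (p : ℚ_[p]) ^ (nm p j m - 1)) ≠ 0 := by
    intro h
    have h8 : ‖(p : ℚ_[p]) ^ (nm p j m - 1)‖ < 1 := by
      rw [norm_pow]; exact pow_lt_one₀ (norm_nonneg _) Padic.norm_p_lt_one (by omega)
    rw [sub_eq_zero] at h
    rw [← h, norm_one] at h8
    exact lt_irrefl _ h8
  have h9 : (p - 1) * p ^ m + 1 - j = nm p j m := rfl
  rw [h9]
  push_cast
  field_simp

lemma zeta_even (j : ℕ) (hj : Even j) :
    Tendsto (fun m : ℕ => ((zetaNegVal p j m : ℚ) : ℚ_[p])) atTop (nhds 0) := by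
  refine tendsto_const_nhds.congr' ?_
  filter_upwards [eventually_ge_atTop (j + 2)] with m hm
  have h1 := nm_add (p := p) j m (by omega)
  have h2 := nm_ge (p := p) j m (by omega)
  have h3 : Even ((p - 1) * p ^ m) := by
    rcases hp.1.eq_two_or_odd' with rfl | h
    · rw [Nat.even_mul]; right; rw [Nat.even_pow]; exact ⟨even_two, by omega⟩
    · rw [Nat.even_mul]; left; obtain ⟨k, hk⟩ := h; exact ⟨k, by omega⟩
  have h4 : Odd (nm p j m) := by
    obtain ⟨c, hc⟩ := hj; obtain ⟨d, hd⟩ := h3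
    exact ⟨d - c, by omega⟩
  have h9 : (p - 1) * p ^ m + 1 - j = nm p j m := rfl
  rw [zetaNegVal, h9, bernoulli_eq_zero_of_odd h4 (by have := h4.pos; omega)]
  simp

end PZ

namespace PZ
open Polynomial

/-- shifted cofactor -/
noncomputable def cof (I : Finset ℤ) (s : ℕ) (k : ℤ) : ℚ[X] :=
  ∏ k' ∈ I.erase k, (X + C ((k' : ℚ) - k)) ^ s

/-- local expansion at `-k` -/
noncomputable def locG (I : Finset ℤ) (s : ℕ) (N : ℚ[X]) (k : ℤ) : PowerSeries ℚ :=
  ((N.comp (X - C (k : ℚ)) : ℚ[X]) : PowerSeries ℚ) * ((cof I s k : ℚ[X]) : PowerSeries ℚ)⁻¹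

/-- partial fraction coefficients -/
noncomputable def pfc (I : Finset ℤ) (s : ℕ) (N : ℚ[X]) (k : ℤ) (e : ℕ) : ℚ :=
  PowerSeries.coeff e (locG I s N k)

lemma cof_const_ne (I : Finset ℤ) (s : ℕ) (k : ℤ) :
    PowerSeries.constantCoeff ((cof I s k : ℚ[X]) : PowerSeries ℚ) ≠ 0 := by
  rw [← PowerSeries.coeff_zero_eq_constantCoeff_apply, Polynomial.coeff_coe, cof,
    Polynomial.coeff_zero_eq_eval_zero, Polynomial.eval_prod, Finset.prod_ne_zero_iff]
  intro k' hk'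
  have : k' ≠ k := Finset.ne_of_mem_erase hk'
  simp only [eval_pow, eval_add, eval_X, eval_C, zero_add]
  refine pow_ne_zero _ ?_
  rw [sub_ne_zero]; exact_mod_cast this

lemma locG_mul (I : Finset ℤ) (s : ℕ) (N : ℚ[X]) (k : ℤ) :
    locG I s N k * ((cof I s k : ℚ[X]) : PowerSeries ℚ) =
     ((N.comp (X - C (k : ℚ)) : ℚ[X]) : PowerSeries ℚ) := by
  rw [locG, mul_assoc, PowerSeries.inv_mul_cancel _ (cof_const_ne I s k), mul_one]

lemma pf_dvd (I : Finset ℤ) (s : ℕ) (N : ℚ[X]) (k : ℤ) :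
    (X + C (k : ℚ)) ^ s ∣ N - ∑ e ∈ Finset.range s, C (pfc I s N k e) * (X + C (k : ℚ)) ^ e *
      ∏ k' ∈ I.erase k, (X + C (k' : ℚ)) ^ s := by
  set Q := N - ∑ e ∈ Finset.range s, C (pfc I s N k e) * (X + C (k : ℚ)) ^ e *
      ∏ k' ∈ I.erase k, (X + C (k' : ℚ)) ^ s with hQ
  have h1 : X ^ s ∣ Q.comp (X - C (k : ℚ)) := by
    have h2 : Q.comp (X - C (k : ℚ)) = N.comp (X - C (k : ℚ)) -
        (PowerSeries.trunc s (locG I s N k)) * cof I s k := by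
      rw [hQ, sub_comp]
      congr 1
      rw [← Finset.sum_mul, mul_comp]
      congr 1
      · rw [Polynomial.sum_comp]
        ext d
        rw [PowerSeries.coeff_trunc, finsetSum_coeff]
        simp [pfc, coeff_X_pow]
      · rw [Polynomial.prod_comp, cof]
        refine Finset.prod_congr rfl fun k' _ => ?_
        simp only [pow_comp, add_comp, X_comp, C_comp]
        congr 1
        rw [map_sub]; ring
    rw [Polynomial.X_pow_dvd_iff]
    intro d hd
    rw [h2, ← Polynomial.coeff_coe]
    have h3 : ((N.comp (X - C (k : ℚ)) - (PowerSeries.trunc s (locG I s N k)) * cof I s k : ℚ[X]) : PowerSeries ℚ)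
      = (locG I s N k - ((PowerSeries.trunc s (locG I s N k) : ℚ[X]) : PowerSeries ℚ)) *
        ((cof I s k : ℚ[X]) : PowerSeries ℚ) := by
      rw [sub_mul, locG_mul]
      simp
    rw [h3]
    have h4 : (PowerSeries.X : PowerSeries ℚ) ^ s ∣
       locG I s N k - ((PowerSeries.trunc s (locG I s N k) : ℚ[X]) : PowerSeries ℚ) := by
      rw [PowerSeries.X_pow_dvd_iff]
      intro m hm
      rw [map_sub, Polynomial.coeff_coe, PowerSeries.coeff_trunc, if_pos hm, sub_self]
    exact PowerSeries.X_pow_dvd_iff.mp (h4.mul_right _) d hd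
  obtain ⟨R, hR⟩ := h1
  refine ⟨R.comp (X + C (k : ℚ)), ?_⟩
  have h5 := congrArg (fun P : ℚ[X] => P.comp (X + C (k : ℚ))) hR
  simp only [mul_comp, pow_comp, X_comp] at h5
  rw [← h5, comp_assoc]
  simp

lemma coprime_nodes {k k' : ℤ} (h : k ≠ k') : IsCoprime (X + C (k : ℚ)) (X + C (k' : ℚ)) := by
  have := Polynomial.pairwise_coprime_X_sub_C (K := ℚ) (s := fun k : ℤ => -(k : ℚ))
    (fun a b hab => by simpa using hab) h
  simpa [Function.onFun] using this

lemma natDegree_cofactor (J : Finset ℤ) (s : ℕ) :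
    (∏ k' ∈ J, (X + C (k' : ℚ)) ^ s).natDegree = s * J.card := by
  rw [natDegree_prod_of_monic _ _ fun k _ => (monic_X_add_C _).pow _]
  simp only [natDegree_pow, natDegree_X_add_C, mul_one, Finset.sum_const, smul_eq_mul]
  ring

lemma monic_cofactor (J : Finset ℤ) (s : ℕ) : (∏ k' ∈ J, (X + C (k' : ℚ)) ^ s).Monic :=
  monic_prod_of_monic _ _ fun k _ => (monic_X_add_C _).pow _

theorem partial_fractions (I : Finset ℤ) (s : ℕ) (N : ℚ[X]) (hN : N.degree < (s * I.card : ℕ)) :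
    N = ∑ k ∈ I, ∑ e ∈ Finset.range s, C (pfc I s N k e) * (X + C (k : ℚ)) ^ e *
      ∏ k' ∈ I.erase k, (X + C (k' : ℚ)) ^ s := by
  rw [← sub_eq_zero]
  refine Polynomial.eq_zero_of_dvd_of_degree_lt (p := ∏ k' ∈ I, (X + C (k' : ℚ)) ^ s) ?_ ?_
  · refine Finset.prod_dvd_of_coprime ?_ ?_
    · intro k _ k' _ h
      exact (coprime_nodes h).pow
    · intro k hk
      rw [← Finset.add_sum_erase _ _ hk, ← sub_sub]
      refine dvd_sub (pf_dvd I s N k) (Finset.dvd_sum fun k' hk' => Finset.dvd_sum fun e _ => ?_)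
      refine Dvd.dvd.mul_left ?_ _
      refine Finset.dvd_prod_of_mem (fun k' : ℤ => (X + C (k' : ℚ)) ^ s) ?_
      rw [Finset.mem_erase] at *
      exact ⟨Ne.symm hk'.1, hk⟩
  · rw [degree_eq_natDegree (monic_cofactor I s).ne_zero, natDegree_cofactor]
    refine lt_of_le_of_lt (degree_sub_le _ _) (max_lt hN ?_)
    rw [← mem_degreeLT]
    refine Submodule.sum_mem _ fun k hk => Submodule.sum_mem _ fun e he => ?_
    rw [mem_degreeLT]
    rw [Finset.mem_range] at he
    by_cases hc : pfc I s N k e = 0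
    · rw [hc]; simp only [map_zero, zero_mul, degree_zero]; exact WithBot.bot_lt_coe _
    have h1 : ((X + C (k : ℚ)) ^ e * ∏ k' ∈ I.erase k, (X + C (k' : ℚ)) ^ s).Monic :=
      ((monic_X_add_C _).pow _).mul (monic_cofactor _ _)
    rw [mul_assoc, degree_C_mul hc, degree_eq_natDegree h1.ne_zero, Monic.natDegree_mul
      ((monic_X_add_C _).pow _) (monic_cofactor _ _), natDegree_cofactor, Finset.card_erase_of_mem hk]
    simp only [natDegree_pow, natDegree_X_add_C, mul_one]
    have : 0 < I.card := Finset.card_pos.mpr ⟨k, hk⟩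
    obtain ⟨c, hc⟩ : ∃ c, I.card = c + 1 := ⟨I.card - 1, by omega⟩
    rw [hc]
    norm_cast
    simp only [add_tsub_cancel_right]
    rw [mul_add]; omega

/-- evaluated version -/
theorem pf_eval {L : Type*} [Field L] [Algebra ℚ L] (I : Finset ℤ) (s : ℕ) (N : ℚ[X])
    (hN : N.degree < (s * I.card : ℕ)) (z : L) (hz : ∀ k ∈ I, z + (k : L) ≠ 0) :
    aeval z N / ∏ k ∈ I, (z + (k : L)) ^ s =
      ∑ k ∈ I, ∑ e ∈ Finset.range s, algebraMap ℚ L (pfc I s N k e) * ((z + (k : L))⁻¹) ^ (s - e) := by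
  conv_lhs => rw [partial_fractions I s N hN]
  rw [map_sum, Finset.sum_div]
  refine Finset.sum_congr rfl fun k hk => ?_
  rw [map_sum, Finset.sum_div]
  refine Finset.sum_congr rfl fun e he => ?_
  rw [Finset.mem_range] at he
  rw [map_mul, map_mul, map_prod, map_pow, ← Finset.mul_prod_erase _ _ hk]
  have hQ : ∀ k : ℤ, aeval z (X + C (k : ℚ)) = z + (k : L) := by
    intro k; simp
  have h1 : ∏ k' ∈ I.erase k, aeval z ((X + C (k' : ℚ)) ^ s) = ∏ k' ∈ I.erase k, (z + (k' : L)) ^ s :=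
    Finset.prod_congr rfl fun k' _ => by rw [map_pow, hQ]
  rw [h1, hQ, aeval_C]
  have h2 : ∏ k' ∈ I.erase k, (z + (k' : L)) ^ s ≠ 0 :=
    Finset.prod_ne_zero_iff.mpr fun k' hk' => pow_ne_zero _ (hz k' (Finset.mem_of_mem_erase hk'))
  have h3 := hz k hk
  have h4 : (z + (k : L)) ^ s = (z + (k : L)) ^ e * (z + (k : L)) ^ (s - e) := by
    rw [← pow_add]; congr 1; omega
  rw [h4, inv_pow]
  field_simp

end PZ

namespace PZ
open Polynomial

/-- product of nodes -/
noncomputable def NP (J : Finset ℤ) (s : ℕ) : ℚ[X] := ∏ k ∈ J, (X + C (k : ℚ)) ^ s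

/-- rational function -/
noncomputable def rf {L : Type*} [Field L] [Algebra ℚ L] (N : ℚ[X]) (J : Finset ℤ) (s : ℕ) (z : L) : L :=
  aeval z N / aeval z (NP J s)

section
variable {L : Type*} [Field L] [Algebra ℚ L]

lemma aeval_NP (J : Finset ℤ) (s : ℕ) (z : L) : aeval z (NP J s) = ∏ k ∈ J, (z + (k : L)) ^ s := by
  rw [NP, map_prod]
  refine Finset.prod_congr rfl fun k _ => ?_
  simp

lemma aeval_NP_ne (J : Finset ℤ) (s : ℕ) (z : L) (hz : ∀ k ∈ J, z + (k : L) ≠ 0) :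
    aeval z (NP J s) ≠ 0 := by
  rw [aeval_NP]
  exact Finset.prod_ne_zero_iff.mpr fun k hk => pow_ne_zero _ (hz k hk)

lemma NP_union {J J' : Finset ℤ} (h : Disjoint J J') (s : ℕ) : NP (J ∪ J') s = NP J s * NP J' s :=
  Finset.prod_union h

lemma rf_eq (N : ℚ[X]) (J : Finset ℤ) (s : ℕ) (hN : N.degree < (s * J.card : ℕ)) (z : L)
    (hz : ∀ k ∈ J, z + (k : L) ≠ 0) : rf N J s z =
      ∑ k ∈ J, ∑ e ∈ Finset.range s, algebraMap ℚ L (pfc J s N k e) * ((z + (k : L))⁻¹) ^ (s - e) := by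
  rw [rf, aeval_NP, pf_eval J s N hN z hz]

lemma rf_extend (N : ℚ[X]) {J J' : Finset ℤ} (h : Disjoint J J') (s : ℕ) (z : L)
    (hz : ∀ k ∈ J', z + (k : L) ≠ 0) : rf (N * NP J' s) (J ∪ J') s z = rf N J s z := by
  rw [rf, rf, NP_union h, map_mul, map_mul, mul_div_mul_right _ _ (aeval_NP_ne J' s z hz)]

lemma rf_add (N N' : ℚ[X]) (J : Finset ℤ) (s : ℕ) (z : L) :
    rf (N + N') J s z = rf N J s z + rf N' J s z := by
  rw [rf, map_add, add_div]; rfl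

lemma rf_sub (N N' : ℚ[X]) (J : Finset ℤ) (s : ℕ) (z : L) :
    rf (N - N') J s z = rf N J s z - rf N' J s z := by
  rw [rf, map_sub, sub_div]; rfl

lemma rf_C_mul (c : ℚ) (N : ℚ[X]) (J : Finset ℤ) (s : ℕ) (z : L) :
    rf (C c * N) J s z = algebraMap ℚ L c * rf N J s z := by
  rw [rf, map_mul, aeval_C, mul_div_assoc]; rfl

lemma rf_sum {ι : Type*} (S : Finset ι) (N : ι → ℚ[X]) (J : Finset ℤ) (s : ℕ) (z : L) :
    rf (∑ i ∈ S, N i) J s z = ∑ i ∈ S, rf (N i) J s z := by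
  rw [rf, map_sum, Finset.sum_div]; rfl

lemma NP_comp (J : Finset ℤ) (s : ℕ) (r : ℤ) :
    (NP J s).comp (X + C (r : ℚ)) = NP (J.map (addRightEmbedding r)) s := by
  rw [NP, NP, Polynomial.prod_comp, Finset.prod_map]
  refine Finset.prod_congr rfl fun k _ => ?_
  simp only [pow_comp, add_comp, X_comp, C_comp, addRightEmbedding_apply]
  push_cast
  congr 1
  rw [map_add]
  ring

lemma rf_comp (N : ℚ[X]) (J : Finset ℤ) (s : ℕ) (z : L) (r : ℤ) :
    rf (N.comp (X + C (r : ℚ))) (J.map (addRightEmbedding r)) s z = rf N J s (z + (r : L)) := by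
  rw [rf, rf, ← NP_comp, aeval_comp, aeval_comp]
  simp

lemma rf_map {L' : Type*} [Field L'] [Algebra ℚ L'] (f : L →ₐ[ℚ] L') (N : ℚ[X]) (J : Finset ℤ) (s : ℕ)
    (z : L) : f (rf N J s z) = rf N J s (f z) := by
  rw [rf, rf, map_div₀, aeval_algHom_apply, aeval_algHom_apply]
end

variable {p : ℕ} [hp : Fact p.Prime]

lemma C_intCast (k : ℤ) : (HahnSeries.C (k : ℚ_[p]) : LaurentSeries ℚ_[p]) = (k : LaurentSeries ℚ_[p]) :=
  map_intCast _ k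

lemma tau_add_int_ne (k : ℤ) : tau p + (k : LaurentSeries ℚ_[p]) ≠ 0 := by
  rw [← C_intCast]; exact tau_add_ne_zero _

lemma padic_add_int_ne {x : ℚ_[p]} (hx : 1 < ‖x‖) (k : ℤ) : x + (k : ℚ_[p]) ≠ 0 := by
  intro h
  have : x = -(k : ℚ_[p]) := by linear_combination h
  rw [this, norm_neg] at hx
  exact absurd (Padic.norm_int_le_one k) (not_le.mpr hx)

lemma TT_ratmul (y : ℚ_[p]) (q : ℚ) (F : LaurentSeries ℚ_[p]) :
    TT y (algebraMap ℚ (LaurentSeries ℚ_[p]) q * F) = (q : ℚ_[p]) * TT y F := by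
  have : algebraMap ℚ (LaurentSeries ℚ_[p]) q * F = (q : ℚ_[p]) • F := by
    have h1 : algebraMap ℚ (LaurentSeries ℚ_[p]) q = HahnSeries.C (q : ℚ_[p]) := by
      rw [eq_ratCast, map_ratCast]
    rw [h1, HahnSeries.C_mul_eq_smul]
  rw [this, map_smul, smul_eq_mul]

theorem TT_rf_shift {x : ℚ_[p]} (hx : 1 < ‖x‖) (N : ℚ[X]) (J : Finset ℤ) (s : ℕ)
    (hN : N.degree < (s * J.card : ℕ)) (r : ℤ) :
    TT x⁻¹ (rf N J s (tau p + ((r + 1 : ℤ) : LaurentSeries ℚ_[p]))) =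
    TT x⁻¹ (rf N J s (tau p + (r : LaurentSeries ℚ_[p]))) - rf N J s (x + (r : ℚ_[p])) := by
  have e1 : ∀ r k : ℤ, tau p + (r : LaurentSeries ℚ_[p]) + (k : LaurentSeries ℚ_[p]) =
      tau p + HahnSeries.C (((r + k : ℤ)) : ℚ_[p]) := by
    intro r k; rw [C_intCast]; push_cast; ring
  rw [rf_eq N J s hN, rf_eq N J s hN, rf_eq N J s hN]
  · simp only [map_sum]
    rw [← Finset.sum_sub_distrib]
    refine Finset.sum_congr rfl fun k _ => ?_
    rw [← Finset.sum_sub_distrib]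
    refine Finset.sum_congr rfl fun e he => ?_
    rw [Finset.mem_range] at he
    rw [TT_ratmul, TT_ratmul, e1, e1]
    obtain ⟨a, ha⟩ : ∃ a, s - e = a + 1 := ⟨s - e - 1, by omega⟩
    rw [ha]
    have h2 := TT_shift hx ((r + k : ℤ) : ℚ_[p]) (Padic.norm_int_le_one _) a
    have h3 : ((r + k : ℤ) : ℚ_[p]) + 1 = ((r + 1 + k : ℤ) : ℚ_[p]) := by push_cast; ring
    rw [h3] at h2
    rw [h2]
    rw [eq_ratCast]
    push_cast
    ring
  · intro k _
    have := padic_add_int_ne hx (r + k)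
    push_cast at this
    rwa [add_assoc]
  · intro k _
    rw [e1]; exact tau_add_ne_zero _
  · intro k _
    rw [e1]; exact tau_add_ne_zero _

/-- main evaluation: `T_x(R)` as a linear form -/
theorem TT_rf_eval {x : ℚ_[p]} (hx : 1 < ‖x‖) (N : ℚ[X]) (n : ℕ) (s : ℕ)
    (hN : N.degree < (s * (n + 1) : ℕ)) (J : Finset ℤ) (hJ : J = Finset.Icc (0 : ℤ) n) :
    TT x⁻¹ (rf N J s (tau p)) =
     (∑ e ∈ Finset.range s, ((∑ k ∈ J, pfc J s N k e : ℚ) : ℚ_[p]) * hh x⁻¹ (s - e - 1)) -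
      ∑ k ∈ J, ∑ l ∈ Finset.range k.toNat, ∑ e ∈ Finset.range s,
        ((pfc J s N k e : ℚ) : ℚ_[p]) * ((x + l)⁻¹) ^ (s - e) := by
  have hN' : N.degree < (s * J.card : ℕ) := by rw [hJ]; simpa using hN
  rw [rf_eq N J s hN' _ (fun k _ => tau_add_int_ne k)]
  simp only [map_sum]
  push_cast
  simp only [Finset.sum_mul]
  rw [Finset.sum_comm (s := Finset.range s), ← Finset.sum_sub_distrib]
  refine Finset.sum_congr rfl fun k hk => ?_
  rw [Finset.sum_comm (s := Finset.range k.toNat), ← Finset.sum_sub_distrib]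
  refine Finset.sum_congr rfl fun e he => ?_
  rw [Finset.mem_range] at he
  obtain ⟨a, ha⟩ : ∃ a, s - e = a + 1 := ⟨s - e - 1, by omega⟩
  have hk0 : 0 ≤ k := by rw [hJ, Finset.mem_Icc] at hk; exact hk.1
  lift k to ℕ using hk0
  rw [TT_ratmul, ha]
  have h1 := TT_pole_nat hx k a
  have h2 : (HahnSeries.C (k : ℚ_[p]) : LaurentSeries ℚ_[p]) = (((k : ℤ)) : LaurentSeries ℚ_[p]) := by
    rw [← C_intCast]; simp
  rw [h2] at h1
  rw [h1]
  simp only [Int.toNat_natCast, add_tsub_cancel_right]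
  rw [← Finset.mul_sum]
  ring

end PZ

namespace PZ
open Polynomial

/-- zeros -/
noncomputable def ZP (F : Finset ℚ) (J : Finset ℤ) : ℚ[X] :=
  ∏ m ∈ J, ∏ θ ∈ F, (X + C ((m : ℚ) - θ))

lemma ZP_union (F : Finset ℚ) {J J' : Finset ℤ} (h : Disjoint J J') : ZP F (J ∪ J') = ZP F J * ZP F J' :=
  Finset.prod_union h

lemma ZP_comp (F : Finset ℚ) (J : Finset ℤ) (r : ℤ) :
    (ZP F J).comp (X + C (r : ℚ)) = ZP F (J.map (addRightEmbedding r)) := by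
  rw [ZP, ZP, Polynomial.prod_comp, Finset.prod_map]
  refine Finset.prod_congr rfl fun k _ => ?_
  rw [Polynomial.prod_comp]
  refine Finset.prod_congr rfl fun k _ => ?_
  simp only [add_comp, X_comp, C_comp, addRightEmbedding_apply]
  rw [add_assoc, ← C_add]
  congr 2
  push_cast
  ring

lemma ZP_monic (F : Finset ℚ) (J : Finset ℤ) : (ZP F J).Monic :=
  monic_prod_of_monic _ _ fun _ _ => monic_prod_of_monic _ _ fun _ _ => monic_X_add_C _

lemma NP_monic (J : Finset ℤ) (s : ℕ) : (NP J s).Monic := monic_cofactor J s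

lemma NP_natDegree (J : Finset ℤ) (s : ℕ) : (NP J s).natDegree = s * J.card := natDegree_cofactor J s

lemma ZP_natDegree (F : Finset ℚ) (J : Finset ℤ) : (ZP F J).natDegree = F.card * J.card := by
  rw [ZP, natDegree_prod_of_monic _ _ fun _ _ => monic_prod_of_monic _ _ fun _ _ => monic_X_add_C _]
  rw [Finset.sum_congr rfl fun m _ => natDegree_prod_of_monic _ _ fun _ _ => monic_X_add_C _]
  simp only [natDegree_X_add_C, Finset.sum_const, smul_eq_mul, mul_one]; ring

lemma ZP_eval_zero (F : Finset ℚ) (J : Finset ℤ) (x : ℚ) (hx : x ∈ F) (m : ℤ) (hm : m ∈ J) :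
    (ZP F J).eval (x - m) = 0 := by
  rw [ZP, eval_prod]
  refine Finset.prod_eq_zero hm ?_
  rw [eval_prod]
  refine Finset.prod_eq_zero hx ?_
  simp

lemma coprime_lin {a b : ℚ} (h : a ≠ b) : IsCoprime (X + C a) (X + C b) := by
  have := Polynomial.pairwise_coprime_X_sub_C (K := ℚ) (s := fun k : ℚ => -(k : ℚ))
    (fun a b hab => by simpa using hab) h
  simpa [Function.onFun] using this

lemma deg_lt_iff (N : ℚ[X]) (d : ℕ) (hd : 0 < d) : N.degree < (d : ℕ) ↔ N.natDegree < d := by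
  by_cases h : N = 0
  · subst h; simp only [natDegree_zero, hd, iff_true, degree_zero]; exact WithBot.bot_lt_coe _
  · rw [natDegree_lt_iff_degree_lt h]

lemma deg_mul_monic_lt {N Q : ℚ[X]} {d : ℕ} (hQ : Q.Monic) (hN : N.degree < (d : ℕ)) :
    (N * Q).degree < ((d + Q.natDegree : ℕ) : WithBot ℕ) := by
  by_cases h : N = 0
  · rw [h]; simp only [zero_mul, degree_zero]; exact WithBot.bot_lt_coe _
  · rw [hQ.degree_mul, degree_eq_natDegree hQ.ne_zero, degree_eq_natDegree h]
    rw [degree_eq_natDegree h] at hN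
    have : N.natDegree < d := by exact_mod_cast hN
    exact_mod_cast (by omega)

lemma deg_of_mul_monic_lt {N Q : ℚ[X]} {d : ℕ} (hQ : Q.Monic)
    (hN : (N * Q).degree < ((d + Q.natDegree : ℕ) : WithBot ℕ)) : N.degree < (d : ℕ) := by
  by_cases h : N = 0
  · rw [h]; simp only [degree_zero]; exact WithBot.bot_lt_coe _
  · rw [hQ.degree_mul, degree_eq_natDegree hQ.ne_zero, degree_eq_natDegree h] at hN
    rw [degree_eq_natDegree h]
    have : N.natDegree + Q.natDegree < d + Q.natDegree := by exact_mod_cast hN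
    exact_mod_cast (by omega)

/-- Bezout with degree control -/
lemma bezout_deg {P Q N : ℚ[X]} (hP : P.Monic) (hQ : Q.Monic) (hPQ : IsCoprime P Q) {d : ℕ}
    (hd : Q.natDegree ≤ d) (hN : N.degree < ((d + P.natDegree : ℕ) : WithBot ℕ)) :
    ∃ N' Q', N = N' * P + Q' * Q ∧ N'.degree < (d : ℕ) ∧ Q'.degree < (P.natDegree : ℕ) := by
  obtain ⟨a, b, hab⟩ := hPQ
  have h1 : P ∣ N - (N * b %ₘ P) * Q := by
    have h2 := modByMonic_add_div (N * b) P
    refine ⟨N * a + (N * b /ₘ P) * Q, ?_⟩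
    linear_combination (-N) * hab + (-Q) * h2
  obtain ⟨N', hN'⟩ := h1
  have hdeg : (N * b %ₘ P).degree < (P.natDegree : ℕ) := by
    rw [← degree_eq_natDegree hP.ne_zero]; exact degree_modByMonic_lt _ hP
  refine ⟨N', N * b %ₘ P, by linear_combination hN', ?_, hdeg⟩
  apply deg_of_mul_monic_lt hP
  rw [mul_comm, ← hN']
  refine lt_of_le_of_lt (degree_sub_le _ _) (max_lt hN ?_)
  refine (deg_mul_monic_lt hQ hdeg).trans_le ?_
  exact_mod_cast (by omega)

variable {p : ℕ} [hp : Fact p.Prime]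

lemma map_Icc (a b r : ℤ) : (Finset.Icc a b).map (addRightEmbedding r) = Finset.Icc (a + r) (b + r) := by
  rw [Finset.map_add_right_Icc]

lemma degF (n s : ℕ) (F : Finset ℚ) (hn : 1 ≤ n) (hs : 2 * F.card ≤ s) (hs1 : 1 ≤ s) (Q : ℚ[X])
    (hQ : Q.degree < ((s + F.card : ℕ) : WithBot ℕ)) :
    (Q * ZP F (Finset.Icc 1 n)).degree < (s * (Finset.Icc (0 : ℤ) n).card : ℕ) := by
  refine (deg_mul_monic_lt (ZP_monic F _) hQ).trans_le ?_
  rw [ZP_natDegree]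
  simp only [Int.card_Icc]
  have e1 : ((n : ℤ) + 1 - 1).toNat = n := by omega
  have e2 : ((n : ℤ) + 1 - 0).toNat = n + 1 := by omega
  rw [e1, e2]
  have : s + F.card + F.card * n ≤ s * (n + 1) := by nlinarith
  exact_mod_cast this

lemma comp_shift (Q : ℚ[X]) (a b : ℚ) (h : a + b = 0) : (Q.comp (X + C a)).comp (X + C b) = Q := by
  rw [comp_assoc, add_comp, X_comp, C_comp, add_assoc, ← C_add, add_comm b a, h, C_0, add_zero, comp_X]

lemma stepA (F : Finset ℚ) (s n l : ℕ) (hl : l + 1 ≤ n) (N' : ℚ[X]) :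
rf (N' * ZP F (Finset.Icc 1 (n - l : ℤ))) (Finset.Icc (-(l : ℤ)) n) s (tau p) =
    rf ((N' * (ZP F {((n : ℤ) - l)} * NP {(-(l + 1 : ℤ))} s)) * ZP F (Finset.Icc 1 (n - (l + 1) : ℤ))) (Finset.Icc (-(l + 1 : ℤ)) n) s (tau p) := by
  have hd : Disjoint (Finset.Icc (-(l : ℤ)) n) {(-(l + 1 : ℤ))} := by
    rw [Finset.disjoint_singleton_right, Finset.mem_Icc]; omega
  rw [← rf_extend _ hd s (tau p) (fun k _ => tau_add_int_ne k)]
  have e1 : Finset.Icc (-(l : ℤ)) n ∪ {(-(l + 1 : ℤ))} = Finset.Icc (-(l + 1 : ℤ)) n := by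
    ext a; simp only [Finset.mem_union, Finset.mem_Icc, Finset.mem_singleton]; omega
  have hd2 : Disjoint (Finset.Icc (1 : ℤ) (n - (l + 1) : ℤ)) {((n : ℤ) - l)} := by
    rw [Finset.disjoint_singleton_right, Finset.mem_Icc]; omega
  have e2 : (Finset.Icc 1 (n - (l + 1) : ℤ)) ∪ {((n : ℤ) - l)} = Finset.Icc 1 (n - l : ℤ) := by
    ext a; simp only [Finset.mem_union, Finset.mem_Icc, Finset.mem_singleton]; omega
  rw [e1, ← e2, ZP_union _ hd2]
  congr 1
  ring

set_option maxHeartbeats 2000000 in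
lemma stepB (F : Finset ℚ) (s n l : ℕ) (hl : l + 1 ≤ n) (Q' : ℚ[X]) :
    rf (Q'.comp (X + C (((l + 1 : ℤ) : ℤ) : ℚ)) * ZP F (Finset.Icc 1 n)) (Finset.Icc (0 : ℤ) n) s
      (tau p + ((-((l + 1 : ℕ) : ℤ) : ℤ) : LaurentSeries ℚ_[p])) =
    rf ((Q' * (ZP F (Finset.Icc (-(l : ℤ)) 0) * NP (Finset.Icc ((n : ℤ) - l) n) s)) * ZP F (Finset.Icc 1 (n - (l + 1) : ℤ))) (Finset.Icc (-(l + 1 : ℤ)) n) s (tau p) := by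
  rw [← rf_comp, mul_comp, ZP_comp, map_Icc, map_Icc]
  rw [comp_shift Q' (((l + 1 : ℤ) : ℤ) : ℚ) _ (by push_cast; ring)]
  have hd : Disjoint (Finset.Icc (0 + (-((l + 1 : ℕ) : ℤ) : ℤ)) (n + (-((l + 1 : ℕ) : ℤ) : ℤ))) (Finset.Icc ((n : ℤ) - l) n) := by
    rw [Finset.disjoint_left]; intro a; rw [Finset.mem_Icc, Finset.mem_Icc]; push_cast; omega
  rw [← rf_extend _ hd s (tau p) (fun k _ => tau_add_int_ne k)]
  have e1 : (Finset.Icc (0 + (-((l + 1 : ℕ) : ℤ) : ℤ)) (n + (-((l + 1 : ℕ) : ℤ) : ℤ))) ∪ (Finset.Icc ((n : ℤ) - l) n) =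
      Finset.Icc (-(l + 1 : ℤ)) n := by
    ext a; simp only [Finset.mem_union, Finset.mem_Icc]; push_cast; omega
  have hd2 : Disjoint (Finset.Icc (-(l : ℤ)) 0) (Finset.Icc (1 : ℤ) (n - (l + 1) : ℤ)) := by
    rw [Finset.disjoint_left]; intro a; rw [Finset.mem_Icc, Finset.mem_Icc]; omega
  have e2 : Finset.Icc (1 + (-((l + 1 : ℕ) : ℤ) : ℤ)) (n + (-((l + 1 : ℕ) : ℤ) : ℤ)) =
      (Finset.Icc (-(l : ℤ)) 0) ∪ (Finset.Icc (1 : ℤ) (n - (l + 1) : ℤ)) := by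
    ext a; simp only [Finset.mem_union, Finset.mem_Icc]; push_cast; omega
  rw [e1, e2, ZP_union _ hd2]
  refine congrArg (fun N => rf N _ s (tau p)) ?_
  generalize NP (Finset.Icc ((n : ℤ) - l) n) s = a
  generalize ZP F (Finset.Icc (-(l : ℤ)) 0) = b
  generalize ZP F (Finset.Icc 1 (n - (l + 1) : ℤ)) = c
  ring

lemma typeB (F : Finset ℚ) (W : ℚ → ℚ_[p]) (s n : ℕ)
  (Lam : LaurentSeries ℚ_[p] →ₗ[ℚ_[p]] ℚ_[p])
  (hLam : ∀ (N : ℚ[X]) (J : Finset ℤ) (r : ℤ), N.degree < (s * J.card : ℕ) →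
    Lam (rf N J s (tau p + ((r + 1 : ℤ) : LaurentSeries ℚ_[p]))) =
    Lam (rf N J s (tau p + (r : LaurentSeries ℚ_[p]))) - ∑ x ∈ F, W x * ((rf N J s (x + (r : ℚ)) : ℚ) : ℚ_[p]))
    (hn : 1 ≤ n) (hs : 2 * F.card ≤ s) (hs1 : 1 ≤ s) (Q : ℚ[X])
    (hQ : Q.degree < ((s + F.card : ℕ) : WithBot ℕ))
    (h0 : Lam (rf (Q * ZP F (Finset.Icc 1 n)) (Finset.Icc (0 : ℤ) n) s (tau p)) = 0) (l : ℕ) (hl : l ≤ n) :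
    Lam (rf (Q * ZP F (Finset.Icc 1 n)) (Finset.Icc (0 : ℤ) n) s
      (tau p + ((-(l : ℤ) : ℤ) : LaurentSeries ℚ_[p]))) = 0 := by
  induction l with
  | zero => simpa using h0
  | succ l ih =>
    have h1 := hLam (Q * ZP F (Finset.Icc 1 n)) (Finset.Icc (0 : ℤ) n) (-(l + 1 : ℤ)) (degF n s F hn hs hs1 Q hQ)
    have e : (-(l + 1 : ℤ) + 1) = -(l : ℤ) := by ring
    rw [e, ih (by omega)] at h1
    rw [Finset.sum_eq_zero, sub_zero] at h1
    · push_cast at h1 ⊢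
      exact h1.symm
    · intro x hx
      have : rf (Q * ZP F (Finset.Icc 1 n)) (Finset.Icc (0 : ℤ) n) s (x + ((-(l + 1 : ℤ) : ℤ) : ℚ)) = 0 := by
        rw [rf]
        have h3 := ZP_eval_zero F (Finset.Icc (1 : ℤ) n) x hx (l + 1) (by rw [Finset.mem_Icc]; omega)
        have e2 : (x + ((-(l + 1 : ℤ) : ℤ) : ℚ)) = x - ((l + 1 : ℤ) : ℚ) := by push_cast; ring
        rw [e2, map_mul, coe_aeval_eq_eval, h3]
        simp
      rw [this]; simp

lemma coprime_step (F : Finset ℚ) (hF : ∀ θ ∈ F, 0 < θ ∧ θ < 1) (s n : ℕ)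
    (l : ℕ) (hl : l + 1 ≤ n) :
    IsCoprime (ZP F {((n : ℤ) - l)} * NP {(-(l + 1 : ℤ))} s)
      (ZP F (Finset.Icc (-(l : ℤ)) 0) * NP (Finset.Icc ((n : ℤ) - l) n) s) := by
  have hIntg : ∀ θ ∈ F, ∀ a : ℤ, (θ : ℚ) ≠ a := by
    intro θ hθ a h
    obtain ⟨h1, h2⟩ := hF θ hθ
    rw [h] at h1 h2
    have h1' : (0 : ℤ) < a := by exact_mod_cast h1
    have h2' : a < (1 : ℤ) := by exact_mod_cast h2
    omega
  have hdiff : ∀ θ ∈ F, ∀ θ' ∈ F, ∀ a : ℤ, 1 ≤ a → θ - θ' ≠ a := by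
    intro θ hθ θ' hθ' a ha h
    obtain ⟨h1, h2⟩ := hF θ hθ
    obtain ⟨h3, h4⟩ := hF θ' hθ'
    have : (a : ℚ) < 1 := by rw [← h]; linarith
    have : a < (1 : ℤ) := by exact_mod_cast this
    omega
  refine IsCoprime.mul_left (IsCoprime.mul_right ?_ ?_) (IsCoprime.mul_right ?_ ?_)
  · rw [ZP, ZP]
    refine IsCoprime.prod_left fun m hm => IsCoprime.prod_left fun θ hθ =>
      IsCoprime.prod_right fun m' hm' => IsCoprime.prod_right fun θ' hθ' => coprime_lin ?_
    intro h
    rw [Finset.mem_singleton] at hm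
    rw [Finset.mem_Icc] at hm'
    refine hdiff θ hθ θ' hθ' (m - m') (by omega) ?_
    push_cast
    linear_combination -h
  · rw [ZP, NP]
    refine IsCoprime.prod_left fun m hm => IsCoprime.prod_left fun θ hθ =>
      IsCoprime.prod_right fun m' hm' => IsCoprime.pow_right (coprime_lin ?_)
    intro h
    refine hIntg θ hθ (m - m') ?_
    push_cast
    linear_combination -h
  · rw [ZP, NP]
    refine IsCoprime.prod_left fun m hm => 
      IsCoprime.prod_right fun m' hm' => IsCoprime.prod_right fun θ' hθ' => IsCoprime.pow_left (coprime_lin ?_)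
    intro h
    refine hIntg θ' hθ' (m' - m) ?_
    push_cast
    linear_combination h
  · rw [NP, NP]
    refine IsCoprime.prod_left fun m hm => 
      IsCoprime.prod_right fun m' hm' => IsCoprime.pow_left (IsCoprime.pow_right (coprime_lin ?_))
    intro h
    rw [Finset.mem_singleton] at hm
    rw [Finset.mem_Icc] at hm'
    have : m = m' := by exact_mod_cast h
    omega

set_option maxHeartbeats 1000000 in
lemma stepS (F : Finset ℚ) (hF : ∀ θ ∈ F, 0 < θ ∧ θ < 1) (W : ℚ → ℚ_[p]) (s n : ℕ)
  (Lam : LaurentSeries ℚ_[p] →ₗ[ℚ_[p]] ℚ_[p])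
  (hLam : ∀ (N : ℚ[X]) (J : Finset ℤ) (r : ℤ), N.degree < (s * J.card : ℕ) →
    Lam (rf N J s (tau p + ((r + 1 : ℤ) : LaurentSeries ℚ_[p]))) =
    Lam (rf N J s (tau p + (r : LaurentSeries ℚ_[p]))) - ∑ x ∈ F, W x * ((rf N J s (x + (r : ℚ)) : ℚ) : ℚ_[p]))
    (hn : 1 ≤ n) (hs : 2 * F.card ≤ s) (hs1 : 1 ≤ s)
    (h0 : ∀ Q : ℚ[X], Q.degree < ((s + F.card : ℕ) : WithBot ℕ) →
      Lam (rf (Q * ZP F (Finset.Icc 1 n)) (Finset.Icc (0 : ℤ) n) s (tau p)) = 0) (l : ℕ) (hl : l ≤ n) :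
    ∀ N : ℚ[X], N.degree < (((s + F.card) * (l + 1) : ℕ) : WithBot ℕ) →
      Lam (rf (N * ZP F (Finset.Icc 1 (n - l : ℤ))) (Finset.Icc (-(l : ℤ)) n) s (tau p)) = 0 := by
  induction l with
  | zero =>
    intro N hN
    simpa using h0 N (by simpa using hN)
  | succ l ih =>
    intro N hN
    have ih := ih (by omega)
    set P := ZP F {((n : ℤ) - l)} * NP {(-(l + 1 : ℤ))} s with hP
    set Q := ZP F (Finset.Icc (-(l : ℤ)) 0) * NP (Finset.Icc ((n : ℤ) - l) n) s with hQ
    have hPm : P.Monic := (ZP_monic _ _).mul (NP_monic _ _)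
    have hQm : Q.Monic := (ZP_monic _ _).mul (NP_monic _ _)
    have hPd : P.natDegree = s + F.card := by
      rw [hP, (ZP_monic _ _).natDegree_mul (NP_monic _ _), ZP_natDegree, NP_natDegree]
      simp; ring
    have hQd : Q.natDegree = (s + F.card) * (l + 1) := by
      rw [hQ, (ZP_monic _ _).natDegree_mul (NP_monic _ _), ZP_natDegree, NP_natDegree]
      simp only [Int.card_Icc]
      have e1 : ((0 : ℤ) + 1 - -(l : ℤ)).toNat = l + 1 := by omega
      have e2 : ((n : ℤ) + 1 - (n - l)).toNat = l + 1 := by omega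
      rw [e1, e2]; ring
    obtain ⟨N', Q', hNQ, hN', hQ'⟩ := bezout_deg hPm hQm (coprime_step F hF s n l hl)
      (N := N) (d := (s + F.card) * (l + 1)) hQd.le (by rw [hPd]; exact_mod_cast hN)
    have hA := ih N' hN'
    -- type B
    let Q0 := Q'.comp (X + C (((l + 1 : ℤ) : ℤ) : ℚ))
    have hQ0 : Q0.degree < ((s + F.card : ℕ) : WithBot ℕ) := by
      rw [hPd] at hQ'
      rw [deg_lt_iff _ _ (by omega)] at hQ' ⊢
      simp only [Q0]
      rw [natDegree_comp, natDegree_X_add_C, mul_one]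
      exact hQ'
    have hB := typeB F W s n Lam hLam hn hs hs1 Q0 hQ0 (h0 Q0 hQ0) (l + 1) hl
    have eA := stepA (p := p) F s n l hl N'
    have eB := stepB (p := p) F s n l hl Q'
    rw [← hP] at eA
    rw [← hQ] at eB
    rw [hNQ, add_mul]
    push_cast
    rw [rf_add, map_add, ← eA, ← eB, hA, hB, add_zero]

theorem nonvanish (F : Finset ℚ) (hF : ∀ θ ∈ F, 0 < θ ∧ θ < 1) (W : ℚ → ℚ_[p]) (s n : ℕ)
  (Lam : LaurentSeries ℚ_[p] →ₗ[ℚ_[p]] ℚ_[p])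
  (hLam : ∀ (N : ℚ[X]) (J : Finset ℤ) (r : ℤ), N.degree < (s * J.card : ℕ) →
    Lam (rf N J s (tau p + ((r + 1 : ℤ) : LaurentSeries ℚ_[p]))) =
    Lam (rf N J s (tau p + (r : LaurentSeries ℚ_[p]))) - ∑ x ∈ F, W x * ((rf N J s (x + (r : ℚ)) : ℚ) : ℚ_[p]))
    (hn : 1 ≤ n) (hs : 2 * F.card ≤ s) (hs1 : 1 ≤ s) (x0 : ℚ) (hx0 : x0 ∈ F) (hW : W x0 ≠ 0) :
    ∃ j < s + F.card,
      Lam (rf (X ^ j * ZP F (Finset.Icc 1 n)) (Finset.Icc (0 : ℤ) n) s (tau p)) ≠ 0 := by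
  by_contra! hcon
  have h0 : ∀ Q : ℚ[X], Q.degree < ((s + F.card : ℕ) : WithBot ℕ) →
      Lam (rf (Q * ZP F (Finset.Icc 1 n)) (Finset.Icc (0 : ℤ) n) s (tau p)) = 0 := by
    intro Q hQ
    rw [deg_lt_iff _ _ (by omega)] at hQ
    rw [Q.as_sum_range' (s + F.card) hQ, Finset.sum_mul, rf_sum, map_sum]
    refine Finset.sum_eq_zero fun j hj => ?_
    rw [← C_mul_X_pow_eq_monomial, mul_assoc, rf_C_mul]
    have : ∀ (q : ℚ) (G : LaurentSeries ℚ_[p]), algebraMap ℚ (LaurentSeries ℚ_[p]) q * G = (q : ℚ_[p]) • G := by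
      intro q G
      have h1 : algebraMap ℚ (LaurentSeries ℚ_[p]) q = HahnSeries.C (q : ℚ_[p]) := by
        rw [eq_ratCast, map_ratCast]
      rw [h1, HahnSeries.C_mul_eq_smul]
    rw [this, map_smul, hcon j (Finset.mem_range.mp hj), smul_zero]
  have hS := stepS F hF W s n Lam hLam hn hs hs1 h0 n le_rfl
  simp only [sub_self] at hS
  have hZ1 : ZP F (Finset.Icc 1 (0 : ℤ)) = 1 := by simp [ZP]
  simp only [hZ1, mul_one] at hS
  set N0 : ℚ[X] := ∏ x ∈ F.erase x0, (X - C x) with hN0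
  have hN0m : N0.Monic := monic_prod_of_monic _ _ fun _ _ => monic_X_sub_C _
  have hN0d : N0.natDegree = F.card - 1 := by
    rw [hN0, natDegree_prod_of_monic _ _ fun _ _ => monic_X_sub_C _]
    simp [Finset.card_erase_of_mem hx0]
  have hF1 : 1 ≤ F.card := Finset.card_pos.mpr ⟨x0, hx0⟩
  set J : Finset ℤ := Finset.Icc (-(n : ℤ)) (n - 1) with hJ
  have hJc : J.card = 2 * n := by rw [hJ, Int.card_Icc]; omega
  have h1 := hLam N0 J 0 (by
    rw [degree_eq_natDegree hN0m.ne_zero, hN0d, hJc]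
    have : F.card - 1 < s * (2 * n) := by
      have : s * 1 ≤ s * (2 * n) := Nat.mul_le_mul_left _ (by omega)
      omega
    exact_mod_cast this)
  have hd1 : Disjoint J {(n : ℤ)} := by
    rw [Finset.disjoint_singleton_right, hJ, Finset.mem_Icc]; omega
  have hd2 : Disjoint (Finset.Icc (-(n : ℤ) + 1) n) {-(n : ℤ)} := by
    rw [Finset.disjoint_singleton_right, Finset.mem_Icc]; omega
  have e1 : J ∪ {(n : ℤ)} = Finset.Icc (-(n : ℤ)) n := by
    ext a; simp only [hJ, Finset.mem_union, Finset.mem_Icc, Finset.mem_singleton]; omega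
  have e2 : (Finset.Icc (-(n : ℤ) + 1) n) ∪ {-(n : ℤ)} = Finset.Icc (-(n : ℤ)) n := by
    ext a; simp only [Finset.mem_union, Finset.mem_Icc, Finset.mem_singleton]; omega
  have e3 : rf N0 J s (tau p + ((0 : ℤ) : LaurentSeries ℚ_[p])) =
     rf (N0 * NP {(n : ℤ)} s) (Finset.Icc (-(n : ℤ)) n) s (tau p) := by
    rw [← e1, rf_extend _ hd1 s (tau p) (fun k _ => tau_add_int_ne k)]
    simp
  have e4 : rf N0 J s (tau p + ((0 + 1 : ℤ) : LaurentSeries ℚ_[p])) =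
     rf (N0.comp (X + C ((1 : ℤ) : ℚ)) * NP {-(n : ℤ)} s) (Finset.Icc (-(n : ℤ)) n) s (tau p) := by
    rw [← e2, rf_extend _ hd2 s (tau p) (fun k _ => tau_add_int_ne k)]
    have : Finset.Icc (-(n : ℤ) + 1) n = J.map (addRightEmbedding 1) := by
      rw [hJ, map_Icc]; congr 1; ring
    rw [this, rf_comp, zero_add]
  have hdeg : s + F.card ≤ (s + F.card) * (n + 1) := Nat.le_mul_of_pos_right _ (by omega)
  have k1 : Lam (rf N0 J s (tau p + ((0 : ℤ) : LaurentSeries ℚ_[p]))) = 0 := by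
    rw [e3]
    refine hS _ ?_
    rw [deg_lt_iff _ _ (by omega), hN0m.natDegree_mul (NP_monic _ _), NP_natDegree, hN0d]
    simp; omega
  have k2 : Lam (rf N0 J s (tau p + ((0 + 1 : ℤ) : LaurentSeries ℚ_[p]))) = 0 := by
    rw [e4]
    refine hS _ ?_
    rw [deg_lt_iff _ _ (by omega)]
    refine lt_of_le_of_lt natDegree_mul_le ?_
    rw [NP_natDegree, natDegree_comp, natDegree_X_add_C, hN0d]
    simp; omega
  rw [k1, k2, zero_sub, zero_eq_neg] at h1
  rw [Finset.sum_eq_single x0] at h1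
  · rcases mul_eq_zero.mp h1 with h | h
    · exact hW h
    · have h' : rf N0 J s (x0 + ((0 : ℤ) : ℚ)) = 0 := by exact_mod_cast h
      rw [rf, div_eq_zero_iff] at h'
      simp only [Int.cast_zero, add_zero] at h'
      rcases h' with h' | h'
      · rw [hN0, map_prod, Finset.prod_eq_zero_iff] at h'
        obtain ⟨a, ha, h'⟩ := h'
        simp [sub_eq_zero] at h'
        exact Finset.ne_of_mem_erase ha h'.symm
      · refine aeval_NP_ne J s x0 ?_ h'
        intro k _ hk
        obtain ⟨h2, h3⟩ := hF x0 hx0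
        have h4 : x0 = ((-k : ℤ) : ℚ) := by push_cast; linear_combination hk
        rw [h4] at h2 h3
        have h1' : (0 : ℤ) < -k := by exact_mod_cast h2
        have h2' : -k < (1 : ℤ) := by exact_mod_cast h3
        omega
  · intro x hx hxx
    have : rf N0 J s (x + ((0 : ℤ) : ℚ)) = 0 := by
      rw [rf, hN0, map_prod]
      rw [Finset.prod_eq_zero (Finset.mem_erase.mpr ⟨hxx, hx⟩)]
      · simp
      · simp
    rw [this]; simp
  · intro h; exact absurd hx0 h

end PZ

namespace PZ
open Polynomial

lemma int_of_padic (x : ℚ) (h : ∀ (q : ℕ) [Fact q.Prime], ‖(x : ℚ_[q])‖ ≤ 1) : ∃ z : ℤ, x = z := by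
  by_contra hcon
  have h1 : x.den ≠ 1 := fun h1 => hcon ⟨x.num, ((Rat.den_eq_one_iff x).mp h1).symm⟩
  obtain ⟨q, hq, hqd⟩ := Nat.exists_prime_and_dvd h1
  haveI : Fact q.Prime := ⟨hq⟩
  have h2 := h q
  have h3 : (x : ℚ_[q]) * (x.den : ℚ_[q]) = (x.num : ℚ_[q]) := by
    have := Rat.mul_den_eq_num x
    exact_mod_cast congrArg (fun t : ℚ => (t : ℚ_[q])) this
  have h4 : ‖(x.den : ℚ_[q])‖ < 1 := Padic.norm_natCast_lt_one_iff.mpr hqd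
  have h5 : ‖(x.num : ℚ_[q])‖ < 1 := by
    rw [← h3, norm_mul]
    exact lt_of_le_of_lt (mul_le_of_le_one_left (norm_nonneg _) h2) h4
  rw [Padic.norm_intCast_lt_one_iff] at h5
  have h6 := x.reduced
  have h7 : q ∣ x.num.natAbs := Int.natCast_dvd.mp h5
  exact Nat.Prime.one_lt hq |>.ne' (Nat.dvd_one.mp (h6 ▸ Nat.dvd_gcd h7 hqd))

/-- kappa -/
def kap (D n : ℕ) : ℕ := ∏ q ∈ D.primeFactors, q ^ (n.factorial.factorization q)

lemma kap_pos (D n : ℕ) : 0 < kap D n :=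
  Finset.prod_pos fun q hq => pow_pos (Nat.prime_of_mem_primeFactors hq).pos _

lemma norm_kap {q : ℕ} [hq : Fact q.Prime] {D n : ℕ} (hD : D ≠ 0) (hqD : q ∣ D) :
    ‖(kap D n : ℚ_[q])‖ = ‖((n.factorial : ℕ) : ℚ_[q])‖ := by
  have h1 : q ∈ D.primeFactors := Nat.mem_primeFactors.mpr ⟨hq.out, hqD, hD⟩
  have h2 : ‖((n.factorial : ℕ) : ℚ_[q])‖ = ‖((q ^ (n.factorial.factorization q) : ℕ) : ℚ_[q])‖ := by
    conv_lhs => rw [← Nat.ordProj_mul_ordCompl_eq_self n.factorial q]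
    push_cast
    rw [norm_mul]
    have : ‖((ordCompl[q] n.factorial : ℕ) : ℚ_[q])‖ = 1 := by
      rw [Padic.norm_natCast_eq_one_iff]
      exact Nat.coprime_ordCompl hq.out (Nat.factorial_ne_zero _)
    rw [this, mul_one]
  rw [h2, kap, ← Finset.mul_prod_erase _ _ h1]
  push_cast
  rw [norm_mul, norm_prod, Finset.prod_eq_one, mul_one]
  intro r hr
  rw [norm_pow]
  have : ‖(r : ℚ_[q])‖ = 1 := by
    rw [Padic.norm_natCast_eq_one_iff]
    exact (Nat.coprime_primes hq.out (Nat.prime_of_mem_primeFactors (Finset.mem_of_mem_erase hr))).mpr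
      (Finset.ne_of_mem_erase hr).symm
  rw [this, one_pow]

lemma smeval_desc {R : Type*} [CommRing R] (r : R) (n : ℕ) :
    (descPochhammer ℤ n).smeval r = ∏ l ∈ Finset.range n, (r - (l : R)) := by
  rw [← aeval_eq_smeval]
  induction n with
  | zero => simp
  | succ n ih =>
    rw [descPochhammer_succ_right, map_mul, ih, Finset.prod_range_succ]
    simp

lemma vandermonde (f β : PowerSeries ℚ) (n : ℕ) :
    ∏ l ∈ Finset.range n, (f + β - (l : PowerSeries ℚ)) =
      ∑ ij ∈ Finset.HasAntidiagonal.antidiagonal n, (n.choose ij.1 : PowerSeries ℚ) *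
        ((∏ l ∈ Finset.range ij.1, (f - (l : PowerSeries ℚ))) * ∏ l ∈ Finset.range ij.2, (β - (l : PowerSeries ℚ))) := by
  have := Ring.descPochhammer_smeval_add (r := f) (s := β) n (Commute.all _ _)
  simp only [smeval_desc] at this
  rw [this]

lemma choose_padic {q : ℕ} [hq : Fact q.Prime] (x : ℚ_[q]) (hx : ‖x‖ ≤ 1) (r : ℕ) :
    ‖(∏ l ∈ Finset.range r, (x - (l : ℚ_[q]))) / (r.factorial : ℚ_[q])‖ ≤ 1 := by
  let y : ℤ_[q] := ⟨x, hx⟩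
  have h1 := Ring.descPochhammer_eq_factorial_smul_choose y r
  rw [smeval_desc, nsmul_eq_mul] at h1
  have h2 := congrArg (PadicInt.Coe.ringHom (p := q)) h1
  rw [map_prod, map_mul, map_natCast] at h2
  have h3 : ∀ l : ℕ, PadicInt.Coe.ringHom (y - (l : ℤ_[q])) = x - (l : ℚ_[q]) := by
    intro l
    rw [map_sub, map_natCast]; rfl
  simp only [h3] at h2
  rw [h2]
  have h4 : ((r.factorial : ℕ) : ℚ_[q]) ≠ 0 := by exact_mod_cast Nat.factorial_ne_zero r
  rw [mul_div_cancel_left₀ _ h4]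
  exact (Ring.choose y r).2

lemma kap_choose (D n r : ℕ) (hD : D ≠ 0) (hr : r ≤ n) (β : ℚ) (u : ℤ) (hβ : (D : ℚ) * β = u) :
    ∃ z : ℤ, (kap D n : ℚ) * (D : ℚ) ^ n * ((∏ l ∈ Finset.range r, (β - (l : ℚ))) / (r.factorial : ℚ)) = z := by
  apply int_of_padic
  intro q hq
  push_cast
  have hβ' : (D : ℚ_[q]) * (β : ℚ_[q]) = (u : ℚ_[q]) := by
    exact_mod_cast congrArg (fun t : ℚ => (t : ℚ_[q])) hβ
  have hn1 : ∀ m : ℕ, ‖(m : ℚ_[q])‖ ≤ 1 := fun m => by simpa using Padic.norm_int_le_one (p := q) m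
  by_cases hqD : q ∣ D
  · have e1 : (kap D n : ℚ_[q]) * (D : ℚ_[q]) ^ n * ((∏ l ∈ Finset.range r, ((β : ℚ_[q]) - (l : ℚ_[q]))) / (r.factorial : ℚ_[q]))
      = ((kap D n : ℚ_[q]) / (r.factorial : ℚ_[q])) * ((D : ℚ_[q]) ^ (n - r) * ∏ l ∈ Finset.range r, ((u - (D : ℤ) * l : ℤ) : ℚ_[q])) := by
      have e2 : (∏ l ∈ Finset.range r, ((u - (D : ℤ) * l : ℤ) : ℚ_[q])) =
          (D : ℚ_[q]) ^ r * ∏ l ∈ Finset.range r, ((β : ℚ_[q]) - (l : ℚ_[q])) := by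
        rw [← Finset.card_range r, ← Finset.prod_const, Finset.card_range, ← Finset.prod_mul_distrib]
        refine Finset.prod_congr rfl fun l _ => ?_
        push_cast
        rw [← hβ']; ring
      rw [e2]
      obtain ⟨m, rfl⟩ := Nat.exists_eq_add_of_le hr
      simp only [add_tsub_cancel_left]
      ring
    rw [e1, norm_mul, norm_mul, norm_div, norm_kap hD hqD]
    refine mul_le_one₀ ?_ (by positivity) (mul_le_one₀ ?_ (norm_nonneg _) ?_)
    · refine div_le_one_of_le₀ ?_ (norm_nonneg _)
      obtain ⟨m, hm⟩ := Nat.factorial_dvd_factorial hr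
      rw [hm]; push_cast
      rw [norm_mul]
      exact mul_le_of_le_one_right (norm_nonneg _) (hn1 m)
    · rw [norm_pow]; exact pow_le_one₀ (norm_nonneg _) (hn1 _)
    · rw [norm_prod]; exact Finset.prod_le_one (fun _ _ => norm_nonneg _) (fun _ _ => Padic.norm_int_le_one _)
  · have h1 : ‖(D : ℚ_[q])‖ = 1 := by
      rw [Padic.norm_natCast_eq_one_iff]; exact (Nat.Prime.coprime_iff_not_dvd hq.out).mpr hqD
    have h2 : ‖(β : ℚ_[q])‖ ≤ 1 := by
      have := congrArg norm hβ'
      rw [norm_mul, h1, one_mul] at this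
      rw [this]; exact Padic.norm_int_le_one _
    rw [norm_mul, norm_mul, norm_pow, h1, one_pow, mul_one]
    exact mul_le_one₀ (hn1 _) (norm_nonneg _) (choose_padic _ h2 r)

/-- the ring of series with `d^e g_e` integral -/
noncomputable def Ad (d : ℕ) : Subring (PowerSeries ℚ) :=
  ((PowerSeries.map (Int.castRingHom ℚ)).range).comap (PowerSeries.rescale (d : ℚ))

lemma mem_Ad {d : ℕ} {g : PowerSeries ℚ} : g ∈ Ad d ↔ ∀ e, ∃ z : ℤ, (d : ℚ) ^ e * PowerSeries.coeff e g = z := by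
  rw [Ad, Subring.mem_comap, RingHom.mem_range]
  constructor
  · rintro ⟨f, hf⟩ e
    refine ⟨PowerSeries.coeff e f, ?_⟩
    rw [← PowerSeries.coeff_rescale, ← hf]; simp
  · intro h
    choose z hz using h
    refine ⟨PowerSeries.mk z, ?_⟩
    ext e
    rw [PowerSeries.coeff_rescale, hz e]; simp

lemma int_mem_Ad {d : ℕ} {q : ℚ} (h : ∃ z : ℤ, q = z) : PowerSeries.C q ∈ Ad d := by
  obtain ⟨z, rfl⟩ := h
  rw [map_intCast]
  exact intCast_mem _ z

lemma X_mem_Ad {d : ℕ} {q : ℚ} (h : ∃ z : ℤ, (d : ℚ) * q = z) : PowerSeries.C q * PowerSeries.X ∈ Ad d := by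
  rw [mem_Ad]
  intro e
  rw [PowerSeries.coeff_C_mul, PowerSeries.coeff_X]
  split_ifs with he
  · subst he; simpa using h
  · exact ⟨0, by simp⟩

lemma inv_mem_Ad {d : ℕ} {q : ℚ} (h : ∃ z : ℤ, (d : ℚ) * q = z) :
    PowerSeries.mk (fun e => (-q) ^ e) ∈ Ad d := by
  rw [mem_Ad]
  intro e
  obtain ⟨z, hz⟩ := h
  refine ⟨(-z) ^ e, ?_⟩
  rw [PowerSeries.coeff_mk, ← mul_pow, mul_neg, hz]; push_cast; rfl

lemma inv_lin (q : ℚ) : PowerSeries.mk (fun e => (-q) ^ e) * (1 + PowerSeries.C q * PowerSeries.X) = 1 := by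
  ext e
  rw [mul_add, mul_one, mul_left_comm, map_add, PowerSeries.coeff_C_mul]
  cases e with
  | zero => simp
  | succ e => rw [PowerSeries.coeff_succ_mul_X]; simp [pow_succ, PowerSeries.coeff_one]; ring

lemma choose_mem_Ad {d n i : ℕ} (hi : i ≤ n) (hd : ∀ m : ℕ, 1 ≤ m → m ≤ n → m ∣ d) :
    PowerSeries.C ((i.factorial : ℚ)⁻¹) * ∏ l ∈ Finset.range i, (PowerSeries.X - (l : PowerSeries ℚ)) ∈ Ad d := by
  cases i with
  | zero => simp
  | succ i =>
    have key : ∀ i, (PowerSeries.C ((i.factorial : ℚ)⁻¹)) * ∏ l ∈ Finset.range i, (PowerSeries.X - ((l + 1 : ℕ) : PowerSeries ℚ)) =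
        ∏ l ∈ Finset.range i, (PowerSeries.C (((l + 1 : ℕ) : ℚ)⁻¹) * PowerSeries.X - 1) := by
      intro i
      induction i with
      | zero => simp
      | succ i ih =>
        rw [Finset.prod_range_succ, Finset.prod_range_succ, ← ih, Nat.factorial_succ]
        have : PowerSeries.C ((((i + 1 : ℕ) : ℚ))⁻¹) * (((i + 1 : ℕ) : PowerSeries ℚ)) = 1 := by
          rw [← map_natCast (PowerSeries.C (R := ℚ)), ← map_mul, inv_mul_cancel₀ (by positivity), map_one]
        rw [Nat.cast_mul, mul_inv, map_mul]
        linear_combination (-(PowerSeries.C ((i.factorial : ℚ)⁻¹)) * ∏ l ∈ Finset.range i, (PowerSeries.X - ((l + 1 : ℕ) : PowerSeries ℚ))) * this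
    have hinv : ∀ m : ℕ, 1 ≤ m → m ≤ n → ∃ z : ℤ, (d : ℚ) * (m : ℚ)⁻¹ = z := by
      intro m h1 h2
      obtain ⟨c, hc⟩ := hd m h1 h2
      refine ⟨c, ?_⟩
      have : (m : ℚ) ≠ 0 := by positivity
      rw [hc]; push_cast; field_simp
    rw [Finset.prod_range_succ', Nat.factorial_succ]
    have e : PowerSeries.C ((((i + 1) * i.factorial : ℕ) : ℚ)⁻¹) * ((∏ l ∈ Finset.range i, (PowerSeries.X - ((l + 1 : ℕ) : PowerSeries ℚ))) *
        (PowerSeries.X - ((0 : ℕ) : PowerSeries ℚ))) = (PowerSeries.C (((i + 1 : ℕ) : ℚ)⁻¹) * PowerSeries.X) *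
        ∏ l ∈ Finset.range i, (PowerSeries.C (((l + 1 : ℕ) : ℚ)⁻¹) * PowerSeries.X - 1) := by
      rw [← key, Nat.cast_mul, mul_inv, map_mul]
      simp only [Nat.cast_zero, sub_zero]
      ring
    rw [e]
    refine mul_mem (X_mem_Ad (hinv _ (by omega) hi)) (prod_mem fun l hl => sub_mem (X_mem_Ad (hinv _ (by omega) ?_)) (one_mem _))
    rw [Finset.mem_range] at hl
    omega

lemma zero_factor_mem_Ad {d n : ℕ} (hd : ∀ m : ℕ, 1 ≤ m → m ≤ n → m ∣ d) (D : ℕ) (hD : D ≠ 0) (β : ℚ) (u : ℤ)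
    (hβ : (D : ℚ) * β = u) :
    PowerSeries.C ((kap D n : ℚ) * (D : ℚ) ^ n / (n.factorial : ℚ)) *
      ∏ l ∈ Finset.range n, (PowerSeries.X + PowerSeries.C β - (l : PowerSeries ℚ)) ∈ Ad d := by
  rw [vandermonde, Finset.mul_sum]
  refine sum_mem fun ij hij => ?_
  obtain ⟨i, r⟩ := ij
  have hir : i + r = n := by simpa using hij
  simp only
  have e1 : (∏ l ∈ Finset.range r, (PowerSeries.C β - (l : PowerSeries ℚ))) =
      PowerSeries.C (∏ l ∈ Finset.range r, (β - (l : ℚ))) := by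
    rw [map_prod]; refine Finset.prod_congr rfl fun l _ => ?_
    rw [map_sub, map_natCast]
  have e2 : PowerSeries.C ((kap D n : ℚ) * (D : ℚ) ^ n / (n.factorial : ℚ)) *
      ((n.choose i : PowerSeries ℚ) * ((∏ l ∈ Finset.range i, (PowerSeries.X - (l : PowerSeries ℚ))) *
        PowerSeries.C (∏ l ∈ Finset.range r, (β - (l : ℚ))))) =
      PowerSeries.C ((kap D n : ℚ) * (D : ℚ) ^ n * ((∏ l ∈ Finset.range r, (β - (l : ℚ))) / (r.factorial : ℚ))) *
      (PowerSeries.C ((i.factorial : ℚ)⁻¹) * ∏ l ∈ Finset.range i, (PowerSeries.X - (l : PowerSeries ℚ))) := by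
    have e3 : (kap D n : ℚ) * (D : ℚ) ^ n / (n.factorial : ℚ) * ((n.choose i : ℚ) * (∏ l ∈ Finset.range r, (β - (l : ℚ)))) =
      (kap D n : ℚ) * (D : ℚ) ^ n * ((∏ l ∈ Finset.range r, (β - (l : ℚ))) / (r.factorial : ℚ)) * (i.factorial : ℚ)⁻¹ := by
      have h1 := Nat.choose_mul_factorial_mul_factorial (n := n) (k := i) (by omega)
      have h2 : n - i = r := by omega
      rw [h2] at h1
      rw [← h1]
      have h3 : (i.factorial : ℚ) ≠ 0 := by exact_mod_cast i.factorial_ne_zero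
      have h4 : (r.factorial : ℚ) ≠ 0 := by exact_mod_cast r.factorial_ne_zero
      have h5 : (n.choose i : ℚ) ≠ 0 := by exact_mod_cast (Nat.choose_pos (by omega)).ne'
      push_cast
      field_simp
    have := congrArg (PowerSeries.C (R := ℚ)) e3
    rw [map_mul, map_mul, map_mul _ _ ((i.factorial : ℚ)⁻¹), map_natCast] at this
    linear_combination (∏ l ∈ Finset.range i, (PowerSeries.X - (l : PowerSeries ℚ))) * this
  rw [e1, e2]
  exact mul_mem (int_mem_Ad (kap_choose D n r hD (by omega) β u hβ)) (choose_mem_Ad (by omega) hd)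

end PZ

namespace PZ
open Polynomial

/-- bounded coefficients up to index `s` -/
def Bnd (s : ℕ) (g : PowerSeries ℚ) (M : ℝ) : Prop :=
  ∀ e ≤ s, |((PowerSeries.coeff e g : ℚ) : ℝ)| ≤ M

lemma Bnd.nonneg {s : ℕ} {g : PowerSeries ℚ} {M : ℝ} (h : Bnd s g M) : 0 ≤ M :=
  (abs_nonneg _).trans (h 0 (Nat.zero_le _))

lemma Bnd.mono {s : ℕ} {g : PowerSeries ℚ} {M M' : ℝ} (h : Bnd s g M) (hM : M ≤ M') : Bnd s g M' :=
  fun e he => (h e he).trans hM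

lemma Bnd.mul {s : ℕ} {f g : PowerSeries ℚ} {M M' : ℝ} (hf : Bnd s f M) (hg : Bnd s g M') :
    Bnd s (f * g) ((s + 1) * (M * M')) := by
  intro e he
  rw [PowerSeries.coeff_mul]
  push_cast
  refine (Finset.abs_sum_le_sum_abs _ _).trans ?_
  have h1 : ∀ ij ∈ Finset.HasAntidiagonal.antidiagonal e,
      |((PowerSeries.coeff ij.1 f : ℚ) : ℝ) * ((PowerSeries.coeff ij.2 g : ℚ) : ℝ)| ≤ M * M' := by
    intro ij hij
    rw [Finset.HasAntidiagonal.mem_antidiagonal] at hij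
    rw [abs_mul]
    exact mul_le_mul (hf _ (by omega)) (hg _ (by omega)) (abs_nonneg _) hf.nonneg
  refine (Finset.sum_le_card_nsmul _ _ _ h1).trans ?_
  rw [Finset.Nat.card_antidiagonal, nsmul_eq_mul]
  refine mul_le_mul_of_nonneg_right ?_ (mul_nonneg hf.nonneg hg.nonneg)
  push_cast
  have : (e : ℝ) ≤ s := by exact_mod_cast he
  linarith

lemma Bnd.one (s : ℕ) : Bnd s 1 1 := by
  intro e _
  rw [PowerSeries.coeff_one]
  split_ifs <;> simp

lemma Bnd.prod {ι : Type*} (S : Finset ι) {s : ℕ} {g : ι → PowerSeries ℚ} {M : ι → ℝ} (h : ∀ i ∈ S, Bnd s (g i) (M i)) :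
    Bnd s (∏ i ∈ S, g i) ((s + 1) ^ S.card * ∏ i ∈ S, M i) := by
  classical
  induction S using Finset.induction_on with
  | empty => simpa using Bnd.one s
  | insert a S ha ih =>
    rw [Finset.prod_insert ha, Finset.prod_insert ha, Finset.card_insert_of_notMem ha]
    refine ((h a (Finset.mem_insert_self _ _)).mul (ih fun i hi => h i (Finset.mem_insert_of_mem hi))).mono (le_of_eq ?_)
    ring

lemma Bnd.pow {s : ℕ} {g : PowerSeries ℚ} {M : ℝ} (h : Bnd s g M) (m : ℕ) :
    Bnd s (g ^ m) ((s + 1) ^ m * M ^ m) := by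
  have := Bnd.prod (Finset.range m) (g := fun _ => g) (M := fun _ => M) (fun _ _ => h)
  simpa using this

lemma Bnd.C_mul {s : ℕ} {g : PowerSeries ℚ} {M : ℝ} (h : Bnd s g M) (c : ℚ) :
    Bnd s (PowerSeries.C c * g) (|(c : ℝ)| * M) := by
  intro e he
  rw [PowerSeries.coeff_C_mul]; push_cast; rw [abs_mul]
  exact mul_le_mul_of_nonneg_left (h e he) (abs_nonneg _)

/-- products of linear polynomials -/
lemma Bnd_lin {ι : Type*} (S : Finset ι) (a : ι → ℚ) (A : ℝ) (hA : 0 ≤ A) (ha : ∀ i ∈ S, |(a i : ℝ)| ≤ A) (s : ℕ) :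
    Bnd s (∏ i ∈ S, (PowerSeries.X + PowerSeries.C (a i))) ((1 + A) ^ S.card) := by
  classical
  induction S using Finset.induction_on with
  | empty => simpa using Bnd.one s
  | insert b S hb ih =>
    have ih := ih fun i hi => ha i (Finset.mem_insert_of_mem hi)
    rw [Finset.prod_insert hb, Finset.card_insert_of_notMem hb]
    intro e he
    rw [add_mul, map_add, PowerSeries.coeff_C_mul]
    have hb' := ha b (Finset.mem_insert_self _ _)
    have h1 : |((PowerSeries.coeff e (PowerSeries.X * ∏ i ∈ S, (PowerSeries.X + PowerSeries.C (a i))) : ℚ) : ℝ)| ≤ (1 + A) ^ S.card := by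
      cases e with
      | zero => simp; positivity
      | succ e => rw [mul_comm, PowerSeries.coeff_succ_mul_X]; exact ih e (by omega)
    push_cast
    refine (abs_add_le _ _).trans ?_
    rw [abs_mul, pow_succ]
    have h2 := mul_le_mul hb' (ih e he) (abs_nonneg _) hA
    linarith

lemma geom_le (m e : ℕ) : ∑ i ∈ Finset.range (e + 1), (m : ℝ) ^ i ≤ ((m : ℝ) + 1) ^ e := by
  rw [add_pow]
  refine Finset.sum_le_sum fun i hi => ?_
  rw [Finset.mem_range] at hi
  have : (1 : ℝ) ≤ (e.choose i : ℝ) := by exact_mod_cast Nat.choose_pos (by omega)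
  rw [one_pow, mul_one]
  nlinarith [pow_nonneg (Nat.cast_nonneg (α := ℝ) m) i]

/-- products of geometric series -/
lemma bnd_geom {ι : Type*} (S : Finset ι) (a : ι → ℚ) (ha : ∀ i ∈ S, |(a i : ℝ)| ≤ 1) (e : ℕ) :
    |((PowerSeries.coeff e (∏ i ∈ S, PowerSeries.mk (fun e => (-(a i)) ^ e)) : ℚ) : ℝ)| ≤ (S.card : ℝ) ^ e := by
  classical
  induction S using Finset.induction_on generalizing e with
  | empty =>
    rw [Finset.prod_empty, PowerSeries.coeff_one]
    split_ifs with h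
    · simp [h]
    · simp [h]
  | insert b S hb ih =>
    have ih := ih fun i hi => ha i (Finset.mem_insert_of_mem hi)
    rw [Finset.prod_insert hb, Finset.card_insert_of_notMem hb, mul_comm, PowerSeries.coeff_mul]
    push_cast
    refine (Finset.abs_sum_le_sum_abs _ _).trans ?_
    rw [Finset.Nat.sum_antidiagonal_eq_sum_range_succ_mk]
    refine le_trans ?_ (geom_le S.card e)
    refine Finset.sum_le_sum fun i hi => ?_
    simp only [PowerSeries.coeff_mk]
    push_cast
    rw [abs_mul, abs_pow, abs_neg]
    have h1 := pow_le_one₀ (abs_nonneg _) (ha b (Finset.mem_insert_self _ _)) (n := e - i)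
    exact (mul_le_of_le_one_right (abs_nonneg _) h1).trans (ih i)

/-- normalising constant -/
noncomputable def cst (F : Finset ℚ) (s n : ℕ) : ℚ :=
  (n.factorial : ℚ) ^ s * ∏ θ ∈ F, ((kap θ.den n : ℚ) * (θ.den : ℚ) ^ n / (n.factorial : ℚ))

/-- the numerator -/
noncomputable def NN (F : Finset ℚ) (s n j : ℕ) : ℚ[X] := C (cst F s n) * (X ^ j * ZP F (Finset.Icc 1 n))

lemma prod_nodes (n k : ℕ) (hk : k ≤ n) :
    ∏ k' ∈ (Finset.Icc (0 : ℤ) n).erase k, ((k' : ℚ) - k) = (-1) ^ k * (k.factorial : ℚ) * ((n - k).factorial : ℚ) := by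
  induction n, hk using Nat.le_induction with
  | base =>
    have e : (Finset.Icc (0 : ℤ) k).erase k = (Finset.range k).map Nat.castEmbedding := by
      ext a; simp only [Finset.mem_erase, Finset.mem_Icc, Finset.mem_map, Finset.mem_range, Nat.castEmbedding_apply]
      constructor
      · rintro ⟨h1, h2, h3⟩
        exact ⟨a.toNat, by omega, by omega⟩
      · rintro ⟨b, hb, rfl⟩; omega
    rw [e, Finset.prod_map, ← Finset.prod_range_reflect]
    simp only [Nat.castEmbedding_apply, Int.cast_natCast, Nat.sub_self, Nat.factorial_zero, Nat.cast_one, mul_one]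
    rw [← Finset.prod_range_add_one_eq_factorial]
    push_cast
    conv_rhs => rw [← Finset.card_range k, ← Finset.prod_const, Finset.card_range, ← Finset.prod_mul_distrib]
    refine Finset.prod_congr rfl fun i hi => ?_
    rw [Finset.mem_range] at hi
    have : ((k - 1 - i : ℕ) : ℚ) = k - 1 - i := by rw [Nat.cast_sub (by omega), Nat.cast_sub (by omega)]; simp
    rw [this]; ring
  | succ n hn ih =>
    have e : (Finset.Icc (0 : ℤ) (n + 1 : ℕ)).erase k = insert ((n + 1 : ℕ) : ℤ) ((Finset.Icc (0 : ℤ) n).erase k) := by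
      ext a; simp only [Finset.mem_erase, Finset.mem_Icc, Finset.mem_insert]; push_cast; omega
    rw [e, Finset.prod_insert (by simp), ih]
    have e2 : n + 1 - k = (n - k) + 1 := by omega
    rw [e2, Nat.factorial_succ]
    push_cast
    rw [Nat.cast_sub hn]; ring

/-- pole factor -/
noncomputable def G1 (n : ℕ) (k : ℤ) : PowerSeries ℚ :=
  PowerSeries.C ((n.factorial : ℚ) * (∏ k' ∈ (Finset.Icc (0 : ℤ) n).erase k, ((k' : ℚ) - k))⁻¹) *
    ∏ k' ∈ (Finset.Icc (0 : ℤ) n).erase k, PowerSeries.mk (fun e => (-(((k' : ℚ) - k)⁻¹)) ^ e)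

lemma node_ne {n : ℕ} {k k' : ℤ} (hk' : k' ∈ (Finset.Icc (0 : ℤ) n).erase k) : ((k' : ℚ) - k) ≠ 0 := by
  have : k' ≠ k := Finset.ne_of_mem_erase hk'
  rw [sub_ne_zero]; exact_mod_cast this

lemma G1_mul (n : ℕ) (k : ℤ) :
    G1 n k * ∏ k' ∈ (Finset.Icc (0 : ℤ) n).erase k, (PowerSeries.X + PowerSeries.C ((k' : ℚ) - k)) = PowerSeries.C (n.factorial : ℚ) := by
  have e : ∏ k' ∈ (Finset.Icc (0 : ℤ) n).erase k, (PowerSeries.X + PowerSeries.C ((k' : ℚ) - k)) =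
      (∏ k' ∈ (Finset.Icc (0 : ℤ) n).erase k, PowerSeries.C ((k' : ℚ) - k)) *
      ∏ k' ∈ (Finset.Icc (0 : ℤ) n).erase k, (1 + PowerSeries.C (((k' : ℚ) - k)⁻¹) * PowerSeries.X) := by
    rw [← Finset.prod_mul_distrib]
    refine Finset.prod_congr rfl fun k' hk' => ?_
    rw [mul_add, ← mul_assoc, ← map_mul, mul_inv_cancel₀ (node_ne hk')]
    simp [add_comm]
  rw [e, G1, ← map_prod]
  have h2 : (∏ k' ∈ (Finset.Icc (0 : ℤ) n).erase k, PowerSeries.mk (fun e => (-(((k' : ℚ) - k)⁻¹)) ^ e)) *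
    ∏ k' ∈ (Finset.Icc (0 : ℤ) n).erase k, (1 + PowerSeries.C (((k' : ℚ) - k)⁻¹) * PowerSeries.X) = 1 := by
    rw [← Finset.prod_mul_distrib]
    exact Finset.prod_eq_one fun k' _ => inv_lin _
  have h3 : PowerSeries.C ((n.factorial : ℚ) * (∏ k' ∈ (Finset.Icc (0 : ℤ) n).erase k, ((k' : ℚ) - k))⁻¹) *
     PowerSeries.C (∏ k' ∈ (Finset.Icc (0 : ℤ) n).erase k, ((k' : ℚ) - k)) = PowerSeries.C (n.factorial : ℚ) := by
    rw [← map_mul, mul_assoc, inv_mul_cancel₀, mul_one]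
    exact Finset.prod_ne_zero_iff.mpr fun k' hk' => node_ne hk'
  rw [← h3]
  linear_combination (PowerSeries.C ((n.factorial : ℚ) * (∏ k' ∈ (Finset.Icc (0 : ℤ) n).erase k, ((k' : ℚ) - k))⁻¹) *
     PowerSeries.C (∏ k' ∈ (Finset.Icc (0 : ℤ) n).erase k, ((k' : ℚ) - k))) * h2

lemma G1_const (n k : ℕ) (hk : k ≤ n) :
    (n.factorial : ℚ) * (∏ k' ∈ (Finset.Icc (0 : ℤ) n).erase (k : ℤ), ((k' : ℚ) - (k : ℤ)))⁻¹ = (-1) ^ k * n.choose k := by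
  have := prod_nodes n k hk
  push_cast at this ⊢
  rw [this, ← Nat.choose_mul_factorial_mul_factorial hk]
  have h3 : (k.factorial : ℚ) ≠ 0 := by exact_mod_cast k.factorial_ne_zero
  have h4 : ((n - k).factorial : ℚ) ≠ 0 := by exact_mod_cast (n - k).factorial_ne_zero
  push_cast
  rw [mul_inv, mul_inv, ← inv_pow]
  field_simp

lemma G1_mem {d n : ℕ} (hd : ∀ m : ℕ, 1 ≤ m → m ≤ n → m ∣ d) (k : ℕ) (hk : k ≤ n) : G1 n k ∈ Ad d := by
  rw [G1]
  refine mul_mem (int_mem_Ad ⟨(-1) ^ k * n.choose k, by rw [G1_const n k hk]; push_cast; rfl⟩) (prod_mem fun k' hk' => inv_mem_Ad ?_)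
  have h0 := node_ne hk'
  rw [Finset.mem_erase, Finset.mem_Icc] at hk'
  have h1 : (k' - k) ∣ (d : ℤ) := by
    rw [← Int.natAbs_dvd_natAbs, Int.natAbs_natCast]
    exact hd _ (by omega) (by omega)
  obtain ⟨c, hc⟩ := h1
  refine ⟨c, ?_⟩
  have : (d : ℚ) = ((k' : ℚ) - (k : ℤ)) * c := by exact_mod_cast congrArg (fun t : ℤ => (t : ℚ)) hc
  rw [this]; field_simp

lemma G1_bnd {n : ℕ} (k : ℕ) (hk : k ≤ n) (s : ℕ) : Bnd s (G1 n k) (2 ^ n * ((n : ℝ) + 1) ^ s) := by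
  rw [G1, G1_const n k hk]
  have h1 : Bnd s (∏ k' ∈ (Finset.Icc (0 : ℤ) n).erase k, PowerSeries.mk (fun e => (-(((k' : ℚ) - (k : ℤ))⁻¹)) ^ e)) (((n : ℝ) + 1) ^ s) := by
    intro e he
    refine (bnd_geom _ _ ?_ e).trans ?_
    · intro k' hk'
      push_cast
      rw [abs_inv]
      refine inv_le_one_of_one_le₀ ?_
      have h0 : k' ≠ k := Finset.ne_of_mem_erase hk'
      have h2 : (1 : ℤ) ≤ |k' - k| := by
        rw [← Int.natCast_natAbs]; omega
      exact_mod_cast h2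
    · refine (pow_le_pow_left₀ (by positivity) (?_ : _ ≤ (n : ℝ) + 1) e).trans (pow_le_pow_right₀ (by linarith [Nat.cast_nonneg (α := ℝ) n]) he)
      have : ((Finset.Icc (0 : ℤ) n).erase k).card ≤ n + 1 := (Finset.card_erase_le).trans (by simp)
      exact_mod_cast this
  refine (h1.C_mul _).mono ?_
  refine mul_le_mul_of_nonneg_right ?_ (by positivity)
  push_cast
  rw [abs_mul, abs_pow, abs_neg, abs_one, one_pow, one_mul, abs_of_nonneg (by positivity)]
  have := Nat.choose_le_two_pow n k
  exact_mod_cast this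

/-- zero factor -/
noncomputable def Gz (n : ℕ) (k : ℤ) (θ : ℚ) : PowerSeries ℚ :=
  PowerSeries.C ((kap θ.den n : ℚ) * (θ.den : ℚ) ^ n / (n.factorial : ℚ)) *
    ∏ m ∈ Finset.Icc (1 : ℤ) n, (PowerSeries.X + PowerSeries.C ((m : ℚ) - θ - k))

lemma Gz_mem {d n : ℕ} (hd : ∀ m : ℕ, 1 ≤ m → m ≤ n → m ∣ d) (k : ℤ) (θ : ℚ) : Gz n k θ ∈ Ad d := by
  have h := zero_factor_mem_Ad hd θ.den θ.den_nz ((n : ℚ) - k - θ) (θ.den * (n - k) - θ.num) (by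
    push_cast
    have := Rat.mul_den_eq_num θ
    linear_combination -this)
  rw [Gz]
  have hE : ∏ m ∈ Finset.Icc (1 : ℤ) n, (PowerSeries.X + PowerSeries.C ((m : ℚ) - θ - k)) =
    ∏ l ∈ Finset.range n, (PowerSeries.X + PowerSeries.C ((n : ℚ) - k - θ) - (l : PowerSeries ℚ)) := by
    refine Finset.prod_bij' (i := fun (m : ℤ) _ => ((n : ℤ) - m).toNat) (j := fun (l : ℕ) _ => (n : ℤ) - (l : ℤ)) ?_ ?_ ?_ ?_ ?_
    · intro m hm; rw [Finset.mem_Icc] at hm; rw [Finset.mem_range]; omega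
    · intro l hl; rw [Finset.mem_range] at hl; rw [Finset.mem_Icc]; omega
    · intro m hm; rw [Finset.mem_Icc] at hm; omega
    · intro l hl; rw [Finset.mem_range] at hl; omega
    · intro m hm
      rw [Finset.mem_Icc] at hm
      have : ((((n : ℤ) - m).toNat : ℕ) : ℚ) = n - m := by
        have : ((((n : ℤ) - m).toNat : ℕ) : ℤ) = n - m := by omega
        exact_mod_cast congrArg (fun t : ℤ => (t : ℚ)) this
      rw [← map_natCast (PowerSeries.C (R := ℚ)), this, add_sub_assoc, ← map_sub]
      congr 2; ring
  rw [hE]; exact h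

lemma Gz_bnd {n : ℕ} (k : ℤ) (hk0 : 0 ≤ k) (hk : k ≤ n) (θ : ℚ) (h0 : 0 < θ) (h1 : θ < 1) (s : ℕ) :
    Bnd s (Gz n k θ) ((kap θ.den n : ℝ) * (θ.den : ℝ) ^ n * Real.exp (n + 2)) := by
  have hb := Bnd_lin (Finset.Icc (1 : ℤ) n) (fun m => (m : ℚ) - θ - k) ((n : ℝ) + 1) (by positivity) (by
    intro m hm
    rw [Finset.mem_Icc] at hm
    push_cast
    have a1 : (1 : ℝ) ≤ m := by exact_mod_cast hm.1
    have a2 : (m : ℝ) ≤ n := by exact_mod_cast hm.2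
    have a3 : (0 : ℝ) ≤ k := by exact_mod_cast hk0
    have a4 : (k : ℝ) ≤ n := by exact_mod_cast hk
    have a5 : (0 : ℝ) < θ := by exact_mod_cast h0
    have a6 : (θ : ℝ) < 1 := by exact_mod_cast h1
    rw [abs_le]; constructor <;> linarith) s
  refine (hb.C_mul _).mono ?_
  push_cast
  rw [abs_of_nonneg (by positivity)]
  have e1 : (Finset.Icc (1 : ℤ) n).card = n := by simp
  rw [e1, div_mul_eq_mul_div, mul_div_assoc]
  refine mul_le_mul_of_nonneg_left ?_ (by positivity)
  have := Real.pow_div_factorial_le_exp ((n : ℝ) + 2) (by positivity) n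
  have e2 : 1 + ((n : ℝ) + 1) = n + 2 := by ring
  rw [e2]
  exact this

lemma locG_NN (F : Finset ℚ) (s n j : ℕ) (k : ℤ) :
    locG (Finset.Icc (0 : ℤ) n) s (NN F s n j) k =
     (PowerSeries.X + PowerSeries.C (-(k : ℚ))) ^ j * (∏ θ ∈ F, Gz n k θ) * G1 n k ^ s := by
  have hne := cof_const_ne (Finset.Icc (0 : ℤ) n) s k
  rw [locG, eq_comm, PowerSeries.eq_mul_inv_iff_mul_eq hne, eq_comm]
  have e1 : ((cof (Finset.Icc (0 : ℤ) n) s k : ℚ[X]) : PowerSeries ℚ) =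
      (∏ k' ∈ (Finset.Icc (0 : ℤ) n).erase k, (PowerSeries.X + PowerSeries.C ((k' : ℚ) - k))) ^ s := by
    rw [cof, ← Finset.prod_pow, ← Polynomial.coeToPowerSeries.ringHom_apply, map_prod]
    refine Finset.prod_congr rfl fun k' _ => ?_
    rw [map_pow, map_add, Polynomial.coeToPowerSeries.ringHom_apply, Polynomial.coeToPowerSeries.ringHom_apply,
      Polynomial.coe_C, Polynomial.coe_X]
  rw [e1, mul_assoc _ (G1 n k ^ s), ← mul_pow, G1_mul]
  have e2 : ∏ θ ∈ F, Gz n k θ = PowerSeries.C (∏ θ ∈ F, ((kap θ.den n : ℚ) * (θ.den : ℚ) ^ n / (n.factorial : ℚ))) *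
      ∏ m ∈ Finset.Icc (1 : ℤ) n, ∏ θ ∈ F, (PowerSeries.X + PowerSeries.C ((m : ℚ) - θ - k)) := by
    simp only [Gz]
    rw [Finset.prod_mul_distrib, Finset.prod_comm, map_prod]
  rw [e2, NN, cst, mul_comp, mul_comp, C_comp, pow_comp, X_comp, ZP, Polynomial.prod_comp]
  simp only [Polynomial.prod_comp, add_comp, X_comp, C_comp]
  have e3 : ∀ θ : ℚ, ∀ m : ℤ, (X - C (k : ℚ) + C ((m : ℚ) - θ)) = X + C ((m : ℚ) - θ - k) := by
    intro θ m; simp only [map_sub]; ring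
  simp only [e3]
  rw [← Polynomial.coeToPowerSeries.ringHom_apply]
  simp only [map_mul, map_prod, map_pow, map_add, map_sub, Polynomial.coeToPowerSeries.ringHom_apply, Polynomial.coe_C, Polynomial.coe_X, map_neg]
  ring

theorem pfc_int (F : Finset ℚ) (s n j d : ℕ) (hd : ∀ m : ℕ, 1 ≤ m → m ≤ n → m ∣ d) (k : ℤ)
    (hk : k ∈ Finset.Icc (0 : ℤ) n) (e : ℕ) :
    ∃ z : ℤ, (d : ℚ) ^ e * pfc (Finset.Icc (0 : ℤ) n) s (NN F s n j) k e = z := by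
  rw [Finset.mem_Icc] at hk
  lift k to ℕ using hk.1
  suffices h : locG (Finset.Icc (0 : ℤ) n) s (NN F s n j) k ∈ Ad d from mem_Ad.mp h e
  rw [locG_NN]
  refine mul_mem (mul_mem (pow_mem (add_mem ?_ (int_mem_Ad ⟨-k, by push_cast; rfl⟩)) _) (prod_mem fun θ _ => Gz_mem hd _ _)) (pow_mem (G1_mem hd k (by omega)) _)
  have := X_mem_Ad (d := d) (q := 1) ⟨d, by simp⟩
  simpa using this

theorem pfc_bnd (F : Finset ℚ) (hF : ∀ θ ∈ F, 0 < θ ∧ θ < 1) (s n j : ℕ) (k : ℤ)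
    (hk : k ∈ Finset.Icc (0 : ℤ) n) (e : ℕ) (he : e ≤ s) :
    |((pfc (Finset.Icc (0 : ℤ) n) s (NN F s n j) k e : ℚ) : ℝ)| ≤
      ((s : ℝ) + 1) ^ (s + F.card + 2) * ((n : ℝ) + 2) ^ j * ((2 ^ n * ((n : ℝ) + 1) ^ s) ^ s) *
       ∏ θ ∈ F, ((kap θ.den n : ℝ) * (θ.den : ℝ) ^ n * Real.exp (n + 2)) := by
  rw [Finset.mem_Icc] at hk
  lift k to ℕ using hk.1
  have h1 := Bnd_lin (Finset.range j) (fun _ => -(k : ℚ)) ((n : ℝ) + 1) (by positivity) (by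
    intro i _
    push_cast
    rw [abs_neg, abs_of_nonneg (by positivity)]
    have : (k : ℝ) ≤ n := by exact_mod_cast hk.2
    linarith) s
  rw [Finset.prod_const, Finset.card_range] at h1
  have h2 := Bnd.prod F (fun θ hθ => Gz_bnd (n := n) (k : ℤ) hk.1 hk.2 θ (hF θ hθ).1 (hF θ hθ).2 s)
  have h3 := (G1_bnd (n := n) k (by omega) s).pow s
  have := ((h1.mul h2).mul h3) e he
  rw [pfc, locG_NN]
  refine (le_of_eq ?_).trans (this.trans (le_of_eq ?_))
  · push_cast; rfl
  · rw [pow_add, pow_add]; ring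

end PZ

namespace PZ
open Polynomial

lemma padic_sum_le_one {q : ℕ} [Fact q.Prime] {ι : Type*} (S : Finset ι) (f : ι → ℚ_[q]) (h : ∀ i ∈ S, ‖f i‖ ≤ 1) :
    ‖∑ i ∈ S, f i‖ ≤ 1 :=
  IsUltrametricDist.norm_sum_le_of_forall_le_of_nonneg zero_le_one h

lemma polar_le {q : ℕ} [Fact q.Prime] (d s : ℕ) (c : ℕ → ℚ) (hc : ∀ e, ∃ z : ℤ, (d : ℚ) ^ e * c e = z)
    (y : ℚ_[q]) (hy0 : y ≠ 0) (hy : ‖(d : ℚ_[q])‖ ≤ ‖y‖) :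
    ‖(d : ℚ_[q]) ^ s * ∑ e ∈ Finset.range s, (c e : ℚ_[q]) * (y⁻¹) ^ (s - e)‖ ≤ 1 := by
  rw [Finset.mul_sum]
  refine padic_sum_le_one _ _ fun e he => ?_
  rw [Finset.mem_range] at he
  obtain ⟨z, hz⟩ := hc e
  have hz' : (d : ℚ_[q]) ^ e * (c e : ℚ_[q]) = (z : ℚ_[q]) := by
    exact_mod_cast congrArg (fun t : ℚ => (t : ℚ_[q])) hz
  have e1 : (d : ℚ_[q]) ^ s * ((c e : ℚ_[q]) * (y⁻¹) ^ (s - e)) = (z : ℚ_[q]) * ((d : ℚ_[q]) * y⁻¹) ^ (s - e) := by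
    rw [← hz', mul_pow]
    have : (d : ℚ_[q]) ^ s = (d : ℚ_[q]) ^ e * (d : ℚ_[q]) ^ (s - e) := by rw [← pow_add]; congr 1; omega
    rw [this]; ring
  rw [e1, norm_mul, norm_pow, norm_mul, norm_inv]
  refine mul_le_one₀ (Padic.norm_int_le_one _) (by positivity) (pow_le_one₀ (by positivity) ?_)
  rw [← div_eq_mul_inv]
  exact div_le_one_of_le₀ hy (norm_nonneg _)

theorem rho0_int (F : Finset ℚ) (hF : ∀ θ ∈ F, 0 < θ ∧ θ < 1) (s n j d : ℕ)
    (hd : ∀ m : ℕ, 1 ≤ m → m ≤ n → m ∣ d)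
    (hN : (NN F s n j).degree < (s * (Finset.Icc (0 : ℤ) n).card : ℕ)) (x : ℚ) (hx : x ∈ F) :
    ∃ z : ℤ, (d : ℚ) ^ s * (∑ k ∈ Finset.Icc (0 : ℤ) n, ∑ l ∈ Finset.range k.toNat, ∑ e ∈ Finset.range s,
        (pfc (Finset.Icc (0 : ℤ) n) s (NN F s n j) k e) * ((x + l)⁻¹) ^ (s - e)) = z := by
  set J := Finset.Icc (0 : ℤ) n with hJ
  have hxint : ∀ a : ℤ, x + a ≠ 0 := by
    intro a h
    obtain ⟨h1, h2⟩ := hF x hx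
    have h3 : x = ((-a : ℤ) : ℚ) := by push_cast; linear_combination h
    rw [h3] at h1 h2
    have h1' : (0 : ℤ) < -a := by exact_mod_cast h1
    have h2' : -a < (1 : ℤ) := by exact_mod_cast h2
    omega
  apply int_of_padic
  intro q hq
  push_cast
  rw [Finset.mul_sum]
  refine padic_sum_le_one _ _ fun k hk => ?_
  rw [Finset.mul_sum]
  refine padic_sum_le_one _ _ fun l hl => ?_
  have hk' := hk
  rw [hJ, Finset.mem_Icc] at hk'
  rw [Finset.mem_range] at hl
  by_cases hcase : ‖(d : ℚ_[q])‖ ≤ ‖((x + l : ℚ) : ℚ_[q])‖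
  · have h1 := polar_le (q := q) d s (pfc J s (NN F s n j) k) (fun e => pfc_int F s n j d hd k hk e) ((x + l : ℚ) : ℚ_[q])
      (by have := hxint l; exact_mod_cast this) hcase
    push_cast at h1
    exact h1
  · push Not at hcase
    -- use the zero of R
    have hz0 : rf (NN F s n j) J s (x + ((l - k : ℤ) : ℚ)) = 0 := by
      rw [rf, NN, map_mul, map_mul, coe_aeval_eq_eval]
      have h3 := ZP_eval_zero F (Finset.Icc (1 : ℤ) n) x hx (k - l) (by rw [Finset.mem_Icc]; omega)
      have e2 : (x + ((l - k : ℤ) : ℚ)) = x - ((k - l : ℤ) : ℚ) := by push_cast; ring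
      rw [e2, h3]
      simp
    rw [rf_eq _ J s hN _ (by
      intro k' _
      have := hxint (l - k + k')
      push_cast at this ⊢
      rwa [add_assoc])] at hz0
    rw [← Finset.add_sum_erase _ _ hk] at hz0
    have hz1 := congrArg (fun t : ℚ => (t : ℚ_[q])) hz0
    simp only [eq_ratCast] at hz1
    push_cast at hz1
    have e3 : ∑ e ∈ Finset.range s, ((pfc J s (NN F s n j) k e : ℚ) : ℚ_[q]) * (((x : ℚ_[q]) + l)⁻¹) ^ (s - e) =
       - ∑ k' ∈ J.erase k, ∑ e ∈ Finset.range s, ((pfc J s (NN F s n j) k' e : ℚ) : ℚ_[q]) * (((x + l + (k' - k : ℤ) : ℚ) : ℚ_[q])⁻¹) ^ (s - e) := by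
      rw [eq_neg_iff_add_eq_zero, ← hz1]
      push_cast
      congr 1
      · refine Finset.sum_congr rfl fun e _ => ?_
        rw [show (x : ℚ_[q]) + ((l : ℚ_[q]) - (k : ℚ_[q])) + (k : ℚ_[q]) = (x : ℚ_[q]) + l by ring]
      · refine Finset.sum_congr rfl fun k' _ => Finset.sum_congr rfl fun e _ => ?_
        rw [show (x : ℚ_[q]) + ((l : ℚ_[q]) - (k : ℚ_[q])) + (k' : ℚ_[q]) = (x : ℚ_[q]) + l + ((k' : ℚ_[q]) - k) by ring]
    rw [e3, mul_neg, norm_neg, Finset.mul_sum]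
    refine padic_sum_le_one _ _ fun k' hk'' => ?_
    have hk3 := hk''
    rw [Finset.mem_erase, hJ, Finset.mem_Icc] at hk3
    have hdiv : (k' - k) ∣ (d : ℤ) := by
      rw [← Int.natAbs_dvd_natAbs, Int.natAbs_natCast]
      exact hd _ (by omega) (by omega)
    have hle : ‖(d : ℚ_[q])‖ ≤ ‖((k' - k : ℤ) : ℚ_[q])‖ := by
      obtain ⟨c, hc⟩ := hdiv
      have : (d : ℚ_[q]) = ((k' - k : ℤ) : ℚ_[q]) * (c : ℚ_[q]) := by
        exact_mod_cast congrArg (fun t : ℤ => (t : ℚ_[q])) hc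
      rw [this, norm_mul]
      exact mul_le_of_le_one_right (norm_nonneg _) (Padic.norm_int_le_one _)
    refine polar_le d s (pfc J s (NN F s n j) k') (fun e => pfc_int F s n j d hd k' (Finset.mem_of_mem_erase hk'') e) _ ?_ ?_
    · have := hxint (l + (k' - k))
      rw [Int.cast_add, ← add_assoc] at this
      exact_mod_cast this
    · have h5 : ‖((x + l + (k' - k : ℤ) : ℚ) : ℚ_[q])‖ = ‖((k' - k : ℤ) : ℚ_[q])‖ := by
        have h6 : ((x + l + (k' - k : ℤ) : ℚ) : ℚ_[q]) = ((x + l : ℚ) : ℚ_[q]) + ((k' - k : ℤ) : ℚ_[q]) := by push_cast; ring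
        rw [h6, IsUltrametricDist.norm_add_eq_max_of_norm_ne_norm (hcase.trans_le hle).ne]
        exact max_eq_right (hcase.le.trans hle)
      rw [h5]; exact hle

variable {p : ℕ} [hp : Fact p.Prime]

/-- series with integral coefficients -/
noncomputable def BB (p : ℕ) [Fact p.Prime] : Subring (PowerSeries ℚ_[p]) :=
  (PowerSeries.map (PadicInt.Coe.ringHom (p := p))).range

lemma mem_BB {g : PowerSeries ℚ_[p]} : g ∈ BB p ↔ ∀ e, ‖PowerSeries.coeff e g‖ ≤ 1 := by
  rw [BB, RingHom.mem_range]
  constructor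
  · rintro ⟨f, rfl⟩ e
    rw [PowerSeries.coeff_map]
    exact (PowerSeries.coeff e f).2
  · intro h
    have h2 : ∀ e, ∃ a : ℤ_[p], PadicInt.Coe.ringHom (p := p) a = PowerSeries.coeff e g := fun e => ⟨⟨_, h e⟩, rfl⟩
    choose a ha using h2
    refine ⟨PowerSeries.mk a, ?_⟩
    ext e
    rw [PowerSeries.coeff_map, PowerSeries.coeff_mk]
    exact ha e

lemma C_mem_BB {a : ℚ_[p]} (h : ‖a‖ ≤ 1) : PowerSeries.C a ∈ BB p := by
  rw [mem_BB]; intro e; rw [PowerSeries.coeff_C]; split_ifs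
  · exact h
  · simp

lemma X_mem_BB : (PowerSeries.X : PowerSeries ℚ_[p]) ∈ BB p := by
  rw [mem_BB]; intro e; rw [PowerSeries.coeff_X]; split_ifs <;> simp

lemma mk_mem_BB (k : ℤ) : PowerSeries.mk (fun e => (-(k : ℚ_[p])) ^ e) ∈ BB p := by
  rw [mem_BB]; intro e; rw [PowerSeries.coeff_mk, norm_pow, norm_neg]
  exact pow_le_one₀ (norm_nonneg _) (Padic.norm_int_le_one k)

lemma aeval_lin_tau (c : ℚ) : aeval (tau p) (X + C c) =
    tau p * HahnSeries.ofPowerSeries ℤ ℚ_[p] (1 + PowerSeries.C (c : ℚ_[p]) * PowerSeries.X) := by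
  rw [map_add, aeval_X, aeval_C, map_add, map_mul, map_one, HahnSeries.ofPowerSeries_C, mul_add, mul_one,
    mul_left_comm, tau_mul_X, mul_one]
  congr 1
  rw [eq_ratCast, map_ratCast]

lemma den_prod_aux (θ : ℚ) (n : ℕ) :
    ∏ m ∈ Finset.Icc (1 : ℤ) n, (PowerSeries.C (θ.den : ℚ_[p]) + PowerSeries.C ((m * θ.den - θ.num : ℤ) : ℚ_[p]) * PowerSeries.X)
      = PowerSeries.C ((θ.den : ℚ_[p]) ^ n) * ∏ m ∈ Finset.Icc (1 : ℤ) n, (1 + PowerSeries.C (((m : ℚ_[p]) - (θ : ℚ_[p]))) * PowerSeries.X) := by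
  have hIc : (Finset.Icc (1 : ℤ) n).card = n := by simp
  have h0 : PowerSeries.C ((θ.den : ℚ_[p]) ^ n) = ∏ m ∈ Finset.Icc (1 : ℤ) n, PowerSeries.C (θ.den : ℚ_[p]) := by
    rw [map_pow, Finset.prod_const, hIc]
  rw [h0, ← Finset.prod_mul_distrib]
  refine Finset.prod_congr rfl fun m _ => ?_
  have h3 : (θ : ℚ_[p]) * (θ.den : ℚ_[p]) = (θ.num : ℚ_[p]) := by
    exact_mod_cast congrArg (fun t : ℚ => (t : ℚ_[p])) (Rat.mul_den_eq_num θ)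
  have h4 : ((m * θ.den - θ.num : ℤ) : ℚ_[p]) = (θ.den : ℚ_[p]) * ((m : ℚ_[p]) - (θ : ℚ_[p])) := by
    push_cast
    rw [← h3]; ring
  rw [h4, map_mul, mul_add, mul_one, mul_assoc]

/-- auxiliary products -/
noncomputable def gg2 (p : ℕ) [Fact p.Prime] (F : Finset ℚ) (n : ℕ) : PowerSeries ℚ_[p] :=
  ∏ m ∈ Finset.Icc (1 : ℤ) n, ∏ θ ∈ F, (1 + PowerSeries.C (((m : ℚ) - θ : ℚ) : ℚ_[p]) * PowerSeries.X)

/-- auxiliary products -/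
noncomputable def gg3 (p : ℕ) [Fact p.Prime] (F : Finset ℚ) (n : ℕ) : PowerSeries ℚ_[p] :=
  ∏ θ ∈ F, (PowerSeries.C ((kap θ.den n : ℚ_[p]) / ((n.factorial : ℕ) : ℚ_[p])) *
      ∏ m ∈ Finset.Icc (1 : ℤ) n, (PowerSeries.C (θ.den : ℚ_[p]) + PowerSeries.C ((m * θ.den - θ.num : ℤ) : ℚ_[p]) * PowerSeries.X))

/-- auxiliary products -/
noncomputable def gg1 (p : ℕ) [Fact p.Prime] (n : ℕ) : PowerSeries ℚ_[p] :=
  ∏ k ∈ Finset.Icc (0 : ℤ) n, PowerSeries.mk (fun e => (-(k : ℚ_[p])) ^ e)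

lemma gg_e1 (F : Finset ℚ) (s n : ℕ) : PowerSeries.C ((cst F s n : ℚ) : ℚ_[p]) * gg2 p F n = PowerSeries.C (((n.factorial : ℕ) : ℚ_[p]) ^ s) * gg3 p F n := by
  have h1 : ((cst F s n : ℚ) : ℚ_[p]) = ((n.factorial : ℕ) : ℚ_[p]) ^ s * ∏ θ ∈ F, ((kap θ.den n : ℚ_[p]) / ((n.factorial : ℕ) : ℚ_[p]) * (θ.den : ℚ_[p]) ^ n) := by
    rw [cst]; push_cast
    refine congrArg (fun t => _ * t) (Finset.prod_congr rfl fun θ _ => ?_)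
    ring
  rw [h1, map_mul, map_prod, mul_assoc]
  refine congrArg (fun t => _ * t) ?_
  rw [gg2, gg3, Finset.prod_comm, ← Finset.prod_mul_distrib]
  refine Finset.prod_congr rfl fun θ _ => ?_
  rw [den_prod_aux, map_mul, mul_assoc]
  refine congrArg (fun t => _ * t) (congrArg (fun t => _ * t) ?_)
  refine Finset.prod_congr rfl fun m _ => ?_
  rw [Rat.cast_sub, Rat.cast_intCast]

lemma gg_mem (F : Finset ℚ) (hF : ∀ θ ∈ F, p ∣ θ.den) (s n : ℕ) : gg3 p F n * gg1 p n ^ s ∈ BB p := by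
  refine mul_mem (prod_mem fun θ hθ => mul_mem (C_mem_BB ?_) (prod_mem fun m _ => add_mem (C_mem_BB ?_) (mul_mem (C_mem_BB (Padic.norm_int_le_one _)) X_mem_BB)))
    (pow_mem (prod_mem fun k _ => mk_mem_BB k) _)
  · rw [norm_div, norm_kap θ.den_nz (hF θ hθ)]
    exact div_self_le_one _
  · simpa using Padic.norm_int_le_one (p := p) θ.den

lemma gg_eN (F : Finset ℚ) (s n j : ℕ) :
    aeval (tau p) (NN F s n j) = HahnSeries.ofPowerSeries ℤ ℚ_[p] (PowerSeries.C ((cst F s n : ℚ) : ℚ_[p]) * gg2 p F n) * tau p ^ (j + n * F.card) := by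
  have hIc : (Finset.Icc (1 : ℤ) n).card = n := by simp
  have h : ∏ m ∈ Finset.Icc (1 : ℤ) n, aeval (tau p) (∏ θ ∈ F, (X + C ((m : ℚ) - θ))) =
      tau p ^ (n * F.card) * HahnSeries.ofPowerSeries ℤ ℚ_[p] (gg2 p F n) := by
    simp only [map_prod, aeval_lin_tau, Finset.prod_mul_distrib, Finset.prod_const, hIc, gg2]
    rw [← pow_mul, mul_comm F.card]
  have h2 : aeval (tau p) (C (cst F s n)) = HahnSeries.ofPowerSeries ℤ ℚ_[p] (PowerSeries.C ((cst F s n : ℚ) : ℚ_[p])) := by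
    rw [aeval_C, HahnSeries.ofPowerSeries_C, eq_ratCast, map_ratCast]
  rw [NN, map_mul, map_mul, map_pow, aeval_X, ZP, map_prod, h, h2, map_mul, pow_add]
  generalize HahnSeries.ofPowerSeries ℤ ℚ_[p] (PowerSeries.C ((cst F s n : ℚ) : ℚ_[p])) = a
  generalize HahnSeries.ofPowerSeries ℤ ℚ_[p] (gg2 p F n) = b
  generalize tau p ^ j = c
  generalize tau p ^ (n * F.card) = d
  ring

lemma gg_eD (s n : ℕ) : (aeval (tau p) (NP (Finset.Icc (0 : ℤ) n) s))⁻¹ = HahnSeries.ofPowerSeries ℤ ℚ_[p] (PowerSeries.X ^ (s * (n + 1)) * gg1 p n ^ s) := by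
  have hJc : (Finset.Icc (0 : ℤ) n).card = n + 1 := by simp
  have h : ∏ k ∈ Finset.Icc (0 : ℤ) n, (tau p + (k : LaurentSeries ℚ_[p]))⁻¹ = HahnSeries.ofPowerSeries ℤ ℚ_[p] (PowerSeries.X ^ (n + 1) * gg1 p n) := by
    simp only [← C_intCast, tau_add_inv]
    rw [← map_prod, Finset.prod_mul_distrib, Finset.prod_const, hJc, gg1]
  rw [aeval_NP, Finset.prod_pow, ← inv_pow, ← Finset.prod_inv_distrib, h, ← map_pow, mul_pow, ← pow_mul, mul_comm s]

lemma ring_aux {R : Type*} [CommRing R] (a b c c3 c4 : R) (e : a * b = 1) :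
    c4 * a * (c * b * c3) = c * (c4 * c3) := by
  linear_combination (c4 * c * c3) * e

theorem rf_tau (F : Finset ℚ) (hF : ∀ θ ∈ F, p ∣ θ.den) (s n j M : ℕ) (hM : M + 1 + j + n * F.card = s * (n + 1)) :
    ∃ f : PowerSeries ℚ_[p], (∀ m, ‖PowerSeries.coeff m f‖ ≤ ‖((n.factorial : ℕ) : ℚ_[p])‖ ^ s) ∧
      rf (NN F s n j) (Finset.Icc (0 : ℤ) n) s (tau p) =
        HahnSeries.ofPowerSeries ℤ ℚ_[p] (PowerSeries.X ^ (M + 1) * f) := by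
  refine ⟨PowerSeries.C ((cst F s n : ℚ) : ℚ_[p]) * gg2 p F n * gg1 p n ^ s, ?_, ?_⟩
  · intro m
    rw [gg_e1, mul_assoc, PowerSeries.coeff_C_mul, norm_mul, norm_pow]
    exact mul_le_of_le_one_right (by positivity) (mem_BB.mp (gg_mem F hF s n) m)
  · have e5 : tau p ^ (j + n * F.card) * HahnSeries.ofPowerSeries ℤ ℚ_[p] (PowerSeries.X ^ (j + n * F.card)) = 1 := by
      rw [map_pow, ← mul_pow, tau_mul_X, one_pow]
    have e4 : s * (n + 1) = (M + 1) + (j + n * F.card) := by rw [← hM]; ring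
    rw [rf, div_eq_mul_inv, gg_eN, gg_eD, e4, pow_add _ (M + 1)]
    rw [map_mul _ (PowerSeries.X ^ (M + 1) * _), map_mul _ (PowerSeries.X ^ (M + 1)), map_mul _ (PowerSeries.X ^ (M + 1)), map_mul _ _ (gg1 p n ^ s)]
    exact ring_aux _ _ _ _ _ e5

theorem norm_TT_NN (F : Finset ℚ) (hF : ∀ θ ∈ F, p ∣ θ.den) (s n j M : ℕ) (hM : M + 1 + j + n * F.card = s * (n + 1))
    {l : ℕ} (hl : 1 ≤ l) {y : ℚ_[p]} (hy : ‖y‖ ≤ ((p : ℝ) ^ l)⁻¹) :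
    ‖TT y (rf (NN F s n j) (Finset.Icc (0 : ℤ) n) s (tau p))‖ ≤
      ‖((n.factorial : ℕ) : ℚ_[p])‖ ^ s * (p * ((M + 1) * (((p : ℝ) ^ l)⁻¹) ^ M)) := by
  obtain ⟨f, hf, he⟩ := rf_tau F hF s n j M hM
  rw [he]
  exact norm_TT_le hl hy M hf

end PZ

namespace PZ
open Finset in
lemma sum_psi (N : ℕ) : ∑ k ∈ Finset.Icc 1 N, Chebyshev.psi ((N / k : ℕ) : ℝ) = Real.log (N.factorial) := by
  induction N with
  | zero => simp
  | succ N ih =>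
    rw [Nat.factorial_succ, Nat.cast_mul, Real.log_mul (by positivity) (by positivity), ← ih,
      ← ArithmeticFunction.vonMangoldt_sum]
    have h1 : ∀ k ∈ Finset.Icc 1 (N+1), Chebyshev.psi (((N+1) / k : ℕ) : ℝ) = Chebyshev.psi ((N / k : ℕ) : ℝ) +
        if k ∣ N + 1 then ArithmeticFunction.vonMangoldt ((N+1)/k) else 0 := by
      intro k hk
      rw [Nat.succ_div]
      split_ifs with h
      · rw [Chebyshev.psi_eq_sum_Icc, Chebyshev.psi_eq_sum_Icc, Nat.floor_natCast, Nat.floor_natCast, Finset.sum_Icc_succ_top (Nat.zero_le _)]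
      · simp
    rw [Finset.sum_congr rfl h1, Finset.sum_add_distrib, Finset.sum_Icc_succ_top (by omega),
      Nat.div_eq_of_lt (Nat.lt_succ_self N)]
    simp only [Nat.cast_zero, Chebyshev.psi_zero, add_zero]
    rw [add_comm, ← Finset.sum_filter]
    congr 1
    rw [← Nat.sum_div_divisors (N+1)]
    refine Finset.sum_congr ?_ fun _ _ => rfl
    ext k
    simp only [Finset.mem_filter, Finset.mem_Icc, Nat.mem_divisors]
    constructor
    · rintro ⟨_, h⟩; exact ⟨h, by omega⟩
    · rintro ⟨h, _⟩; exact ⟨⟨Nat.pos_of_dvd_of_pos h (by omega), Nat.le_of_dvd (by omega) h⟩, h⟩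

lemma psi_small (ε : ℝ) (hε : 0 < ε) (n0 : ℕ) : ∃ n ≥ n0, Chebyshev.psi (n : ℝ) ≤ (1 + ε) * n := by
  by_contra! hcon
  set n1 := n0 + 1 with hn1
  have key : ∀ m : ℕ, 1 ≤ m → ε * Real.log m ≤ Real.log n1 + (1 + ε) := by
    intro m hm
    have hm' : (1 : ℝ) ≤ m := by exact_mod_cast hm
    have hn1' : (1 : ℝ) ≤ n1 := by rw [hn1]; push_cast; linarith [(Nat.cast_nonneg n0 : (0:ℝ) ≤ n0)]
    have h1 := sum_psi (n1 * m)
    have h2 : Real.log ((n1 * m).factorial) ≤ (n1 * m) * (Real.log n1 + Real.log m) := by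
      have : ((n1 * m).factorial : ℝ) ≤ ((n1 * m : ℕ) : ℝ) ^ (n1 * m) := by
        exact_mod_cast Nat.factorial_le_pow (n1 * m)
      calc Real.log ((n1 * m).factorial) ≤ Real.log (((n1 * m : ℕ) : ℝ) ^ (n1 * m)) := Real.log_le_log (by positivity) this
        _ = _ := by
          rw [Real.log_pow]; push_cast; rw [Real.log_mul (by positivity) (by positivity)]
    have h3 : ∑ k ∈ Finset.Icc 1 m, (1 + ε) * ((n1 * m : ℝ) * (k : ℝ)⁻¹ - 1) ≤ ∑ k ∈ Finset.Icc 1 (n1 * m), Chebyshev.psi ((n1 * m / k : ℕ) : ℝ) := by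
      refine le_trans (Finset.sum_le_sum fun k hk => ?_)
        (Finset.sum_le_sum_of_subset_of_nonneg (Finset.Icc_subset_Icc le_rfl (Nat.le_mul_of_pos_left m (by omega))) fun _ _ _ => Chebyshev.psi_nonneg _)
      rw [Finset.mem_Icc] at hk
      have h4 : n0 ≤ n1 * m / k := by
        rw [Nat.le_div_iff_mul_le (by omega)]
        exact Nat.mul_le_mul (by omega) hk.2
      refine le_trans ?_ (hcon _ h4).le
      refine mul_le_mul_of_nonneg_left ?_ (by linarith)
      have h5 := Nat.lt_div_mul_add (a := n1 * m) (b := k) (by omega)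
      have h6 : ((n1 : ℝ) * m) < ((n1 * m / k : ℕ) : ℝ) * k + k := by exact_mod_cast h5
      have hk0 : (0 : ℝ) < k := by exact_mod_cast (by omega : 0 < k)
      rw [← div_eq_mul_inv, sub_le_iff_le_add, div_le_iff₀ hk0]
      linarith
    rw [← Finset.mul_sum, Finset.sum_sub_distrib, ← Finset.mul_sum] at h3
    have h7 : Real.log m ≤ ∑ k ∈ Finset.Icc 1 m, (k : ℝ)⁻¹ := by
      have h8 := log_add_one_le_harmonic m
      rw [harmonic_eq_sum_Icc] at h8
      push_cast at h8
      exact (Real.log_le_log (by linarith) (by linarith)).trans h8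
    simp only [Finset.sum_const, Nat.card_Icc, add_tsub_cancel_right, nsmul_eq_mul, mul_one] at h3
    have h9 : (1 + ε) * ((n1 * m : ℝ) * Real.log m - m) ≤ (n1 * m) * (Real.log n1 + Real.log m) := by
      refine le_trans ?_ (h3.trans (h1.le.trans h2))
      refine mul_le_mul_of_nonneg_left ?_ (by linarith)
      have : (n1 * m : ℝ) * Real.log m ≤ (n1 * m : ℝ) * ∑ k ∈ Finset.Icc 1 m, (k : ℝ)⁻¹ := mul_le_mul_of_nonneg_left h7 (by positivity)
      linarith
    have h10 : (n1 * m : ℝ) * (ε * Real.log m) ≤ (n1 * m : ℝ) * (Real.log n1 + (1 + ε)) := by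
      have : (1 + ε) * m ≤ (n1 * m : ℝ) * (1 + ε) := by nlinarith [mul_nonneg (mul_nonneg (sub_nonneg.mpr hn1') (by linarith : (0:ℝ) ≤ m)) (by linarith : 0 ≤ 1 + ε)]
      nlinarith
    exact le_of_mul_le_mul_left h10 (by positivity)
  have ht : Tendsto (fun m : ℕ => ε * Real.log m) atTop atTop :=
    (Real.tendsto_log_atTop.comp tendsto_natCast_atTop_atTop).const_mul_atTop hε
  obtain ⟨m, hm1, hm2⟩ := ((ht.eventually_gt_atTop (Real.log n1 + (1 + ε))).and (eventually_ge_atTop 1)).exists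
  linarith [key m hm2]

lemma factorization_factorial_le {q : ℕ} (hq : q.Prime) (n : ℕ) : (n.factorial.factorization q : ℝ) ≤ n / ((q : ℝ) - 1) := by
  have := Fact.mk hq
  have h := sub_one_mul_padicValNat_factorial (p := q) n
  rw [Nat.factorization_def _ hq]
  have h1 : (q - 1) * padicValNat q n.factorial ≤ n := by omega
  have hq2 := hq.two_le
  have hq2' : (2 : ℝ) ≤ q := by exact_mod_cast hq2
  rw [le_div_iff₀ (by linarith), mul_comm]
  have h2 : (((q - 1 : ℕ) : ℝ)) * (padicValNat q n.factorial : ℝ) ≤ n := by exact_mod_cast h1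
  rwa [Nat.cast_sub (by omega), Nat.cast_one] at h2

lemma kap_le (D n : ℕ) : (kap D n : ℝ) ≤ Real.exp (n * ∑ q ∈ D.primeFactors, Real.log q / ((q : ℝ) - 1)) := by
  rw [kap, Finset.mul_sum, Real.exp_sum]
  push_cast
  refine Finset.prod_le_prod (fun q _ => by positivity) fun q hq => ?_
  have hqp := Nat.prime_of_mem_primeFactors hq
  have hq0 : (1 : ℝ) < q := by exact_mod_cast hqp.one_lt
  rw [← Real.exp_log (by positivity : (0 : ℝ) < (q : ℝ) ^ (n.factorial.factorization q)), Real.log_pow]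
  refine Real.exp_le_exp.mpr ?_
  have := mul_le_mul_of_nonneg_right (factorization_factorial_le hqp n) (Real.log_pos hq0).le
  calc _ ≤ _ := this
    _ = _ := by ring

lemma norm_factorial_le {p : ℕ} [hp : Fact p.Prime] (n : ℕ) :
    ‖((n.factorial : ℕ) : ℚ_[p])‖ ≤ (p * (n + 1)) * Real.exp (-(n * (Real.log p / ((p : ℝ) - 1)))) := by
  have hp2 := hp.out.two_le
  have hp2' : (2 : ℝ) ≤ p := by exact_mod_cast hp2
  have hlp : 0 < Real.log p := Real.log_pos (by linarith)
  have h := sub_one_mul_padicValNat_factorial (p := p) n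
  have hd : (Nat.digits p n).sum ≤ (p - 1) * (Nat.log p n + 1) := by
    rcases Nat.eq_zero_or_pos n with rfl | hn
    · simp
    have h2 : (Nat.digits p n).sum ≤ (Nat.digits p n).length • (p - 1) := by
      refine List.sum_le_card_nsmul _ _ fun x hx => ?_
      have := Nat.digits_lt_base (by omega : 1 < p) hx
      omega
    rw [Nat.length_digits p n (by omega) (by omega)] at h2
    rw [mul_comm]; simpa using h2
  set v := padicValNat p n.factorial with hv
  have hle : (n : ℝ) ≤ (p - 1) * v + (p - 1) * (Nat.log p n + 1) := by
    have h3 : n ≤ (p - 1) * v + (p - 1) * (Nat.log p n + 1) := by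
      have := Nat.digit_sum_le p n
      omega
    have h4 : (n : ℝ) ≤ ((p - 1 : ℕ) : ℝ) * v + ((p - 1 : ℕ) : ℝ) * (Nat.log p n + 1) := by exact_mod_cast h3
    rwa [Nat.cast_sub (by omega), Nat.cast_one] at h4
  have hn : ‖((n.factorial : ℕ) : ℚ_[p])‖ = Real.exp (-(v * Real.log p)) := by
    rw [Padic.norm_eq_zpow_neg_valuation (by exact_mod_cast n.factorial_ne_zero), Padic.valuation_natCast, ← hv]
    rw [Real.exp_neg, zpow_neg, zpow_natCast]
    congr 1
    rw [← Real.log_pow, Real.exp_log (by positivity)]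
  rw [hn]
  have hlog : (Nat.log p n : ℝ) * Real.log p ≤ Real.log (n + 1) := by
    rw [← Real.log_pow]
    refine Real.log_le_log (by positivity) ?_
    rcases Nat.eq_zero_or_pos n with rfl | hn
    · simp
    have := Nat.pow_log_le_self p (by omega : n ≠ 0)
    have : ((p : ℝ)) ^ Nat.log p n ≤ n := by exact_mod_cast this
    linarith
  rw [← Real.exp_log (by positivity : (0 : ℝ) < p * (n + 1)), ← Real.exp_add, Real.log_mul (by positivity) (by positivity)]
  refine Real.exp_le_exp.mpr ?_
  have h5 : (n : ℝ) * (Real.log p / ((p : ℝ) - 1)) ≤ (v + (Nat.log p n + 1)) * Real.log p := by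
    rw [mul_div_assoc', div_le_iff₀ (by linarith)]
    nlinarith
  nlinarith
end PZ

namespace PZ
open Polynomial

/-- numerators -/
def idx (p b : ℕ) : Finset ℕ := (Finset.range b).filter (fun a => ¬ p ∣ a)

/-- all fractions -/
def FF (p : ℕ) (Ψ : Finset ℕ) : Finset ℚ := Ψ.biUnion fun b => (idx p b).image (fun a : ℕ => (a : ℚ) / b)

variable {p : ℕ} [hp : Fact p.Prime]

/-- the functional -/
noncomputable def LL (p : ℕ) [Fact p.Prime] (Ψ : Finset ℕ) (w : ℕ → ℤ) : LaurentSeries ℚ_[p] →ₗ[ℚ_[p]] ℚ_[p] :=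
  ∑ b ∈ Ψ, ∑ a ∈ idx p b, (w b : ℚ_[p]) • TT ((b : ℚ_[p]) / (a : ℚ_[p]))

/-- weights -/
noncomputable def WW (p : ℕ) [Fact p.Prime] (Ψ : Finset ℕ) (w : ℕ → ℤ) (x : ℚ) : ℚ_[p] :=
  ∑ b ∈ Ψ, ∑ a ∈ idx p b, if (a : ℚ) / b = x then (w b : ℚ_[p]) else 0

lemma LL_apply (Ψ : Finset ℕ) (w : ℕ → ℤ) (f) : LL p Ψ w f = ∑ b ∈ Ψ, ∑ a ∈ idx p b, (w b : ℚ_[p]) * TT ((b : ℚ_[p]) / (a : ℚ_[p])) f := by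
  simp [LL, LinearMap.sum_apply]

lemma mem_FF {Ψ : Finset ℕ} {x : ℚ} : x ∈ FF p Ψ ↔ ∃ b ∈ Ψ, ∃ a ∈ idx p b, (a : ℚ) / b = x := by
  simp [FF]

lemma idx_pos {b a : ℕ} (h : a ∈ idx p b) : 0 < a ∧ a < b ∧ ¬ p ∣ a := by
  simp only [idx, Finset.mem_filter, Finset.mem_range] at h
  refine ⟨Nat.pos_of_ne_zero ?_, h.1, h.2⟩
  rintro rfl; exact h.2 (dvd_zero p)

lemma norm_idx {b a : ℕ} (h : a ∈ idx p b) : ‖(a : ℚ_[p])‖ = 1 := by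
  rw [Padic.norm_natCast_eq_one_iff, Nat.Prime.coprime_iff_not_dvd hp.out]
  exact (idx_pos h).2.2

lemma norm_div_idx {l b a : ℕ} (hb : p ^ l ∣ b) (h : a ∈ idx p b) : ‖(b : ℚ_[p]) / (a : ℚ_[p])‖ ≤ ((p : ℝ) ^ l)⁻¹ := by
  rw [norm_div, norm_idx h, div_one]
  obtain ⟨c, rfl⟩ := hb
  push_cast
  rw [norm_mul, norm_pow, Padic.norm_p, inv_pow]
  exact mul_le_of_le_one_right (by positivity) (by simpa using Padic.norm_int_le_one (p := p) c)

lemma one_lt_norm {l b a : ℕ} (hl : 1 ≤ l) (hb : p ^ l ∣ b) (h : a ∈ idx p b) : 1 < ‖(((a : ℚ) / b : ℚ) : ℚ_[p])‖ := by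
  have h1 := norm_div_idx hb h
  have h2 := idx_pos h
  have h3 : (((a : ℚ) / b : ℚ) : ℚ_[p]) = ((b : ℚ_[p]) / (a : ℚ_[p]))⁻¹ := by push_cast; rw [inv_div]
  rw [h3, norm_inv]
  have h4 : (b : ℚ_[p]) / (a : ℚ_[p]) ≠ 0 := div_ne_zero (Nat.cast_ne_zero.mpr (by omega)) (Nat.cast_ne_zero.mpr (by omega))
  refine (one_lt_inv₀ (norm_pos_iff.mpr h4)).mpr (h1.trans_lt ?_)
  have : (1 : ℝ) < p := by exact_mod_cast hp.out.one_lt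
  exact inv_lt_one_of_one_lt₀ (one_lt_pow₀ this (by omega))

lemma FF_pos {Ψ : Finset ℕ} : ∀ θ ∈ FF p Ψ, 0 < θ ∧ θ < 1 := by
  intro θ h
  obtain ⟨b, _, a, ha, rfl⟩ := mem_FF.mp h
  have h2 := idx_pos ha
  have hb : (0 : ℚ) < b := by exact_mod_cast (by omega : 0 < b)
  have ha0 : (0 : ℚ) < a := by exact_mod_cast h2.1
  refine ⟨by positivity, ?_⟩
  rw [div_lt_one hb]; exact_mod_cast h2.2.1

lemma FF_den {l : ℕ} (hl : 1 ≤ l) {Ψ : Finset ℕ} (hΨ : ∀ b ∈ Ψ, p ^ l ∣ b) : ∀ θ ∈ FF p Ψ, p ∣ θ.den := by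
  intro θ h
  obtain ⟨b, hb, a, ha, rfl⟩ := mem_FF.mp h
  by_contra hc
  exact absurd (Padic.norm_rat_le_one hc) (not_le.mpr (one_lt_norm hl (hΨ b hb) ha))

lemma LL_shift {l : ℕ} (hl : 1 ≤ l) {Ψ : Finset ℕ} (hΨ : ∀ b ∈ Ψ, p ^ l ∣ b) (w : ℕ → ℤ) (s : ℕ)
    (N : ℚ[X]) (J : Finset ℤ) (r : ℤ) (hN : N.degree < (s * J.card : ℕ)) :
    LL p Ψ w (rf N J s (tau p + ((r + 1 : ℤ) : LaurentSeries ℚ_[p]))) =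
    LL p Ψ w (rf N J s (tau p + (r : LaurentSeries ℚ_[p]))) -
      ∑ x ∈ FF p Ψ, WW p Ψ w x * ((rf N J s (x + (r : ℚ)) : ℚ) : ℚ_[p]) := by
  have h1 : ∑ x ∈ FF p Ψ, WW p Ψ w x * ((rf N J s (x + (r : ℚ)) : ℚ) : ℚ_[p]) =
      ∑ b ∈ Ψ, ∑ a ∈ idx p b, (w b : ℚ_[p]) * ((rf N J s ((a : ℚ) / b + (r : ℚ)) : ℚ) : ℚ_[p]) := by
    simp only [WW, Finset.sum_mul]
    rw [Finset.sum_comm]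
    refine Finset.sum_congr rfl fun b hb => ?_
    rw [Finset.sum_comm]
    refine Finset.sum_congr rfl fun a ha => ?_
    rw [Finset.sum_eq_single ((a : ℚ) / b)]
    · rw [if_pos rfl]
    · intro x _ hx; rw [if_neg (Ne.symm hx), zero_mul]
    · intro h; exact absurd (mem_FF.mpr ⟨b, hb, a, ha, rfl⟩) h
  rw [h1, LL_apply, LL_apply, ← Finset.sum_sub_distrib]
  refine Finset.sum_congr rfl fun b hb => ?_
  rw [← Finset.sum_sub_distrib]
  refine Finset.sum_congr rfl fun a ha => ?_
  rw [← mul_sub]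
  refine congrArg (fun t => _ * t) ?_
  have h3 : (b : ℚ_[p]) / (a : ℚ_[p]) = (((a : ℚ) / b : ℚ) : ℚ_[p])⁻¹ := by push_cast; rw [inv_div]
  rw [h3, TT_rf_shift (one_lt_norm hl (hΨ b hb) ha) N J s hN r]
  refine congrArg (fun t => _ - t) ?_
  have h4 := rf_map (Algebra.ofId ℚ ℚ_[p]) N J s ((a : ℚ) / b + (r : ℚ))
  simp only [Algebra.ofId_apply, eq_ratCast] at h4
  rw [h4]
  push_cast
  rfl

lemma WW_ne {l : ℕ} (hl : 1 ≤ l) {Ψ : Finset ℕ} (hΨ : ∀ b ∈ Ψ, b ≠ 0 ∧ p ^ l ∣ b) (w : ℕ → ℤ) (hw : ∃ b ∈ Ψ, w b ≠ 0) :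
    ∃ x ∈ FF p Ψ, WW p Ψ w x ≠ 0 := by
  classical
  have hne : (Ψ.filter (fun b => w b ≠ 0)).Nonempty := by
    obtain ⟨b, hb, h⟩ := hw; exact ⟨b, Finset.mem_filter.mpr ⟨hb, h⟩⟩
  obtain ⟨b0, hb0, hmax⟩ := Finset.exists_max_image _ id hne
  rw [Finset.mem_filter] at hb0
  have hp2 := hp.out.two_le
  have hb2 : 1 < b0 := by
    have h1 := Nat.le_of_dvd (Nat.pos_of_ne_zero (hΨ b0 hb0.1).1) (hΨ b0 hb0.1).2
    have h2 := Nat.one_lt_pow (by omega : l ≠ 0) hp.out.one_lt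
    omega
  have h1i : 1 ∈ idx p b0 := by
    simp only [idx, Finset.mem_filter, Finset.mem_range]
    exact ⟨hb2, fun h => by have := Nat.le_of_dvd one_pos h; omega⟩
  refine ⟨((1 : ℕ) : ℚ) / b0, mem_FF.mpr ⟨b0, hb0.1, 1, h1i, rfl⟩, ?_⟩
  rw [WW, Finset.sum_eq_single b0, Finset.sum_eq_single 1, if_pos rfl]
  · exact_mod_cast hb0.2
  · intro a ha hne
    rw [if_neg]
    intro h
    rw [div_left_inj' (by exact_mod_cast (by omega : b0 ≠ 0))] at h
    exact hne (by exact_mod_cast h)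
  · intro h; exact absurd h1i h
  · intro b hb hbne
    refine Finset.sum_eq_zero fun a ha => ?_
    split_ifs with h
    · have hpos := idx_pos ha
      have hb' : (b : ℚ) ≠ 0 := by exact_mod_cast (by omega : b ≠ 0)
      have hb0' : (b0 : ℚ) ≠ 0 := by exact_mod_cast (by omega : b0 ≠ 0)
      rw [div_eq_div_iff hb' hb0'] at h
      have h' : a * b0 = 1 * b := by exact_mod_cast h
      by_contra hcw
      have h4 := hmax b (Finset.mem_filter.mpr ⟨hb, by exact_mod_cast hcw⟩)
      simp only [id] at h4
      have : b0 ≤ a * b0 := Nat.le_mul_of_pos_left _ hpos.1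
      omega
    · rfl
  · intro h; exact absurd hb0.1 h

end PZ

namespace PZ
open Polynomial

/-- polynomial-exponential bound -/
noncomputable def BN (F : Finset ℚ) (s n : ℕ) : ℝ :=
  ((s : ℝ) + 1) ^ (s + F.card + 2) * ((n : ℝ) + 2) ^ (s + F.card) * ((2 ^ n * ((n : ℝ) + 1) ^ s) ^ s) *
       ∏ θ ∈ F, ((kap θ.den n : ℝ) * (θ.den : ℝ) ^ n * Real.exp (n + 2))

lemma BN_nonneg (F : Finset ℚ) (s n : ℕ) : 0 ≤ BN F s n := by
  unfold BN
  have : 0 ≤ ∏ θ ∈ F, ((kap θ.den n : ℝ) * (θ.den : ℝ) ^ n * Real.exp (n + 2)) :=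
    Finset.prod_nonneg fun θ _ => by positivity
  positivity

/-- polar part -/
noncomputable def rho (F : Finset ℚ) (s n j : ℕ) (x : ℚ) : ℚ :=
  ∑ k ∈ Finset.Icc (0 : ℤ) n, ∑ l ∈ Finset.range k.toNat, ∑ e ∈ Finset.range s,
        (pfc (Finset.Icc (0 : ℤ) n) s (NN F s n j) k e) * ((x + l)⁻¹) ^ (s - e)

/-- coefficient sums -/
noncomputable def PP (F : Finset ℚ) (s n j e : ℕ) : ℚ := ∑ k ∈ Finset.Icc (0 : ℤ) n, pfc (Finset.Icc (0 : ℤ) n) s (NN F s n j) k e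

lemma pfc_BN (F : Finset ℚ) (hF : ∀ θ ∈ F, 0 < θ ∧ θ < 1) (s n j : ℕ) (hj : j ≤ s + F.card) (k : ℤ)
    (hk : k ∈ Finset.Icc (0 : ℤ) n) (e : ℕ) (he : e ≤ s) :
    |((pfc (Finset.Icc (0 : ℤ) n) s (NN F s n j) k e : ℚ) : ℝ)| ≤ BN F s n := by
  refine (pfc_bnd F hF s n j k hk e he).trans ?_
  unfold BN
  have h0 : 0 ≤ ∏ θ ∈ F, ((kap θ.den n : ℝ) * (θ.den : ℝ) ^ n * Real.exp (n + 2)) :=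
    Finset.prod_nonneg fun θ _ => by positivity
  have h1 : ((n : ℝ) + 2) ^ j ≤ ((n : ℝ) + 2) ^ (s + F.card) :=
    pow_le_pow_right₀ (by linarith [(Nat.cast_nonneg n : (0:ℝ) ≤ n)]) hj
  gcongr

lemma PP_BN (F : Finset ℚ) (hF : ∀ θ ∈ F, 0 < θ ∧ θ < 1) (s n j : ℕ) (hj : j ≤ s + F.card) (e : ℕ) (he : e ≤ s) :
    |((PP F s n j e : ℚ) : ℝ)| ≤ (n + 1) * BN F s n := by
  rw [PP]; push_cast
  refine (Finset.abs_sum_le_sum_abs _ _).trans ?_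
  refine (Finset.sum_le_sum fun k hk => pfc_BN F hF s n j hj k hk e he).trans ?_
  simp

lemma rho_BN (F : Finset ℚ) (hF : ∀ θ ∈ F, 0 < θ ∧ θ < 1) (s n j : ℕ) (hj : j ≤ s + F.card) (x : ℚ) (H : ℝ) (hH : 1 ≤ H)
    (hx0 : 0 < x) (hx : ((x : ℝ))⁻¹ ≤ H) :
    |((rho F s n j x : ℚ) : ℝ)| ≤ (n + 1) * ((n + 1) * (s * (BN F s n * H ^ s))) := by
  have hB := BN_nonneg F s n
  rw [rho]; push_cast
  refine (Finset.abs_sum_le_sum_abs _ _).trans ?_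
  have hc : ((Finset.Icc (0 : ℤ) n).card : ℝ) = n + 1 := by simp
  rw [← hc, ← nsmul_eq_mul]
  refine Finset.sum_le_card_nsmul _ _ _ fun k hk => ?_
  refine (Finset.abs_sum_le_sum_abs _ _).trans ?_
  have hk' := Finset.mem_Icc.mp hk
  have h1 : ∀ l ∈ Finset.range k.toNat, |∑ e ∈ Finset.range s, ((pfc (Finset.Icc (0 : ℤ) n) s (NN F s n j) k e : ℚ) : ℝ) * (((x : ℝ) + l)⁻¹) ^ (s - e)| ≤ s * (BN F s n * H ^ s) := by
    intro l _
    refine (Finset.abs_sum_le_sum_abs _ _).trans ?_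
    have : ∀ e ∈ Finset.range s, |((pfc (Finset.Icc (0 : ℤ) n) s (NN F s n j) k e : ℚ) : ℝ) * (((x : ℝ) + l)⁻¹) ^ (s - e)| ≤ BN F s n * H ^ s := by
      intro e he
      rw [abs_mul]
      have hx0' : (0 : ℝ) < x := by exact_mod_cast hx0
      refine mul_le_mul (pfc_BN F hF s n j hj k hk e (Finset.mem_range.mp he).le) ?_ (abs_nonneg _) hB
      rw [abs_of_nonneg (by positivity)]
      calc (((x : ℝ) + l)⁻¹) ^ (s - e) ≤ H ^ (s - e) := by
            refine pow_le_pow_left₀ (by positivity) (le_trans ?_ hx) _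
            exact inv_anti₀ hx0' (by linarith [(Nat.cast_nonneg l : (0:ℝ) ≤ l)])
        _ ≤ H ^ s := pow_le_pow_right₀ hH (Nat.sub_le _ _)
    refine (Finset.sum_le_card_nsmul _ _ _ this).trans ?_
    simp
  refine (Finset.sum_le_card_nsmul _ _ _ h1).trans ?_
  rw [nsmul_eq_mul, Finset.card_range, hc]
  refine mul_le_mul_of_nonneg_right ?_ (by positivity)
  have : k.toNat ≤ n + 1 := by omega
  exact_mod_cast this

variable {p : ℕ} [hp : Fact p.Prime]

lemma cst_ne (F : Finset ℚ) (s n : ℕ) : cst F s n ≠ 0 := by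
  unfold cst
  refine mul_ne_zero (pow_ne_zero _ (by exact_mod_cast n.factorial_ne_zero)) (Finset.prod_ne_zero_iff.mpr fun θ _ => ?_)
  refine div_ne_zero (mul_ne_zero (by exact_mod_cast (kap_pos _ _).ne') (pow_ne_zero _ (by exact_mod_cast θ.den_nz))) (by exact_mod_cast n.factorial_ne_zero)

lemma NN_deg (F : Finset ℚ) (s n j : ℕ) (hn : 1 ≤ n) (hs : 2 * F.card ≤ s) (hs1 : 1 ≤ s) (hj : j < s + F.card) :
    (NN F s n j).degree < (s * (Finset.Icc (0 : ℤ) n).card : ℕ) := by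
  rw [NN]
  refine lt_of_le_of_lt ?_ (degF n s F hn hs hs1 (X ^ j) ?_)
  · rw [degree_C_mul (cst_ne F s n)]
  · rw [degree_X_pow]; exact_mod_cast hj

lemma LL_eval {l : ℕ} (hl : 1 ≤ l) {Ψ : Finset ℕ} (hΨ : ∀ b ∈ Ψ, b ≠ 0 ∧ p ^ l ∣ b) (w : ℕ → ℤ) (F : Finset ℚ) (s n j : ℕ)
    (hN : (NN F s n j).degree < (s * (Finset.Icc (0 : ℤ) n).card : ℕ)) (g : ℕ → ℚ)
    (hg : ∀ e < s, ∑ b ∈ Ψ, (w b : ℚ_[p]) * ∑ a ∈ idx p b, hh ((b : ℚ_[p]) / (a : ℚ_[p])) (s - e - 1) = (g e : ℚ_[p])) :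
    LL p Ψ w (rf (NN F s n j) (Finset.Icc (0 : ℤ) n) s (tau p)) =
      (((∑ e ∈ Finset.range s, PP F s n j e * g e) - ∑ b ∈ Ψ, (w b : ℚ) * ∑ a ∈ idx p b, rho F s n j ((a : ℚ) / b) : ℚ) : ℚ_[p]) := by
  have h1 : ∀ b ∈ Ψ, ∀ a ∈ idx p b, TT ((b : ℚ_[p]) / (a : ℚ_[p])) (rf (NN F s n j) (Finset.Icc (0 : ℤ) n) s (tau p)) =
      (∑ e ∈ Finset.range s, (PP F s n j e : ℚ_[p]) * hh ((b : ℚ_[p]) / (a : ℚ_[p])) (s - e - 1)) - (rho F s n j ((a : ℚ) / b) : ℚ_[p]) := by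
    intro b hb a ha
    have h3 : (b : ℚ_[p]) / (a : ℚ_[p]) = (((a : ℚ) / b : ℚ) : ℚ_[p])⁻¹ := by push_cast; rw [inv_div]
    have hN' : (NN F s n j).degree < (s * (n + 1) : ℕ) := by simpa using hN
    rw [h3, TT_rf_eval (one_lt_norm hl (hΨ b hb).2 ha) _ n s hN' _ rfl]
    refine congrArg₂ (fun t u => t - u) rfl ?_
    rw [rho]; push_cast; rfl
  rw [LL_apply]
  have h2 : ∀ e ∈ Finset.range s, (PP F s n j e : ℚ_[p]) * (g e : ℚ_[p]) =
      ∑ b ∈ Ψ, ∑ a ∈ idx p b, (w b : ℚ_[p]) * ((PP F s n j e : ℚ_[p]) * hh ((b : ℚ_[p]) / (a : ℚ_[p])) (s - e - 1)) := by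
    intro e he
    rw [← hg e (Finset.mem_range.mp he), Finset.mul_sum]
    refine Finset.sum_congr rfl fun b _ => ?_
    rw [mul_left_comm, Finset.mul_sum, Finset.mul_sum]
  push_cast
  rw [Finset.sum_congr rfl h2, Finset.sum_comm, ← Finset.sum_sub_distrib]
  refine Finset.sum_congr rfl fun b hb => ?_
  rw [Finset.sum_comm, Finset.mul_sum, ← Finset.sum_sub_distrib]
  refine Finset.sum_congr rfl fun a ha => ?_
  rw [h1 b hb a ha, ← Finset.mul_sum, ← mul_sub]

set_option maxHeartbeats 1000000 in
theorem approx {l : ℕ} (hl : 1 ≤ l) {Ψ : Finset ℕ} (hΨ : ∀ b ∈ Ψ, b ≠ 0 ∧ p ^ l ∣ b) (w : ℕ → ℤ) (hw : ∃ b ∈ Ψ, w b ≠ 0)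
    (s : ℕ) (hs : 2 * (FF p Ψ).card ≤ s) (hs1 : 1 ≤ s) (g : ℕ → ℚ)
    (hg : ∀ e < s, ∑ b ∈ Ψ, (w b : ℚ_[p]) * ∑ a ∈ idx p b, hh ((b : ℚ_[p]) / (a : ℚ_[p])) (s - e - 1) = (g e : ℚ_[p])) :
    ∃ C : ℝ, 0 < C ∧ ∀ n d : ℕ, 1 ≤ n → 0 < d → (∀ m : ℕ, 1 ≤ m → m ≤ n → m ∣ d) → ∃ (z : ℤ) (M : ℕ), z ≠ 0 ∧
      s * n ≤ M + (FF p Ψ).card * (n + 1) ∧ M + 1 ≤ s * (n + 1) ∧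
      |(z : ℝ)| ≤ C * (d : ℝ) ^ s * ((n + 1) ^ 2 * BN (FF p Ψ) s n) ∧
      ‖(z : ℚ_[p])‖ ≤ ‖((n.factorial : ℕ) : ℚ_[p])‖ ^ s * (p * ((M + 1) * (((p : ℝ) ^ l)⁻¹) ^ M)) := by
  set F := FF p Ψ with hF
  set D0 : ℕ := ∏ e ∈ Finset.range s, (g e).den with hD0
  have hD0pos : 0 < D0 := Finset.prod_pos fun e _ => (g e).den_pos
  have hDg : ∀ e ∈ Finset.range s, ∃ z : ℤ, (D0 : ℚ) * g e = z := by
    intro e he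
    obtain ⟨c, hc⟩ : (g e).den ∣ D0 := Finset.dvd_prod_of_mem _ he
    refine ⟨c * (g e).num, ?_⟩
    rw [hc]; push_cast
    rw [← Rat.mul_den_eq_num (g e)]; ring
  set H : ℝ := 1 + ∑ b ∈ Ψ, (b : ℝ) with hH
  have hH1 : 1 ≤ H := by
    have : 0 ≤ ∑ b ∈ Ψ, (b : ℝ) := Finset.sum_nonneg fun _ _ => by positivity
    linarith
  have hHb : ∀ b ∈ Ψ, (b : ℝ) ≤ H := by
    intro b hb
    have := Finset.single_le_sum (f := fun b : ℕ => (b : ℝ)) (fun _ _ => by positivity) hb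
    linarith
  set C0 : ℝ := (∑ e ∈ Finset.range s, |(g e : ℝ)|) + ∑ b ∈ Ψ, |(w b : ℝ)| * ((idx p b).card * (s * H ^ s)) with hC0
  have hC0n : 0 ≤ C0 := by
    refine add_nonneg (Finset.sum_nonneg fun _ _ => abs_nonneg _) (Finset.sum_nonneg fun _ _ => by positivity)
  clear_value D0 H C0
  refine ⟨D0 * (C0 + 1), mul_pos (Nat.cast_pos.mpr hD0pos) (by linarith), ?_⟩
  intro n d hn hdpos hd
  obtain ⟨x0, hx0, hWx⟩ := WW_ne hl hΨ w hw
  obtain ⟨j, hj, hne⟩ := nonvanish F FF_pos (WW p Ψ w) s n (LL p Ψ w)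
    (fun N J r hN => LL_shift hl (fun b hb => (hΨ b hb).2) w s N J r hN) hn hs hs1 x0 hx0 hWx
  have hNd := NN_deg F s n j hn hs hs1 hj
  have hne2 : LL p Ψ w (rf (NN F s n j) (Finset.Icc (0 : ℤ) n) s (tau p)) ≠ 0 := by
    rw [NN, rf_C_mul]
    have h1 : algebraMap ℚ (LaurentSeries ℚ_[p]) (cst F s n) = HahnSeries.C (cst F s n : ℚ_[p]) := by
      rw [eq_ratCast, map_ratCast]
    rw [h1, HahnSeries.C_mul_eq_smul, map_smul, smul_eq_mul]
    exact mul_ne_zero (by exact_mod_cast cst_ne F s n) hne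
  have hev := LL_eval hl hΨ w F s n j hNd g hg
  set r : ℚ := (∑ e ∈ Finset.range s, PP F s n j e * g e) - ∑ b ∈ Ψ, (w b : ℚ) * ∑ a ∈ idx p b, rho F s n j ((a : ℚ) / b) with hr
  have hIntg : ∃ z : ℤ, (D0 : ℚ) * (d : ℚ) ^ s * r = z := by
    have hsub : (D0 : ℚ) * (d : ℚ) ^ s * r ∈ (Int.castRingHom ℚ).range := by
      rw [hr, mul_sub]
      refine sub_mem ?_ ?_
      · rw [Finset.mul_sum]
        refine sum_mem fun e he => ?_
        have h1 : (d : ℚ) ^ s * PP F s n j e ∈ (Int.castRingHom ℚ).range := by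
          rw [PP, Finset.mul_sum]
          refine sum_mem fun k hk => ?_
          obtain ⟨z, hz⟩ := pfc_int F s n j d hd k hk e
          have : (d : ℚ) ^ s = (d : ℚ) ^ (s - e) * (d : ℚ) ^ e := by
            rw [← pow_add, Nat.sub_add_cancel (Finset.mem_range.mp he).le]
          rw [this, mul_assoc, hz]
          exact ⟨d ^ (s - e) * z, by push_cast; simp⟩
        obtain ⟨z, hz⟩ := hDg e he
        have h2 : (D0 : ℚ) * (d : ℚ) ^ s * (PP F s n j e * g e) = ((d : ℚ) ^ s * PP F s n j e) * (D0 * g e) := by ring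
        rw [h2, hz]
        exact mul_mem h1 ⟨z, by simp⟩
      · rw [mul_assoc]
        refine mul_mem ⟨D0, by simp⟩ ?_
        rw [Finset.mul_sum]
        refine sum_mem fun b hb => ?_
        rw [mul_left_comm]
        refine mul_mem ⟨w b, by simp⟩ ?_
        rw [Finset.mul_sum]
        refine sum_mem fun a ha => ?_
        obtain ⟨z, hz⟩ := rho0_int F FF_pos s n j d hd hNd ((a : ℚ) / b) (mem_FF.mpr ⟨b, hb, a, ha, rfl⟩)
        exact ⟨z, by rw [rho, hz]; simp⟩
    obtain ⟨z, hz⟩ := hsub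
    exact ⟨z, by rw [← hz]; simp⟩
  obtain ⟨z, hz⟩ := hIntg
  have hr0 : r ≠ 0 := by
    intro h; rw [hev, h] at hne2; exact hne2 (by simp)
  have hcard : (F.card : ℕ) * (n + 1) ≤ s * n := by nlinarith
  obtain ⟨M, hM⟩ : ∃ M, M + 1 + j + n * F.card = s * (n + 1) := by
    refine ⟨s * (n + 1) - (1 + j + n * F.card), ?_⟩
    have : 1 + j + n * F.card ≤ s * (n + 1) := by nlinarith
    omega
  refine ⟨z, M, ?_, ?_, ?_, ?_, ?_⟩
  · intro h
    rw [h] at hz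
    have : (D0 : ℚ) * (d : ℚ) ^ s * r ≠ 0 := mul_ne_zero (mul_ne_zero (by exact_mod_cast hD0pos.ne') (pow_ne_zero _ (by exact_mod_cast hdpos.ne'))) hr0
    exact this (by rw [hz]; simp)
  · nlinarith
  · nlinarith [Nat.zero_le (n * F.card)]
  · have hzr : (z : ℝ) = D0 * (d : ℝ) ^ s * (r : ℝ) := by
      have : ((z : ℚ) : ℝ) = ((D0 * (d : ℚ) ^ s * r : ℚ) : ℝ) := by rw [hz]
      push_cast at this; exact this
    have hrb : |(r : ℝ)| ≤ C0 * ((n + 1) ^ 2 * BN F s n) := by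
      have hB := BN_nonneg F s n
      rw [hr]; push_cast
      refine (abs_sub _ _).trans ?_
      rw [hC0, add_mul]
      refine add_le_add ?_ ?_
      · refine (Finset.abs_sum_le_sum_abs _ _).trans ?_
        rw [Finset.sum_mul]
        refine Finset.sum_le_sum fun e he => ?_
        rw [abs_mul, mul_comm]
        refine mul_le_mul_of_nonneg_left ?_ (abs_nonneg _)
        refine (PP_BN F FF_pos s n j hj.le e (Finset.mem_range.mp he).le).trans ?_
        have h0 : (0 : ℝ) ≤ n := Nat.cast_nonneg n
        refine mul_le_mul_of_nonneg_right ?_ hB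
        nlinarith
      · refine (Finset.abs_sum_le_sum_abs _ _).trans ?_
        rw [Finset.sum_mul]
        refine Finset.sum_le_sum fun b hb => ?_
        rw [abs_mul, mul_assoc]
        refine mul_le_mul_of_nonneg_left ?_ (abs_nonneg _)
        refine (Finset.abs_sum_le_sum_abs _ _).trans ?_
        rw [mul_assoc, ← nsmul_eq_mul]
        refine Finset.sum_le_card_nsmul _ _ _ fun a ha => ?_
        have hpos := idx_pos ha
        have ha1 : (1 : ℝ) ≤ a := by exact_mod_cast hpos.1
        have hxx := (FF_pos (p := p) (Ψ := Ψ) ((a : ℚ) / b) (mem_FF.mpr ⟨b, hb, a, ha, rfl⟩)).1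
        have h5 := rho_BN F FF_pos s n j hj.le ((a : ℚ) / b) H hH1 hxx (by
          push_cast
          rw [inv_div]
          refine le_trans ?_ (hHb b hb)
          exact div_le_self (by positivity) ha1)
        refine h5.trans (le_of_eq ?_)
        ring
    rw [hzr, abs_mul, abs_of_nonneg (by positivity : (0:ℝ) ≤ D0 * (d : ℝ) ^ s)]
    have hB := BN_nonneg F s n
    calc (D0 : ℝ) * (d : ℝ) ^ s * |(r : ℝ)| ≤ D0 * (d : ℝ) ^ s * (C0 * ((n + 1) ^ 2 * BN F s n)) := by gcongr
      _ ≤ D0 * (d : ℝ) ^ s * ((C0 + 1) * ((n + 1) ^ 2 * BN F s n)) := by gcongr; linarith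
      _ = _ := by ring
  · have hzr : (z : ℚ_[p]) = ((D0 * d ^ s : ℕ) : ℚ_[p]) * (r : ℚ_[p]) := by
      have : ((z : ℚ) : ℚ_[p]) = ((D0 * (d : ℚ) ^ s * r : ℚ) : ℚ_[p]) := by rw [hz]
      push_cast at this ⊢; exact this
    rw [hzr, norm_mul, ← hev]
    refine (mul_le_of_le_one_left (norm_nonneg _) (norm_nat_le_one _)).trans ?_
    rw [LL_apply]
    have hBn : 0 ≤ ‖((n.factorial : ℕ) : ℚ_[p])‖ ^ s * (p * ((M + 1) * (((p : ℝ) ^ l)⁻¹) ^ M)) := by positivity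
    refine IsUltrametricDist.norm_sum_le_of_forall_le_of_nonneg hBn fun b hb => ?_
    refine IsUltrametricDist.norm_sum_le_of_forall_le_of_nonneg hBn fun a ha => ?_
    rw [norm_mul]
    refine (mul_le_of_le_one_left (norm_nonneg _) (Padic.norm_int_le_one _)).trans ?_
    exact norm_TT_NN F (FF_den hl (fun b hb => (hΨ b hb).2)) s n j M hM hl (norm_div_idx (hΨ b hb).2 ha)

end PZ

namespace PZ

variable {p : ℕ} [hp : Fact p.Prime]

lemma int_norm_prod (z : ℤ) (hz : z ≠ 0) : 1 ≤ |(z : ℝ)| * ‖(z : ℚ_[p])‖ := by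
  have hz' : (z : ℚ_[p]) ≠ 0 := by exact_mod_cast hz
  have h1 : ‖(z : ℚ_[p])‖ = (p : ℝ) ^ (-((padicValInt p z : ℕ) : ℤ)) := by
    rw [Padic.norm_eq_zpow_neg_valuation hz', Padic.valuation_intCast]
  have h2 : ((p ^ (padicValInt p z) : ℕ) : ℤ) ∣ z := by
    have := (Padic.norm_int_le_pow_iff_dvd (p := p) z (padicValInt p z)).mp h1.le
    exact_mod_cast this
  have h3 := Int.le_of_dvd (abs_pos.mpr hz) ((dvd_abs _ _).mpr h2)
  have h4 : ((p : ℝ) ^ (padicValInt p z)) ≤ |(z : ℝ)| := by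
    rw [← Int.cast_abs]; exact_mod_cast h3
  have hp0 : (0 : ℝ) < p := by exact_mod_cast hp.out.pos
  rw [h1, zpow_neg, zpow_natCast, ← div_eq_mul_inv, le_div_iff₀ (by positivity), one_mul]
  exact h4

lemma BN_le (F : Finset ℚ) (s n : ℕ) (ω : ℝ) (hω : ∀ θ ∈ F, Real.log θ.den + ∑ q ∈ θ.den.primeFactors, Real.log q / ((q : ℝ) - 1) ≤ ω) :
    BN F s n ≤ ((s : ℝ) + 1) ^ (s + F.card + 2) * ((n : ℝ) + 2) ^ (s + F.card) * (Real.exp (n * (s * Real.log 2)) * ((n : ℝ) + 2) ^ (s * s)) *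
      (Real.exp (n * (F.card * ω)) * Real.exp ((n + 2) * F.card)) := by
  unfold BN
  have h1 : ∏ θ ∈ F, ((kap θ.den n : ℝ) * (θ.den : ℝ) ^ n * Real.exp (n + 2)) ≤ Real.exp (n * (F.card * ω)) * Real.exp ((n + 2) * F.card) := by
    have h2 : ∏ θ ∈ F, ((kap θ.den n : ℝ) * (θ.den : ℝ) ^ n * Real.exp (n + 2)) ≤ ∏ θ ∈ F, (Real.exp (n * ω) * Real.exp (n + 2)) := by
      refine Finset.prod_le_prod (fun _ _ => by positivity) fun θ hθ => ?_
      refine mul_le_mul_of_nonneg_right ?_ (Real.exp_pos _).le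
      have hden : (0 : ℝ) < θ.den := by exact_mod_cast θ.den_pos
      have h3 : (θ.den : ℝ) ^ n = Real.exp (n * Real.log θ.den) := by
        rw [← Real.log_pow, Real.exp_log (by positivity)]
      rw [h3]
      refine (mul_le_mul_of_nonneg_right (kap_le _ _) (Real.exp_pos _).le).trans ?_
      rw [← Real.exp_add, ← mul_add]
      refine Real.exp_le_exp.mpr (mul_le_mul_of_nonneg_left ?_ (Nat.cast_nonneg n))
      linarith [hω θ hθ]
    refine h2.trans (le_of_eq ?_)
    rw [Finset.prod_const, mul_pow, ← Real.exp_nat_mul, ← Real.exp_nat_mul]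
    congr 2 <;> ring
  have h4 : ((2 : ℝ) ^ n * ((n : ℝ) + 1) ^ s) ^ s ≤ Real.exp (n * (s * Real.log 2)) * ((n : ℝ) + 2) ^ (s * s) := by
    rw [mul_pow, ← pow_mul, ← pow_mul]
    refine mul_le_mul (le_of_eq ?_) (pow_le_pow_left₀ (by positivity) (by linarith) _) (by positivity) (Real.exp_pos _).le
    rw [← mul_assoc, ← Nat.cast_mul, ← Real.log_pow, Real.exp_log (by positivity)]
  have h0 : 0 ≤ ∏ θ ∈ F, ((kap θ.den n : ℝ) * (θ.den : ℝ) ^ n * Real.exp (n + 2)) :=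
    Finset.prod_nonneg fun θ _ => by positivity
  gcongr

lemma poly_exp_small (C : ℝ) (c : ℕ) (E : ℝ) (hE : E < 0) : ∃ n0 : ℕ, ∀ n ≥ n0, C * ((n : ℝ) + 2) ^ c * Real.exp (n * E) < 1 := by
  have h1 : Tendsto (fun n : ℕ => (-E) * ((n : ℝ) + 2)) atTop atTop :=
    (tendsto_atTop_add_const_right _ _ tendsto_natCast_atTop_atTop).const_mul_atTop (by linarith)
  have h2 := Real.tendsto_pow_mul_exp_neg_atTop_nhds_zero c
  have h3 := (h2.comp h1).const_mul (C * Real.exp (-(2 * E)) * (((-E) ^ c)⁻¹))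
  rw [mul_zero] at h3
  obtain ⟨n0, hn0⟩ := eventually_atTop.mp (h3.eventually_lt_const zero_lt_one)
  refine ⟨n0, fun n hn => ?_⟩
  have h4 := hn0 n hn
  simp only [Function.comp] at h4
  refine lt_of_eq_of_lt ?_ h4
  have h5 : Real.exp (n * E) = Real.exp (-(2 * E)) * Real.exp (-(-E * (n + 2))) := by
    rw [← Real.exp_add]; congr 1; ring
  have h6 : (-E) ^ c ≠ 0 := pow_ne_zero _ (by linarith)
  rw [h5, mul_pow]
  generalize (-E) ^ c = u at *
  field_simp

/-- The contradiction: the number of relations cannot exist. -/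
theorem no_relation {l : ℕ} (hl : 1 ≤ l) {Ψ : Finset ℕ} (hΨ : ∀ b ∈ Ψ, b ≠ 0 ∧ p ^ l ∣ b) (w : ℕ → ℤ) (hw : ∃ b ∈ Ψ, w b ≠ 0)
    (s : ℕ) (hs : 2 * (FF p Ψ).card ≤ s) (hs1 : 1 ≤ s) (g : ℕ → ℚ)
    (hg : ∀ e < s, ∑ b ∈ Ψ, (w b : ℚ_[p]) * ∑ a ∈ idx p b, hh ((b : ℚ_[p]) / (a : ℚ_[p])) (s - e - 1) = (g e : ℚ_[p]))
    (ω : ℝ) (hω : ∀ b ∈ Ψ, Real.log b + ∑ q ∈ b.primeFactors, Real.log q / ((q : ℝ) - 1) ≤ ω)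
    (hcost : (FF p Ψ).card * (ω + 1 + l * Real.log p) < s * ((l + 1 / ((p : ℝ) - 1)) * Real.log p - 1 - Real.log 2)) : False := by
  obtain ⟨C, hC, hap⟩ := approx hl hΨ w hw s hs hs1 g hg
  have hωF : ∀ θ ∈ FF p Ψ, Real.log θ.den + ∑ q ∈ θ.den.primeFactors, Real.log q / ((q : ℝ) - 1) ≤ ω := by
    intro θ h
    obtain ⟨b, hb, a, ha, rfl⟩ := mem_FF.mp h
    have hb0 := (hΨ b hb).1
    have hdvd : ((a : ℚ) / b).den ∣ b := by
      have := Rat.den_dvd (a : ℤ) (b : ℤ)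
      rw [Rat.divInt_eq_div, Int.cast_natCast, Int.cast_natCast] at this
      exact Int.natCast_dvd_natCast.mp this
    refine le_trans (add_le_add ?_ ?_) (hω b hb)
    · exact Real.log_le_log (by exact_mod_cast Rat.den_pos _) (by exact_mod_cast Nat.le_of_dvd (by omega) hdvd)
    · refine Finset.sum_le_sum_of_subset_of_nonneg (Nat.primeFactors_mono hdvd hb0) fun q hq _ => ?_
      have : (1 : ℝ) < q := by exact_mod_cast (Nat.prime_of_mem_primeFactors hq).one_lt
      exact div_nonneg (Real.log_nonneg this.le) (by linarith)
  have hBN := fun n => BN_le (FF p Ψ) s n ω hωF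
  set m := (FF p Ψ).card with hm
  generalize FF p Ψ = F at *
  have hp1 : (1 : ℝ) < p := by exact_mod_cast hp.out.one_lt
  have hlp : 0 < Real.log p := Real.log_pos hp1
  set lam := Real.log p / ((p : ℝ) - 1) with hlam
  set E0 : ℝ := s + s * Real.log 2 + m * ω + m - s * lam - s * (l * Real.log p) + m * (l * Real.log p) with hE0
  have hE0n : E0 < 0 := by
    have : (s : ℝ) * ((l + 1 / ((p : ℝ) - 1)) * Real.log p - 1 - Real.log 2) = s * (l * Real.log p) + s * lam - s - s * Real.log 2 := by
      rw [hlam]; ring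
    rw [this] at hcost
    rw [hE0]; linarith
  have hs0 : (0 : ℝ) < s := by exact_mod_cast hs1
  set ε := -E0 / (2 * s) with hε
  have hεp : 0 < ε := div_pos (by linarith) (by linarith)
  have hsε : s * ε = -E0 / 2 := by rw [hε]; field_simp
  set C1 : ℝ := C * ((s : ℝ) + 1) ^ (s + m + 2) * (p : ℝ) ^ s * (p * s) * (Real.exp (2 * m) * Real.exp (m * (l * Real.log p))) with hC1
  obtain ⟨n0, hn0⟩ := poly_exp_small C1 (2 + (s + m) + s * s + s + 1) (E0 / 2) (by linarith)
  obtain ⟨n, hn, hψ⟩ := psi_small ε hεp (n0 + 1)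
  have hlt := hn0 n (by omega)
  obtain ⟨z, M, hz, hM1, hM2, hza, hzp⟩ := hap n (Nat.lcmUpto n) (by omega) (Nat.lcmUpto_pos n) (by
    intro k h1 h2
    exact Finset.dvd_lcm (f := id) (Finset.mem_Icc.mpr ⟨h1, h2⟩))
  have h1 := int_norm_prod (p := p) z hz
  rw [Chebyshev.psi_eq_log_lcmUpto] at hψ
  have hd : ((Nat.lcmUpto n : ℕ) : ℝ) ^ s ≤ Real.exp (n * (s * (1 + ε))) := by
    have hpos : (0 : ℝ) < (Nat.lcmUpto n : ℕ) := by exact_mod_cast Nat.lcmUpto_pos n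
    rw [← Real.exp_log (pow_pos hpos s), Real.log_pow]
    refine Real.exp_le_exp.mpr ?_
    calc (s : ℝ) * _ ≤ s * ((1 + ε) * n) := mul_le_mul_of_nonneg_left hψ hs0.le
      _ = _ := by ring
  have hnf : ‖((n.factorial : ℕ) : ℚ_[p])‖ ^ s ≤ (p : ℝ) ^ s * ((n : ℝ) + 2) ^ s * Real.exp (-(n * (s * lam))) := by
    refine (pow_le_pow_left₀ (norm_nonneg _) (norm_factorial_le n) s).trans ?_
    rw [mul_pow, mul_pow, ← Real.exp_nat_mul]
    have e1 : (s : ℝ) * -(n * lam) = -(n * (s * lam)) := by ring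
    rw [← hlam, e1]
    have : ((n : ℝ) + 1) ^ s ≤ ((n : ℝ) + 2) ^ s := pow_le_pow_left₀ (by positivity) (by linarith) _
    gcongr
  have hMM : ((M : ℝ) + 1) ≤ s * ((n : ℝ) + 2) := by
    have : ((M : ℝ) + 1) ≤ s * ((n : ℝ) + 1) := by exact_mod_cast hM2
    nlinarith
  have hpM : (((p : ℝ) ^ l)⁻¹) ^ M ≤ Real.exp (-(n * (s * (l * Real.log p))) + m * (n + 1) * (l * Real.log p)) := by
    have e1 : (((p : ℝ) ^ l)⁻¹) ^ M = Real.exp (-(M * (l * Real.log p))) := by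
      rw [Real.exp_neg, Real.exp_nat_mul, Real.exp_nat_mul, Real.exp_log (by linarith), inv_pow]
    rw [e1]
    refine Real.exp_le_exp.mpr ?_
    have h2 : (s : ℝ) * n ≤ M + m * (n + 1) := by exact_mod_cast hM1
    have h3 := mul_le_mul_of_nonneg_right h2 (by positivity : 0 ≤ l * Real.log p)
    linarith
  have hB0 := BN_nonneg F s n
  have hn2 : ((n : ℝ) + 1) ^ 2 ≤ ((n : ℝ) + 2) ^ 2 := pow_le_pow_left₀ (by positivity) (by linarith) _
  have hfin : |(z : ℝ)| * ‖(z : ℚ_[p])‖ ≤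
     (C * Real.exp (n * (s * (1 + ε))) * (((n : ℝ) + 2) ^ 2 * (((s : ℝ) + 1) ^ (s + m + 2) * ((n : ℝ) + 2) ^ (s + m) * (Real.exp (n * (s * Real.log 2)) * ((n : ℝ) + 2) ^ (s * s)) *
      (Real.exp (n * (m * ω)) * Real.exp ((n + 2) * m))))) *
     (((p : ℝ) ^ s * ((n : ℝ) + 2) ^ s * Real.exp (-(n * (s * lam)))) * (p * ((s * ((n : ℝ) + 2)) * Real.exp (-(n * (s * (l * Real.log p))) + m * (n + 1) * (l * Real.log p))))) := by
    refine mul_le_mul (hza.trans ?_) (hzp.trans ?_) (norm_nonneg _) (by positivity)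
    · exact mul_le_mul (mul_le_mul_of_nonneg_left hd hC.le) (mul_le_mul hn2 (hBN n) hB0 (by positivity)) (by positivity) (by positivity)
    · exact mul_le_mul hnf (mul_le_mul_of_nonneg_left (mul_le_mul hMM hpM (by positivity) (by positivity)) (by positivity)) (by positivity) (by positivity)
  have heq : (C * Real.exp (n * (s * (1 + ε))) * (((n : ℝ) + 2) ^ 2 * (((s : ℝ) + 1) ^ (s + m + 2) * ((n : ℝ) + 2) ^ (s + m) * (Real.exp (n * (s * Real.log 2)) * ((n : ℝ) + 2) ^ (s * s)) *
      (Real.exp (n * (m * ω)) * Real.exp ((n + 2) * m))))) *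
     (((p : ℝ) ^ s * ((n : ℝ) + 2) ^ s * Real.exp (-(n * (s * lam)))) * (p * ((s * ((n : ℝ) + 2)) * Real.exp (-(n * (s * (l * Real.log p))) + m * (n + 1) * (l * Real.log p)))))
     = C1 * ((n : ℝ) + 2) ^ (2 + (s + m) + s * s + s + 1) * Real.exp (n * (E0 / 2)) := by
    have e2 : Real.exp (n * (s * (1 + ε))) * Real.exp (n * (s * Real.log 2)) * Real.exp (n * (m * ω)) * Real.exp ((n + 2) * m) *
       Real.exp (-(n * (s * lam))) * Real.exp (-(n * (s * (l * Real.log p))) + m * (n + 1) * (l * Real.log p)) =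
       Real.exp (2 * m) * Real.exp (m * (l * Real.log p)) * Real.exp (n * (E0 / 2)) := by
      simp only [← Real.exp_add]
      congr 1
      have : E0 / 2 = E0 + s * ε := by rw [hsε]; ring
      rw [this, hE0]; ring
    rw [hC1]
    rw [pow_add _ (2 + (s + m) + s * s + s) 1, pow_add _ (2 + (s + m) + s * s) s, pow_add _ (2 + (s + m)) (s * s), pow_add _ 2 (s + m), pow_one]
    generalize Real.exp (n * (s * (1 + ε))) = x1 at *
    generalize Real.exp (n * (s * Real.log 2)) = x2 at *
    generalize Real.exp (n * (m * ω)) = x3 at *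
    generalize Real.exp ((n + 2) * m) = x4 at *
    generalize Real.exp (-(n * (s * lam))) = x5 at *
    generalize Real.exp (-(n * (s * (l * Real.log p))) + m * (n + 1) * (l * Real.log p)) = x6 at *
    generalize Real.exp (2 * m) * Real.exp (m * (l * Real.log p)) = x7 at *
    generalize Real.exp (n * (E0 / 2)) = x8 at *
    generalize ((n : ℝ) + 2) ^ (s + m) = y1
    generalize ((n : ℝ) + 2) ^ (s * s) = y2
    generalize ((n : ℝ) + 2) ^ s = y3
    generalize ((s : ℝ) + 1) ^ (s + m + 2) = y4
    generalize (p : ℝ) ^ s = y5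
    generalize ((n : ℝ) + 2) = y6
    linear_combination (C * y6 ^ 2 * y4 * y1 * y2 * y5 * y3 * p * s * y6) * e2
  rw [heq] at hfin
  linarith
end PZ

namespace PZ

lemma exists_int_relation (Ψ I : Finset ℕ) (h : I.card < Ψ.card) :
    ∃ w : ℕ → ℤ, (∃ b ∈ Ψ, w b ≠ 0) ∧ ∀ i ∈ I, ∑ b ∈ Ψ, w b * (b : ℤ) ^ i = 0 := by
  classical
  let f : (Ψ → ℚ) →ₗ[ℚ] (I → ℚ) := LinearMap.pi fun i => ∑ b : Ψ, ((b : ℕ) : ℚ) ^ (i : ℕ) • LinearMap.proj b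
  have hk : LinearMap.ker f ≠ ⊥ := LinearMap.ker_ne_bot_of_finrank_lt (by simpa using h)
  obtain ⟨v, hv, hv0⟩ := (Submodule.ne_bot_iff _).mp hk
  rw [LinearMap.mem_ker] at hv
  have hv' : ∀ i ∈ I, ∑ b : Ψ, v b * ((b : ℕ) : ℚ) ^ i = 0 := by
    intro i hi
    have := congrFun hv ⟨i, hi⟩
    simp only [f, LinearMap.pi_apply, LinearMap.sum_apply, LinearMap.smul_apply, LinearMap.proj_apply, smul_eq_mul, Pi.zero_apply] at this
    rw [← this]
    exact Finset.sum_congr rfl fun b _ => mul_comm _ _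
  set D : ℕ := ∏ b : Ψ, (v b).den with hD
  have hD0 : (D : ℚ) ≠ 0 := by
    rw [hD]; push_cast; exact Finset.prod_ne_zero_iff.mpr fun b _ => by exact_mod_cast (v b).den_nz
  have hIntg : ∀ b : Ψ, ∃ z : ℤ, (D : ℚ) * v b = z := by
    intro b
    obtain ⟨c, hc⟩ : (v b).den ∣ D := Finset.dvd_prod_of_mem _ (Finset.mem_univ b)
    refine ⟨c * (v b).num, ?_⟩
    rw [hc]; push_cast
    rw [← Rat.mul_den_eq_num (v b)]; ring
  choose z hz using hIntg
  refine ⟨fun b => if hb : b ∈ Ψ then z ⟨b, hb⟩ else 0, ?_, ?_⟩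
  · obtain ⟨b, hb⟩ := Function.ne_iff.mp hv0
    refine ⟨b, b.2, ?_⟩
    simp only [b.2, dif_pos]
    intro h0
    have h1 := hz b
    rw [h0] at h1
    exact mul_ne_zero hD0 hb (by simpa using h1)
  · intro i hi
    have h1 : ((∑ b ∈ Ψ, (if hb : b ∈ Ψ then z ⟨b, hb⟩ else 0) * (b : ℤ) ^ i : ℤ) : ℚ) = 0 := by
      rw [← Finset.sum_coe_sort, Int.cast_sum]
      have h2 : ∀ b : Ψ, (((if hb : (b : ℕ) ∈ Ψ then z ⟨b, hb⟩ else 0) * ((b : ℕ) : ℤ) ^ i : ℤ) : ℚ) = D * (v b * ((b : ℕ) : ℚ) ^ i) := by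
        intro b
        rw [dif_pos b.2]
        push_cast
        rw [← mul_assoc, hz]
      rw [Finset.sum_congr rfl fun b _ => h2 b, ← Finset.mul_sum, hv' i hi, mul_zero]
    exact_mod_cast h1

variable {p : ℕ} [hp : Fact p.Prime]

open Classical in
theorem core {l : ℕ} (hl : 1 ≤ l) {Ψ : Finset ℕ} (hΨ : ∀ b ∈ Ψ, b ≠ 0 ∧ p ^ l ∣ b)
    (s : ℕ) (hs : 2 * (FF p Ψ).card ≤ s) (hs1 : 1 ≤ s)
    (ω : ℝ) (hω : ∀ b ∈ Ψ, Real.log b + ∑ q ∈ b.primeFactors, Real.log q / ((q : ℝ) - 1) ≤ ω)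
    (hcost : (FF p Ψ).card * (ω + 1 + l * Real.log p) < s * ((l + 1 / ((p : ℝ) - 1)) * Real.log p - 1 - Real.log 2)) :
    Ψ.card ≤ Nat.card {j : ℕ | Odd j ∧ 3 ≤ j ∧ j ≤ s ∧ ZetaPIrrational p j} := by
  set I : Finset ℕ := (Finset.Icc 3 s).filter (fun j => Odd j ∧ ZetaPIrrational p j) with hI
  have hIeq : {j : ℕ | Odd j ∧ 3 ≤ j ∧ j ≤ s ∧ ZetaPIrrational p j} = (I : Set ℕ) := by
    ext j; simp only [hI, Set.mem_ofPred_eq, Finset.coe_filter, Finset.mem_Icc]; tauto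
  rw [hIeq]
  simp only [Nat.card_eq_fintype_card, Fintype.card_coe, Finset.coe_sort_coe]
  by_contra! hlt
  obtain ⟨w, hw, hrel⟩ := exists_int_relation Ψ I hlt
  have hg : ∀ e, ∃ g : ℚ, e < s → ∑ b ∈ Ψ, (w b : ℚ_[p]) * ∑ a ∈ idx p b, hh ((b : ℚ_[p]) / (a : ℚ_[p])) (s - e - 1) = (g : ℚ_[p]) := by
    intro e
    by_cases he : e < s
    swap
    · exact ⟨0, fun h => absurd h he⟩
    obtain ⟨i, hi⟩ : ∃ i, i = s - e := ⟨_, rfl⟩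
    rw [← hi]
    rcases Nat.lt_or_ge i 2 with h2 | h2
    · have : i - 1 = 0 := by omega
      exact ⟨0, fun _ => by simp [this, hh_zero]⟩
    have hbp : ∀ b ∈ Ψ, p ∣ b := fun b hb => (dvd_pow_self p (by omega)).trans (hΨ b hb).2
    have hT : ∀ b ∈ Ψ, Tendsto (fun m => ((zetaNegVal p i m : ℚ) : ℚ_[p])) atTop (nhds (((b : ℚ_[p]) ^ i)⁻¹ * ∑ a ∈ idx p b, hh ((b : ℚ_[p]) / (a : ℚ_[p])) (i - 1))) :=
      fun b hb => tendsto_zeta i b h2 (hΨ b hb).1 (hbp b hb)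
    obtain ⟨b0, hb0, _⟩ := hw
    obtain ⟨x, hx⟩ : ∃ x, x = ((b0 : ℚ_[p]) ^ i)⁻¹ * ∑ a ∈ idx p b0, hh ((b0 : ℚ_[p]) / (a : ℚ_[p])) (i - 1) := ⟨_, rfl⟩
    have hxT := hT b0 hb0
    rw [← hx] at hxT
    have hsum : ∑ b ∈ Ψ, (w b : ℚ_[p]) * ∑ a ∈ idx p b, hh ((b : ℚ_[p]) / (a : ℚ_[p])) (i - 1) = ((∑ b ∈ Ψ, w b * (b : ℤ) ^ i : ℤ) : ℚ_[p]) * x := by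
      push_cast
      rw [Finset.sum_mul]
      refine Finset.sum_congr rfl fun b hb => ?_
      have h3 := tendsto_nhds_unique hxT (hT b hb)
      have hb' : ((b : ℚ_[p]) ^ i) ≠ 0 := pow_ne_zero _ (Nat.cast_ne_zero.mpr (hΨ b hb).1)
      rw [h3, mul_assoc, mul_inv_cancel_left₀ hb']
    rw [hsum]
    rcases Nat.even_or_odd i with hev | hodd
    · have := tendsto_nhds_unique hxT (zeta_even i hev)
      exact ⟨0, fun _ => by rw [this]; simp⟩
    · by_cases hir : ZetaPIrrational p i
      · have hiI : i ∈ I := by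
          simp only [hI, Finset.mem_filter, Finset.mem_Icc]
          obtain ⟨k, hk⟩ := hodd
          exact ⟨⟨by omega, by omega⟩, ⟨k, hk⟩, hir⟩
        exact ⟨0, fun _ => by rw [hrel i hiI]; simp⟩
      · have hxr : x ∈ Set.range ((↑) : ℚ → ℚ_[p]) := by
          by_contra hc
          exact hir ⟨x, hc, hxT⟩
        obtain ⟨y, hy⟩ := hxr
        exact ⟨(∑ b ∈ Ψ, w b * (b : ℤ) ^ i : ℤ) * y, fun _ => by rw [← hy]; push_cast; rfl⟩
  choose g hg using hg
  exact no_relation hl hΨ w hw s hs hs1 g (fun e he => hg e he) ω hω hcost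
end PZ

namespace PZ

/-- local density weight -/
noncomputable def ff (p : ℕ) (Q : Finset ℕ) (b : ℕ) : ℝ :=
  ((p : ℝ) / ((p : ℝ) - 1)) * ∏ q ∈ Q with q ∣ b, ((q : ℝ) / ((q : ℝ) - 1))

/-- period -/
def PQ (p l : ℕ) (Q : Finset ℕ) : ℕ := p ^ l * ∏ q ∈ Q, q

/-- mean value -/
noncomputable def Cq (p l : ℕ) (Q : Finset ℕ) : ℝ :=
  ((p : ℝ) ^ l)⁻¹ * (((p : ℝ) / ((p : ℝ) - 1)) * ∏ q ∈ Q, (1 + 1 / ((q : ℝ) * ((q : ℝ) - 1))))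

/-- the set of denominators -/
noncomputable def Psi (p l : ℕ) (Q : Finset ℕ) (B : ℝ) : Finset ℕ :=
  open Classical in (Finset.Ioc 0 ⌊B * ff p Q 0⌋₊).filter (fun b => p ^ l ∣ b ∧ (b : ℝ) ≤ B * ff p Q b)

lemma one_le_ratio {q : ℕ} (hq : q.Prime) : 1 ≤ (q : ℝ) / ((q : ℝ) - 1) := by
  have : (1 : ℝ) < q := by exact_mod_cast hq.one_lt
  rw [le_div_iff₀ (by linarith)]; linarith

lemma one_le_ff {p : ℕ} (hp : p.Prime) {Q : Finset ℕ} (hQ : ∀ q ∈ Q, q.Prime) (b : ℕ) : 1 ≤ ff p Q b :=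
  one_le_mul_of_one_le_of_one_le (one_le_ratio hp)
    (Finset.one_le_prod fun q hq => one_le_ratio (hQ q (Finset.mem_filter.mp hq).1))

lemma ff_le_zero {p : ℕ} (hp : p.Prime) {Q : Finset ℕ} (hQ : ∀ q ∈ Q, q.Prime) (b : ℕ) : ff p Q b ≤ ff p Q 0 := by
  refine mul_le_mul_of_nonneg_left ?_ (by linarith [one_le_ratio hp])
  refine Finset.prod_le_prod_of_subset_of_one_le ?_ ?_ ?_
  · intro q hq
    rw [Finset.mem_filter] at hq ⊢
    exact ⟨hq.1, dvd_zero q⟩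
  · intro q hq
    linarith [one_le_ratio (hQ q (Finset.mem_filter.mp hq).1)]
  · intro q hq _
    exact one_le_ratio (hQ q (Finset.mem_filter.mp hq).1)

lemma ff_period (p l : ℕ) (Q : Finset ℕ) (r k : ℕ) : ff p Q (r + k * PQ p l Q) = ff p Q r := by
  unfold ff
  congr 2
  refine Finset.filter_congr fun q hq => ?_
  have : q ∣ k * PQ p l Q := Dvd.dvd.mul_left (Dvd.dvd.mul_left (Finset.dvd_prod_of_mem _ hq) _) _
  exact (Nat.dvd_add_left this)

lemma PQ_pos {p : ℕ} (l : ℕ) (hp : p.Prime) {Q : Finset ℕ} (hQ : ∀ q ∈ Q, q.Prime) : 0 < PQ p l Q :=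
  mul_pos (pow_pos hp.pos l) (Finset.prod_pos fun q hq => (hQ q hq).pos)

lemma sum_ff {p : ℕ} (l : ℕ) (hp : p.Prime) {Q : Finset ℕ} (hQ : ∀ q ∈ Q, q.Prime) (hpQ : p ∉ Q) :
    ∑ r ∈ Finset.Ioc 0 (PQ p l Q) with p ^ l ∣ r, ff p Q r = PQ p l Q * Cq p l Q := by
  classical
  have h1 : ∀ r, ff p Q r = ((p : ℝ) / ((p : ℝ) - 1)) * ∑ S ∈ Q.powerset, if (∏ q ∈ S, q) ∣ r then ∏ q ∈ S, (1 / ((q : ℝ) - 1)) else 0 := by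
    intro r
    unfold ff
    congr 1
    rw [Finset.prod_filter]
    have h2 : ∀ q ∈ Q, (if q ∣ r then (q : ℝ) / ((q : ℝ) - 1) else 1) = 1 + (if q ∣ r then 1 / ((q : ℝ) - 1) else 0) := by
      intro q hq
      have : (1 : ℝ) < q := by exact_mod_cast (hQ q hq).one_lt
      have h3 : (q : ℝ) - 1 ≠ 0 := by linarith
      split_ifs
      · field_simp; ring
      · simp
    rw [Finset.prod_congr rfl h2, Finset.prod_one_add]
    refine Finset.sum_congr rfl fun S hS => ?_
    rw [Finset.mem_powerset] at hS
    have h4 : (∏ q ∈ S, q) ∣ r ↔ ∀ q ∈ S, q ∣ r := by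
      constructor
      · intro h q hq; exact (Finset.dvd_prod_of_mem _ hq).trans h
      · intro h
        exact Finset.prod_primes_dvd r (fun q hq => (hQ q (hS hq)).prime) h
    split_ifs with h
    · exact Finset.prod_congr rfl fun q hq => by rw [if_pos (h4.mp h q hq)]
    · rw [h4] at h
      push Not at h
      obtain ⟨q, hq, hqr⟩ := h
      exact Finset.prod_eq_zero hq (by rw [if_neg hqr])
  simp only [h1]
  rw [← Finset.mul_sum, Finset.sum_comm]
  have h5 : ∀ S ∈ Q.powerset, ∑ r ∈ Finset.Ioc 0 (PQ p l Q) with p ^ l ∣ r, (if (∏ q ∈ S, q) ∣ r then ∏ q ∈ S, (1 / ((q : ℝ) - 1)) else 0)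
      = (PQ p l Q : ℝ) * ((p : ℝ) ^ l)⁻¹ * ∏ q ∈ S, (1 / ((q : ℝ) * ((q : ℝ) - 1))) := by
    intro S hS
    rw [Finset.mem_powerset] at hS
    rw [← Finset.sum_filter, Finset.filter_filter, Finset.sum_const]
    have hcop : Nat.Coprime (p ^ l) (∏ q ∈ S, q) := by
      refine Nat.Coprime.pow_left l (Nat.Coprime.prod_right fun q hq => ?_)
      rw [Nat.coprime_primes hp (hQ q (hS hq))]
      rintro rfl; exact hpQ (hS hq)
    have h6 : (Finset.Ioc 0 (PQ p l Q)).filter (fun r => p ^ l ∣ r ∧ (∏ q ∈ S, q) ∣ r) = (Finset.Ioc 0 (PQ p l Q)).filter (fun r => p ^ l * (∏ q ∈ S, q) ∣ r) := by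
      refine Finset.filter_congr fun r _ => ?_
      exact ⟨fun h => hcop.mul_dvd_of_dvd_of_dvd h.1 h.2, fun h => ⟨(Dvd.intro _ rfl).trans h, (Dvd.intro_left _ rfl).trans h⟩⟩
    rw [h6, Nat.Ioc_filter_dvd_card_eq_div, nsmul_eq_mul]
    have hd : p ^ l * (∏ q ∈ S, q) ∣ PQ p l Q := Nat.mul_dvd_mul_left _ (Finset.prod_dvd_prod_of_subset _ _ _ hS)
    have hS0 : (∏ q ∈ S, (q : ℝ)) ≠ 0 := Finset.prod_ne_zero_iff.mpr fun q hq => by exact_mod_cast (hQ q (hS hq)).ne_zero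
    have hp0 : (p : ℝ) ^ l ≠ 0 := pow_ne_zero _ (by exact_mod_cast hp.ne_zero)
    rw [Nat.cast_div hd (by push_cast; exact mul_ne_zero hp0 hS0)]
    push_cast
    have h7 : ∏ q ∈ S, (1 / ((q : ℝ) * ((q : ℝ) - 1))) = (∏ q ∈ S, (q : ℝ))⁻¹ * ∏ q ∈ S, (1 / ((q : ℝ) - 1)) := by
      rw [← Finset.prod_inv_distrib, ← Finset.prod_mul_distrib]
      refine Finset.prod_congr rfl fun q _ => ?_
      rw [one_div, mul_inv, one_div]
    rw [h7, div_eq_mul_inv, mul_inv]; ring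
  rw [Finset.sum_congr rfl h5, ← Finset.mul_sum, Cq, Finset.prod_one_add]
  ring

lemma mem_Psi {p l : ℕ} (hp : p.Prime) {Q : Finset ℕ} (hQ : ∀ q ∈ Q, q.Prime) {B : ℝ} (hB : 0 ≤ B) {b : ℕ} :
    b ∈ Psi p l Q B ↔ 0 < b ∧ p ^ l ∣ b ∧ (b : ℝ) ≤ B * ff p Q b := by
  simp only [Psi, Finset.mem_filter, Finset.mem_Ioc]
  constructor
  · rintro ⟨⟨h1, _⟩, h2⟩; exact ⟨h1, h2⟩
  · rintro ⟨h1, h2, h3⟩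
    refine ⟨⟨h1, Nat.le_floor (h3.trans ?_)⟩, h2, h3⟩
    exact mul_le_mul_of_nonneg_left (ff_le_zero hp hQ b) hB

lemma card_R_le (p l : ℕ) (Q : Finset ℕ) : (((Finset.Ioc 0 (PQ p l Q)).filter (fun r => p ^ l ∣ r)).card : ℝ) ≤ PQ p l Q := by
  have := Finset.card_filter_le (Finset.Ioc 0 (PQ p l Q)) (fun r => p ^ l ∣ r)
  rw [Nat.card_Ioc, Nat.sub_zero] at this
  exact_mod_cast this

lemma Psi_card_lb {p l : ℕ} (hp : p.Prime) {Q : Finset ℕ} (hQ : ∀ q ∈ Q, q.Prime) (hpQ : p ∉ Q) {B : ℝ} (hB : 0 ≤ B) :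
    Cq p l Q * B - PQ p l Q ≤ (Psi p l Q B).card := by
  classical
  set P := PQ p l Q with hP
  have hP0 : 0 < P := PQ_pos l hp hQ
  have hP0' : (0 : ℝ) < P := by exact_mod_cast hP0
  set R := (Finset.Ioc 0 P).filter (fun r => p ^ l ∣ r) with hR
  have hinj : (R.sigma fun r => Finset.range ⌊B * ff p Q r / P⌋₊).card ≤ (Psi p l Q B).card := by
    refine Finset.card_le_card_of_injOn (fun x => x.1 + x.2 * P) ?_ ?_
    · rintro ⟨r, k⟩ h
      simp only [Finset.coe_sigma, Set.mem_sigma_iff, Finset.mem_coe, hR, Finset.mem_filter, Finset.mem_Ioc, Finset.mem_range] at h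
      obtain ⟨⟨⟨hr0, hrP⟩, hrp⟩, hk⟩ := h
      rw [Finset.mem_coe, mem_Psi hp hQ hB]
      simp only
      refine ⟨by omega, ?_, ?_⟩
      · exact dvd_add hrp (Dvd.dvd.mul_left (Dvd.intro _ rfl) k)
      · rw [hP, ff_period, ← hP]
        have h1 : ((k + 1 : ℕ) : ℝ) ≤ B * ff p Q r / P := by
          refine le_trans ?_ (Nat.floor_le (by have := one_le_ff hp hQ r; positivity))
          exact_mod_cast hk
        rw [le_div_iff₀ hP0'] at h1
        have h2 : (r : ℝ) ≤ P := by exact_mod_cast hrP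
        push_cast at h1 ⊢
        linarith
    · rintro ⟨r, k⟩ h ⟨r', k'⟩ h' heq
      simp only [Finset.coe_sigma, Set.mem_sigma_iff, Finset.mem_coe, hR, Finset.mem_filter, Finset.mem_Ioc, Finset.mem_range] at h h' heq
      have hk : k = k' := by
        rcases lt_trichotomy k k' with hlt | he | hlt
        · have : (k + 1) * P ≤ k' * P := Nat.mul_le_mul_right _ hlt
          rw [add_mul] at this; omega
        · exact he
        · have : (k' + 1) * P ≤ k * P := Nat.mul_le_mul_right _ hlt
          rw [add_mul] at this; omega
      subst hk
      have : r = r' := by omega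
      subst this; rfl
  rw [Finset.card_sigma] at hinj
  simp only [Finset.card_range] at hinj
  have h3 : ∑ r ∈ R, (B * ff p Q r / P - 1) ≤ ∑ r ∈ R, ((⌊B * ff p Q r / P⌋₊ : ℕ) : ℝ) :=
    Finset.sum_le_sum fun r _ => by linarith [Nat.lt_floor_add_one (B * ff p Q r / P)]
  have h4 : ∑ r ∈ R, (B * ff p Q r / P - 1) = Cq p l Q * B - R.card := by
    rw [Finset.sum_sub_distrib, ← Finset.sum_div, ← Finset.mul_sum, hR, hP, sum_ff l hp hQ hpQ, ← hP]
    simp only [Finset.sum_const, nsmul_eq_mul, mul_one]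
    field_simp
  have h5 := card_R_le p l Q
  have h6 : ((∑ r ∈ R, ⌊B * ff p Q r / P⌋₊ : ℕ) : ℝ) ≤ (Psi p l Q B).card := by exact_mod_cast hinj
  push_cast at h6
  linarith

lemma arith_sum (r P K : ℕ) (hP : 0 < P) : ∑ k ∈ Finset.range K, ((r + k * P : ℕ) : ℝ) ≤ (((r : ℝ) + K * P) ^ 2 - (r : ℝ) ^ 2) / (2 * P) := by
  have hP' : (0 : ℝ) < P := by exact_mod_cast hP
  induction K with
  | zero => simp
  | succ K ih =>
    rw [Finset.sum_range_succ]
    refine (add_le_add_left ih _).trans ?_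
    rw [← sub_nonneg]
    have : (((r : ℝ) + (K + 1 : ℕ) * P) ^ 2 - (r : ℝ) ^ 2) / (2 * P) - ((((r : ℝ) + K * P) ^ 2 - (r : ℝ) ^ 2) / (2 * P) + ((r + K * P : ℕ) : ℝ)) = P / 2 := by
      push_cast; field_simp; ring
    rw [this]; positivity

lemma sum_biUnion_le' (R : Finset ℕ) (t : ℕ → Finset ℕ) (f : ℕ → ℝ) (hf : ∀ b, 0 ≤ f b) :
    ∑ b ∈ R.biUnion t, f b ≤ ∑ r ∈ R, ∑ b ∈ t r, f b := by
  induction R using Finset.induction_on with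
  | empty => simp
  | insert a R ha ih =>
    rw [Finset.biUnion_insert, Finset.sum_insert ha]
    have h := Finset.sum_union_inter (s₁ := t a) (s₂ := R.biUnion t) (f := f)
    have h2 : 0 ≤ ∑ b ∈ t a ∩ R.biUnion t, f b := Finset.sum_nonneg fun b _ => hf b
    linarith

lemma Psi_sum_ub {p l : ℕ} (hp : p.Prime) {Q : Finset ℕ} (hQ : ∀ q ∈ Q, q.Prime) (hpQ : p ∉ Q) {B : ℝ} (hB : 0 ≤ B) :
    ∑ b ∈ Psi p l Q B, (b : ℝ) / ff p Q b ≤ Cq p l Q * B ^ 2 / 2 + PQ p l Q * B + (PQ p l Q : ℝ) ^ 2 := by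
  classical
  set P := PQ p l Q with hP
  have hP0 : 0 < P := PQ_pos l hp hQ
  have hP0' : (0 : ℝ) < P := by exact_mod_cast hP0
  set R := (Finset.Ioc 0 P).filter (fun r => p ^ l ∣ r) with hR
  -- number of terms in class r
  let K : ℕ → ℕ := fun r => if (r : ℝ) ≤ B * ff p Q r then ⌊(B * ff p Q r - r) / P⌋₊ + 1 else 0
  have hsub : Psi p l Q B ⊆ R.biUnion fun r => (Finset.range (K r)).image (fun k => r + k * P) := by
    intro b hb
    rw [mem_Psi hp hQ hB] at hb
    obtain ⟨hb0, hbp, hbB⟩ := hb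
    rw [Finset.mem_biUnion]
    obtain ⟨r, hr⟩ : ∃ r, r = (b - 1) % P + 1 := ⟨_, rfl⟩
    obtain ⟨k, hk⟩ : ∃ k, k = (b - 1) / P := ⟨_, rfl⟩
    have hmod := Nat.mod_lt (b - 1) hP0
    have hdm := Nat.mod_add_div (b - 1) P
    have hbrk : b = r + k * P := by
      rw [hr, hk, mul_comm]; omega
    have hff : ff p Q b = ff p Q r := by rw [hbrk, hP, ff_period]
    have hbr : (b : ℝ) = r + k * P := by rw [hbrk]; push_cast; ring
    refine ⟨r, ?_, ?_⟩
    · rw [hR, Finset.mem_filter, Finset.mem_Ioc]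
      refine ⟨by omega, ?_⟩
      rw [hbrk] at hbp
      exact (Nat.dvd_add_left (Dvd.dvd.mul_left (Dvd.intro _ rfl) k)).mp hbp
    · rw [Finset.mem_image]
      refine ⟨k, ?_, hbrk.symm⟩
      rw [hff, hbr] at hbB
      have hkP : (0 : ℝ) ≤ k * P := by positivity
      have hle : (r : ℝ) ≤ B * ff p Q r := by linarith
      rw [Finset.mem_range]
      simp only [K, if_pos hle]
      refine Nat.lt_succ_of_le (Nat.le_floor ?_)
      rw [le_div_iff₀ hP0']; linarith
  refine (Finset.sum_le_sum_of_subset_of_nonneg hsub fun b _ _ => div_nonneg (Nat.cast_nonneg b) (by linarith [one_le_ff hp hQ b])).trans ?_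
  have hper : ∀ r ∈ R, ∑ b ∈ (Finset.range (K r)).image (fun k => r + k * P), (b : ℝ) / ff p Q b ≤ B ^ 2 * ff p Q r / (2 * P) + B + P := by
    intro r hr
    have hf := one_le_ff hp hQ r
    have hf0 : (0 : ℝ) < ff p Q r := by linarith
    have h1 : ∑ b ∈ (Finset.range (K r)).image (fun k => r + k * P), (b : ℝ) / ff p Q b ≤ ∑ k ∈ Finset.range (K r), ((r + k * P : ℕ) : ℝ) / ff p Q r := by
      rw [Finset.sum_image]
      · refine Finset.sum_le_sum fun k _ => ?_
        rw [hP, ff_period]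
      · intro k _ k' _ h
        simp only at h
        exact Nat.eq_of_mul_eq_mul_right hP0 (by omega)
    refine h1.trans ?_
    rw [← Finset.sum_div]
    have h2 := arith_sum r P (K r) hP0
    have h3 : ∑ k ∈ Finset.range (K r), ((r + k * P : ℕ) : ℝ) ≤ (B * ff p Q r + P) ^ 2 / (2 * P) := by
      by_cases hle : (r : ℝ) ≤ B * ff p Q r
      · refine h2.trans ?_
        have hK : (K r : ℝ) = ⌊(B * ff p Q r - r) / P⌋₊ + 1 := by simp only [K, if_pos hle]; push_cast; ring
        have h4 : (⌊(B * ff p Q r - r) / P⌋₊ : ℝ) * P ≤ B * ff p Q r - r := by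
          rw [← le_div_iff₀ hP0']
          exact Nat.floor_le (div_nonneg (by linarith) hP0'.le)
        have h5 : (r : ℝ) + K r * P ≤ B * ff p Q r + P := by rw [hK]; linarith
        have h6 : ((r : ℝ) + K r * P) ^ 2 ≤ (B * ff p Q r + P) ^ 2 := pow_le_pow_left₀ (by positivity) h5 2
        refine div_le_div_of_nonneg_right ?_ (by positivity)
        nlinarith [sq_nonneg (r : ℝ)]
      · have : K r = 0 := by simp only [K, if_neg hle]
        rw [this]; simp; positivity
    rw [div_le_iff₀ hf0]
    refine h3.trans ?_
    rw [div_le_iff₀ (by positivity)]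
    have e : (B ^ 2 * ff p Q r / (2 * P) + B + P) * ff p Q r * (2 * P) = B ^ 2 * ff p Q r ^ 2 + 2 * P * B * ff p Q r + 2 * P ^ 2 * ff p Q r := by
      field_simp
    rw [e]
    nlinarith [sq_nonneg (P : ℝ)]
  refine (sum_biUnion_le' _ _ _ fun b => div_nonneg (Nat.cast_nonneg b) (by linarith [one_le_ff hp hQ b])).trans ?_
  refine (Finset.sum_le_sum hper).trans ?_
  have h5 : (R.card : ℝ) ≤ P := card_R_le p l Q
  have h4 : ∑ r ∈ R, (B ^ 2 * ff p Q r / (2 * P) + B + P) = Cq p l Q * B ^ 2 / 2 + R.card * (B + P) := by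
    rw [Finset.sum_add_distrib, Finset.sum_add_distrib, ← Finset.sum_div, ← Finset.mul_sum, hR, hP, sum_ff l hp hQ hpQ, ← hP]
    simp only [Finset.sum_const, nsmul_eq_mul]
    field_simp
    ring
  rw [h4]
  have h6 : (R.card : ℝ) * (B + P) ≤ P * (B + P) := mul_le_mul_of_nonneg_right h5 (by positivity)
  nlinarith
end PZ

namespace PZ

lemma totient_le {p : ℕ} (hp : p.Prime) {Q : Finset ℕ} (hQ : ∀ q ∈ Q, q.Prime) (hpQ : p ∉ Q) {b : ℕ} (hb : b ≠ 0) (hpb : p ∣ b) :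
    (b.totient : ℝ) ≤ b / ff p Q b := by
  classical
  have h1 : (b.totient : ℝ) = b * ∏ q ∈ b.primeFactors, (1 - (q : ℝ)⁻¹) := by
    have := Nat.totient_eq_mul_prod_factors b
    have h2 := congrArg (fun x : ℚ => (x : ℝ)) this
    push_cast at h2
    exact h2
  have hnot : p ∉ Q.filter (fun q => q ∣ b) := fun h => hpQ (Finset.mem_filter.mp h).1
  have hpr : ∀ q ∈ insert p (Q.filter (fun q => q ∣ b)), q.Prime := by
    intro q hq
    rw [Finset.mem_insert] at hq
    rcases hq with rfl | hq
    · exact hp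
    · exact hQ q (Finset.mem_filter.mp hq).1
  have h3 : (ff p Q b)⁻¹ = ∏ q ∈ insert p (Q.filter (fun q => q ∣ b)), (1 - (q : ℝ)⁻¹) := by
    rw [ff, ← Finset.prod_insert (f := fun q : ℕ => (q : ℝ) / ((q : ℝ) - 1)) hnot, ← Finset.prod_inv_distrib]
    refine Finset.prod_congr rfl fun q hq => ?_
    have : (1 : ℝ) < q := by exact_mod_cast (hpr q hq).one_lt
    rw [inv_div, sub_div, div_self (by linarith), one_div]
  rw [h1, div_eq_mul_inv, h3]
  refine mul_le_mul_of_nonneg_left ?_ (Nat.cast_nonneg b)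
  refine Finset.prod_le_prod_of_subset_of_le_one ?_ ?_ ?_
  · intro q hq
    rw [Nat.mem_primeFactors]
    refine ⟨hpr q hq, ?_, hb⟩
    rw [Finset.mem_insert] at hq
    rcases hq with rfl | hq
    · exact hpb
    · exact (Finset.mem_filter.mp hq).2
  · intro q hq
    have : (1 : ℝ) < q := by exact_mod_cast (Nat.prime_of_mem_primeFactors hq).one_lt
    have := inv_le_one_of_one_le₀ this.le
    linarith
  · intro q hq _
    have : (0 : ℝ) ≤ (q : ℝ)⁻¹ := by positivity
    linarith

lemma ff_mul_le {p : ℕ} (hp : p.Prime) {Q : Finset ℕ} (hQ : ∀ q ∈ Q, q.Prime) (b g : ℕ) (hg : 0 < g) :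
    ff p Q (b * g) ≤ ff p Q b * g := by
  classical
  have hsub : Q.filter (fun q => q ∣ b) ⊆ Q.filter (fun q => q ∣ b * g) := by
    intro q hq
    rw [Finset.mem_filter] at hq ⊢
    exact ⟨hq.1, hq.2.mul_right g⟩
  unfold ff
  rw [mul_assoc]
  refine mul_le_mul_of_nonneg_left ?_ (by linarith [one_le_ratio hp])
  rw [← Finset.prod_sdiff hsub, mul_comm]
  refine mul_le_mul_of_nonneg_left ?_ (Finset.prod_nonneg fun q hq => by linarith [one_le_ratio (hQ q (Finset.mem_filter.mp hq).1)])
  set T := Q.filter (fun q => q ∣ b * g) \ Q.filter (fun q => q ∣ b) with hT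
  have hTp : ∀ q ∈ T, q.Prime ∧ q ∣ g := by
    intro q hq
    rw [hT, Finset.mem_sdiff, Finset.mem_filter, Finset.mem_filter] at hq
    have hqp := hQ q hq.1.1
    refine ⟨hqp, (hqp.dvd_mul.mp hq.1.2).resolve_left fun h => hq.2 ⟨hq.1.1, h⟩⟩
  have h1 : ∏ q ∈ T, ((q : ℝ) / ((q : ℝ) - 1)) ≤ ∏ q ∈ T, (q : ℝ) := by
    refine Finset.prod_le_prod (fun q hq => by linarith [one_le_ratio (hTp q hq).1]) fun q hq => ?_
    have : (2 : ℝ) ≤ q := by exact_mod_cast (hTp q hq).1.two_le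
    exact div_le_self (by linarith) (by linarith)
  refine h1.trans ?_
  have h2 : ∏ q ∈ T, q ∣ g := Finset.prod_primes_dvd g (fun q hq => (hTp q hq).1.prime) fun q hq => (hTp q hq).2
  rw [← Nat.cast_prod]
  exact Nat.cast_le.mpr (Nat.le_of_dvd hg h2)

lemma Psi_closed {p l : ℕ} (hp : p.Prime) {Q : Finset ℕ} (hQ : ∀ q ∈ Q, q.Prime) {B : ℝ} (hB : 0 ≤ B) {b g : ℕ}
    (hb : b * g ∈ Psi p l Q B) (hg : ¬ p ∣ g) : b ∈ Psi p l Q B := by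
  rw [mem_Psi hp hQ hB] at hb ⊢
  obtain ⟨h0, h1, h2⟩ := hb
  have hg0 : 0 < g := Nat.pos_of_mul_pos_left h0
  refine ⟨Nat.pos_of_mul_pos_right h0, ?_, ?_⟩
  · exact (Nat.Coprime.pow_left l ((Nat.Prime.coprime_iff_not_dvd hp).mpr hg)).dvd_of_dvd_mul_right h1
  · have h3 := ff_mul_le hp hQ b g hg0
    have h4 : (b : ℝ) * g ≤ B * ff p Q b * g := by
      push_cast at h2
      rw [mul_assoc]
      exact h2.trans (mul_le_mul_of_nonneg_left h3 hB)
    exact le_of_mul_le_mul_right h4 (by exact_mod_cast hg0)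

lemma FF_card_le {p l : ℕ} (hp : p.Prime) {Q : Finset ℕ} (hQ : ∀ q ∈ Q, q.Prime) {B : ℝ} (hB : 0 ≤ B) :
    (FF p (Psi p l Q B)).card ≤ ∑ b ∈ Psi p l Q B, b.totient := by
  classical
  haveI := Fact.mk hp
  have hsub : FF p (Psi p l Q B) ⊆ (Psi p l Q B).biUnion fun b => ((Finset.range b).filter (fun a => b.Coprime a)).image fun a : ℕ => (a : ℚ) / b := by
    intro x hx
    rw [mem_FF] at hx
    obtain ⟨b, hb, a, ha, rfl⟩ := hx
    obtain ⟨ha0, hab, hpa⟩ := idx_pos ha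
    obtain ⟨g, a', b', hg, hcop, hag, hbg⟩ := Nat.exists_coprime' (m := a) (n := b) (Nat.gcd_pos_of_pos_left _ ha0)
    have hb' : b' ∈ Psi p l Q B := by
      refine Psi_closed (g := g) hp hQ hB (hbg ▸ hb) fun h => hpa ?_
      rw [hag]; exact h.mul_left _
    rw [Finset.mem_biUnion]
    refine ⟨b', hb', ?_⟩
    rw [Finset.mem_image]
    refine ⟨a', ?_, ?_⟩
    · rw [Finset.mem_filter, Finset.mem_range]
      refine ⟨?_, hcop.symm⟩
      rw [hag, hbg] at hab
      exact lt_of_mul_lt_mul_right hab (Nat.zero_le g)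
    · rw [hag, hbg]
      push_cast
      have : (g : ℚ) ≠ 0 := by exact_mod_cast hg.ne'
      exact (mul_div_mul_right _ _ this).symm
  refine (Finset.card_le_card hsub).trans (Finset.card_biUnion_le.trans ?_)
  refine Finset.sum_le_sum fun b _ => Finset.card_image_le.trans ?_
  rw [Nat.totient]

lemma FF_card_ub {p l : ℕ} (hl : 1 ≤ l) (hp : p.Prime) {Q : Finset ℕ} (hQ : ∀ q ∈ Q, q.Prime) (hpQ : p ∉ Q) {B : ℝ} (hB : 0 ≤ B) :
    ((FF p (Psi p l Q B)).card : ℝ) ≤ Cq p l Q * B ^ 2 / 2 + PQ p l Q * B + (PQ p l Q : ℝ) ^ 2 := by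
  refine le_trans ?_ (Psi_sum_ub hp hQ hpQ hB)
  have h : ((FF p (Psi p l Q B)).card : ℝ) ≤ ∑ b ∈ Psi p l Q B, (b.totient : ℝ) := by
    exact_mod_cast FF_card_le hp hQ hB
  refine h.trans (Finset.sum_le_sum fun b hb => ?_)
  rw [mem_Psi hp hQ hB] at hb
  exact totient_le hp hQ hpQ hb.1.ne' ((dvd_pow_self p (by omega)).trans hb.2.1)

lemma omega_bound (δ : ℝ) (hδ : 0 < δ) : ∃ c : ℝ, 0 ≤ c ∧ ∀ b : ℕ, b ≠ 0 →
    Real.log b + ∑ q ∈ b.primeFactors, Real.log q / ((q : ℝ) - 1) ≤ (1 + δ) * Real.log b + c := by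
  classical
  obtain ⟨N, hN⟩ := exists_nat_ge (1 / δ + 1)
  have hnn : ∀ q : ℕ, 0 ≤ Real.log q := fun q => Real.log_natCast_nonneg q
  refine ⟨∑ q ∈ Finset.range N, Real.log q, Finset.sum_nonneg fun q _ => hnn q, fun b hb => ?_⟩
  have h1 : ∀ q ∈ b.primeFactors, Real.log q / ((q : ℝ) - 1) ≤ δ * Real.log q + (if q < N then Real.log q else 0) := by
    intro q hq
    have hq2 : (2 : ℝ) ≤ q := by exact_mod_cast (Nat.prime_of_mem_primeFactors hq).two_le
    have hlq := hnn q
    split_ifs with h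
    · have : Real.log q / ((q : ℝ) - 1) ≤ Real.log q := div_le_self hlq (by linarith)
      have : 0 ≤ δ * Real.log q := by positivity
      linarith
    · have hNq : (N : ℝ) ≤ q := by exact_mod_cast (not_lt.mp h)
      rw [add_zero, div_le_iff₀ (by linarith)]
      have h3 : 1 / δ ≤ (q : ℝ) - 1 := by linarith
      rw [div_le_iff₀ hδ] at h3
      nlinarith
  have h2 := Finset.sum_le_sum h1
  rw [Finset.sum_add_distrib, ← Finset.mul_sum, ← Finset.sum_filter] at h2
  have h3 : ∑ q ∈ b.primeFactors, Real.log q ≤ Real.log b := by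
    rw [← Real.log_prod (fun q hq => by exact_mod_cast (Nat.prime_of_mem_primeFactors hq).ne_zero)]
    refine Real.log_le_log (Finset.prod_pos fun q hq => by exact_mod_cast (Nat.prime_of_mem_primeFactors hq).pos) ?_
    rw [← Nat.cast_prod]
    exact Nat.cast_le.mpr (Nat.le_of_dvd (Nat.pos_of_ne_zero hb) (Nat.prod_primeFactors_dvd b))
  have h4 : ∑ q ∈ b.primeFactors with q < N, Real.log q ≤ ∑ q ∈ Finset.range N, Real.log q := by
    refine Finset.sum_le_sum_of_subset_of_nonneg ?_ fun q _ _ => hnn q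
    intro q hq
    rw [Finset.mem_filter] at hq
    exact Finset.mem_range.mpr hq.2
  nlinarith [mul_le_mul_of_nonneg_left h3 hδ.le]
end PZ

namespace PZ

/-- n ↦ n^(-k) as a monoid hom -/
noncomputable def invPow (k : ℕ) (hk : k ≠ 0) : ℕ →*₀ ℝ where
  toFun n := ((n : ℝ) ^ k)⁻¹
  map_zero' := by simp [hk]
  map_one' := by simp
  map_mul' a b := by push_cast; rw [mul_pow, mul_inv]

lemma zeta_euler (k : ℕ) (hk : 1 < k) :
    Tendsto (fun n => ∏ q ∈ Nat.primesBelow n, (1 - ((q : ℝ) ^ k)⁻¹)⁻¹) atTop (nhds (∑' n : ℕ, 1 / ((n : ℝ) + 1) ^ k)) := by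
  have hs : Summable fun n : ℕ => ((n : ℝ) ^ k)⁻¹ := by
    simpa using Real.summable_one_div_nat_pow.mpr hk
  have h := EulerProduct.eulerProduct_completely_multiplicative (f := invPow k (by omega)) (by
    refine hs.congr fun n => ?_
    show _ = ‖((n : ℝ) ^ k)⁻¹‖
    rw [Real.norm_of_nonneg (by positivity)])
  have e : ∑' n : ℕ, (invPow k (by omega)) n = ∑' n : ℕ, 1 / ((n : ℝ) + 1) ^ k := by
    show ∑' n : ℕ, ((n : ℝ) ^ k)⁻¹ = _
    rw [hs.tsum_eq_zero_add]
    simp [show k ≠ 0 by omega]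
  rw [e] at h
  exact h

lemma zeta_pos (k : ℕ) (hk : 1 < k) : 0 < ∑' n : ℕ, 1 / ((n : ℝ) + 1) ^ k := by
  have hs : Summable fun n : ℕ => 1 / ((n : ℝ) + 1) ^ k := by
    have := (summable_nat_add_iff 1).mpr (Real.summable_one_div_nat_pow.mpr hk)
    simpa using this
  exact hs.tsum_pos (fun n => by positivity) 0 (by simp)

/-- the limiting density -/
noncomputable def Cinf (p l : ℕ) : ℝ := zetaR 2 * zetaR 3 / zetaR 6 / ((p : ℝ) ^ ((l : ℤ) - 2) * ((p : ℝ) ^ 2 - (p : ℝ) + 1))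

lemma zetaR_eq (k : ℕ) : zetaR k = ∑' n : ℕ, 1 / ((n : ℝ) + 1) ^ k := by
  simp [zetaR]

lemma Cq_tendsto {p : ℕ} (l : ℕ) (hp : p.Prime) :
    Tendsto (fun n => Cq p l ((Nat.primesBelow n).erase p)) atTop (nhds (Cinf p l)) := by
  have h2 := zeta_euler 2 (by norm_num)
  have h3 := zeta_euler 3 (by norm_num)
  have h6 := zeta_euler 6 (by norm_num)
  have hz6 := zeta_pos 6 (by norm_num)
  have h := ((h2.mul h3).div h6 hz6.ne').div_const ((p : ℝ) ^ ((l : ℤ) - 2) * ((p : ℝ) ^ 2 - (p : ℝ) + 1))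
  refine Tendsto.congr' ?_ h
  filter_upwards [eventually_gt_atTop p] with n hn
  have hpn : p ∈ Nat.primesBelow n := Nat.mem_primesBelow.mpr ⟨hn, hp⟩
  have key : ∀ q ∈ Nat.primesBelow n, (1 - ((q : ℝ) ^ 2)⁻¹)⁻¹ * (1 - ((q : ℝ) ^ 3)⁻¹)⁻¹ / (1 - ((q : ℝ) ^ 6)⁻¹)⁻¹
      = 1 + 1 / ((q : ℝ) * ((q : ℝ) - 1)) := by
    intro q hq
    have hq1 : (1 : ℝ) < q := by exact_mod_cast (Nat.prime_of_mem_primesBelow hq).one_lt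
    generalize (q : ℝ) = x at hq1
    have hx : x ≠ 0 := by linarith
    have e1 : x - 1 ≠ 0 := by linarith
    have e2 : x ^ 2 - 1 ≠ 0 := by nlinarith
    have e3 : x ^ 3 - 1 ≠ 0 := by nlinarith [mul_pos (sub_pos.mpr hq1) (by nlinarith : 0 < x ^ 2 + x + 1)]
    have e2' : 1 - (x ^ 2)⁻¹ = (x ^ 2 - 1) / x ^ 2 := by field_simp
    have e3' : 1 - (x ^ 3)⁻¹ = (x ^ 3 - 1) / x ^ 3 := by field_simp
    have e6' : 1 - (x ^ 6)⁻¹ = (x ^ 3 - 1) * (x ^ 3 + 1) / x ^ 6 := by field_simp; ring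
    have e4 : x ^ 3 + 1 ≠ 0 := by positivity
    rw [e2', e3', e6']
    field_simp
    ring
  simp only [Pi.div_apply]
  rw [← Finset.prod_mul_distrib, ← Finset.prod_div_distrib, Finset.prod_congr rfl key, ← Finset.mul_prod_erase _ _ hpn, Cq]
  have hp1 : (1 : ℝ) < p := by exact_mod_cast hp.one_lt
  generalize ∏ q ∈ (Nat.primesBelow n).erase p, (1 + 1 / ((q : ℝ) * ((q : ℝ) - 1))) = Z
  generalize (p : ℝ) = x at hp1
  have hx : x ≠ 0 := by linarith
  have e1 : x - 1 ≠ 0 := by linarith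
  have e2 : x ^ 2 - x + 1 ≠ 0 := by nlinarith
  have e3 : x * (x - 1) + 1 ≠ 0 := by nlinarith
  rw [zpow_sub₀ hx, zpow_natCast]
  have hl : x ^ l ≠ 0 := pow_ne_zero _ hx
  norm_cast
  generalize x ^ l = w at hl
  field_simp

lemma Cinf_pos {p : ℕ} (l : ℕ) (hp : p.Prime) : 0 < Cinf p l := by
  have h2 := zeta_pos 2 (by norm_num)
  have h3 := zeta_pos 3 (by norm_num)
  have h6 := zeta_pos 6 (by norm_num)
  have hp1 : (1 : ℝ) < p := by exact_mod_cast hp.one_lt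
  have e2 : 0 < (p : ℝ) ^ 2 - p + 1 := by nlinarith
  have e3 : 0 < (p : ℝ) ^ ((l : ℤ) - 2) := zpow_pos (by linarith) _
  exact div_pos (div_pos (mul_pos h2 h3) h6) (mul_pos e3 e2)

lemma Cq_pos {p : ℕ} (l : ℕ) (hp : p.Prime) {Q : Finset ℕ} (hQ : ∀ q ∈ Q, q.Prime) : 0 < Cq p l Q := by
  have hp1 : (1 : ℝ) < p := by exact_mod_cast hp.one_lt
  refine mul_pos (by positivity) (mul_pos (div_pos (by linarith) (by linarith)) (Finset.prod_pos fun q hq => ?_))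
  have hq1 : (1 : ℝ) < q := by exact_mod_cast (hQ q hq).one_lt
  have : 0 < (q : ℝ) * ((q : ℝ) - 1) := mul_pos (by linarith) (by linarith)
  positivity

/-- the gain -/
noncomputable def Ap (p : ℕ) : ℝ := ((ellp p : ℝ) + 1 / ((p : ℝ) - 1)) * Real.log p - 1 - Real.log 2

lemma one_le_ellp (p : ℕ) : 1 ≤ ellp p := by unfold ellp; split_ifs <;> norm_num

lemma Ap_pos {p : ℕ} (hp : p.Prime) : 0 < Ap p := by
  have hl2 := Real.log_two_gt_d9
  have hl2' := Real.log_two_lt_d9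
  unfold Ap ellp
  by_cases h5 : 5 ≤ p
  · rw [if_pos h5]
    have h5' : (5 : ℝ) ≤ p := by exact_mod_cast h5
    by_cases h6 : p = 5
    · subst h6
      have : Real.log 4 ≤ Real.log 5 := Real.log_le_log (by norm_num) (by norm_num)
      rw [show (4 : ℝ) = 2 ^ 2 by norm_num, Real.log_pow] at this
      push_cast at this ⊢
      norm_num
      linarith
    · have h6' : (6 : ℝ) ≤ p := by exact_mod_cast (by omega : 6 ≤ p)
      have h7 : Real.log 6 ≤ Real.log p := Real.log_le_log (by norm_num) h6'
      rw [show (6 : ℝ) = 2 * 3 by norm_num, Real.log_mul (by norm_num) (by norm_num)] at h7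
      have h3 : 1 < Real.log 3 := by
        rw [Real.lt_log_iff_exp_lt (by norm_num)]
        linarith [Real.exp_one_lt_d9]
      have h8 : 0 ≤ 1 / ((p : ℝ) - 1) * Real.log p := mul_nonneg (one_div_nonneg.mpr (by linarith)) (by linarith)
      push_cast
      linarith
  · rw [if_neg h5]
    by_cases h3 : p = 3
    · subst h3
      have h3 : 1 < Real.log 3 := by
        rw [Real.lt_log_iff_exp_lt (by norm_num)]
        linarith [Real.exp_one_lt_d9]
      norm_num
      linarith
    · have h2 : p = 2 := by
        have := hp.two_le
        interval_cases p
        · rfl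
        · exact absurd rfl h3
        · exact absurd hp (by norm_num)
      subst h2
      norm_num
      linarith

lemma cp_eq (p : ℕ) : cp p = Real.sqrt (4 * Ap p * Cinf p (ellp p)) := by
  unfold cp Ap Cinf
  congr 1
  ring
end PZ

namespace PZ

lemma x_tendsto : Tendsto (fun s : ℕ => Real.sqrt ((s : ℝ) / Real.log s)) atTop atTop := by
  refine Real.tendsto_sqrt_atTop.comp ?_
  have h : Tendsto (fun x : ℝ => x / Real.log x) atTop atTop := by
    have h1 : Tendsto (fun x : ℝ => Real.exp x / x ^ 1) atTop atTop := Real.tendsto_exp_div_pow_atTop 1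
    have h2 := h1.comp Real.tendsto_log_atTop
    refine h2.congr' ?_
    filter_upwards [eventually_gt_atTop 0] with x hx
    simp [Real.exp_log hx]
  exact h.comp tendsto_natCast_atTop_atTop

lemma asymp (C A P f0 c δ L η : ℝ) (hC : 0 < C) (hA : 0 < A) (hf0 : 1 ≤ f0) (hδ : 0 < δ) (hη : 0 < η) :
    ∃ S : ℕ, ∀ s : ℕ, S ≤ s → ∃ B : ℝ, 0 < B ∧ 1 ≤ s ∧
      2 * (C * B ^ 2 / 2 + P * B + P ^ 2) ≤ s ∧
      0 ≤ (1 + δ) * Real.log (B * f0) + c + 1 + L ∧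
      (C * B ^ 2 / 2 + P * B + P ^ 2) * ((1 + δ) * Real.log (B * f0) + c + 1 + L) < s * A ∧
      (Real.sqrt (4 * A * C / (1 + δ) ^ 4) - η) * Real.sqrt ((s : ℝ) / Real.log s) ≤ C * B - P := by
  rw [← eventually_atTop]
  set β := Real.sqrt (4 * A / (C * (1 + δ) ^ 4)) with hβ
  have hβ0 : 0 < β := Real.sqrt_pos.mpr (by positivity)
  have hβ2 : β ^ 2 = 4 * A / (C * (1 + δ) ^ 4) := Real.sq_sqrt (by positivity)
  have hCβ : Real.sqrt (4 * A * C / (1 + δ) ^ 4) = C * β := by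
    rw [show 4 * A * C / (1 + δ) ^ 4 = C ^ 2 * (4 * A / (C * (1 + δ) ^ 4)) by field_simp,
      Real.sqrt_mul (by positivity), Real.sqrt_sq hC.le]
  have hBt : Tendsto (fun s : ℕ => β * Real.sqrt ((s : ℝ) / Real.log s)) atTop atTop :=
    x_tendsto.const_mul_atTop hβ0
  have hlogs : Tendsto (fun s : ℕ => Real.log s) atTop atTop := Real.tendsto_log_atTop.comp tendsto_natCast_atTop_atTop
  -- facts in B
  have e1 : ∀ᶠ B : ℝ in atTop, P * B + P ^ 2 ≤ C / 2 * δ * B ^ 2 := by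
    filter_upwards [eventually_ge_atTop 1, eventually_ge_atTop ((|P| + P ^ 2) / (C / 2 * δ))] with B h1 h2
    rw [div_le_iff₀ (by positivity)] at h2
    have h3 : P * B ≤ |P| * B := mul_le_mul_of_nonneg_right (le_abs_self P) (by linarith)
    have h4 : P ^ 2 ≤ P ^ 2 * B := le_mul_of_one_le_right (sq_nonneg P) h1
    nlinarith
  have e2 : ∀ᶠ B : ℝ in atTop, 0 < B ∧ 0 ≤ (1 + δ) * Real.log (B * f0) + c + 1 + L ∧
      (1 + δ) * Real.log (B * f0) + c + 1 + L ≤ (1 + 2 * δ) * Real.log B ∧ 0 ≤ Real.log B := by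
    filter_upwards [eventually_gt_atTop 0, Real.tendsto_log_atTop.eventually_ge_atTop 0,
      Real.tendsto_log_atTop.eventually_ge_atTop (((1 + δ) * Real.log f0 + c + 1 + L) / δ),
      Real.tendsto_log_atTop.eventually_ge_atTop (-((1 + δ) * Real.log f0 + c + 1 + L) / (1 + δ))] with B h1 h2 h3 h4
    rw [div_le_iff₀ (by positivity)] at h3 h4
    rw [Real.log_mul h1.ne' (by linarith)]
    refine ⟨h1, by nlinarith, by nlinarith, h2⟩
  filter_upwards [hBt.eventually e1, hBt.eventually e2, hlogs.eventually_ge_atTop (β ^ 2), hlogs.eventually_gt_atTop 0,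
    hlogs.eventually_ge_atTop (C * (1 + δ) * β ^ 2), eventually_ge_atTop 1, x_tendsto.eventually_ge_atTop (P / η)]
    with s h1 h2 h3 h4 h5 h6 h7
  obtain ⟨hB0, h2a, h2b, h2c⟩ := h2
  have hs0 : (1 : ℝ) ≤ s := by exact_mod_cast h6
  have hx2 : Real.sqrt ((s : ℝ) / Real.log s) ^ 2 = s / Real.log s := Real.sq_sqrt (by positivity)
  generalize Real.sqrt ((s : ℝ) / Real.log s) = x at *
  set B := β * x with hB
  have hB2 : B ^ 2 * Real.log s = β ^ 2 * s := by
    rw [hB, mul_pow, hx2]; field_simp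
  have hlB : Real.log B ≤ Real.log s / 2 := by
    have : Real.log (B ^ 2) ≤ Real.log s := by
      refine Real.log_le_log (by positivity) ?_
      refine le_of_mul_le_mul_right ?_ h4
      rw [hB2]
      nlinarith
    rw [Real.log_pow] at this
    push_cast at this
    linarith
  have hF : C * B ^ 2 / 2 + P * B + P ^ 2 ≤ C / 2 * (1 + δ) * B ^ 2 := by nlinarith
  refine ⟨B, hB0, h6, ?_, h2a, ?_, ?_⟩
  · have : C * (1 + δ) * B ^ 2 ≤ s := by
      refine le_of_mul_le_mul_right ?_ h4
      rw [mul_assoc, hB2]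
      nlinarith
    linarith
  · have hW : (1 + δ) * Real.log (B * f0) + c + 1 + L ≤ (1 + 2 * δ) * (Real.log s / 2) :=
      h2b.trans (mul_le_mul_of_nonneg_left hlB (by positivity))
    have h8 : (C * B ^ 2 / 2 + P * B + P ^ 2) * ((1 + δ) * Real.log (B * f0) + c + 1 + L) ≤
        (C / 2 * (1 + δ) * B ^ 2) * ((1 + 2 * δ) * (Real.log s / 2)) := by
      refine (mul_le_mul_of_nonneg_right hF h2a).trans (mul_le_mul_of_nonneg_left hW (by positivity))
    refine h8.trans_lt ?_
    have h9 : (C / 2 * (1 + δ) * B ^ 2) * ((1 + 2 * δ) * (Real.log s / 2)) = s * A * ((1 + 2 * δ) / (1 + δ) ^ 3) := by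
      rw [show (C / 2 * (1 + δ) * B ^ 2) * ((1 + 2 * δ) * (Real.log s / 2)) = C / 4 * (1 + δ) * (1 + 2 * δ) * (B ^ 2 * Real.log s) by ring, hB2, hβ2]
      field_simp
    rw [h9]
    have h10 : (1 + 2 * δ) / (1 + δ) ^ 3 < 1 := by
      rw [div_lt_one (by positivity)]
      nlinarith [pow_pos hδ 3, pow_pos hδ 2]
    exact mul_lt_of_lt_one_right (by positivity) h10
  · rw [hCβ]
    rw [div_le_iff₀ hη] at h7
    rw [hB]; linarith

lemma main (p : ℕ) [hpf : Fact p.Prime] (ε : ℝ) (hε : 0 < ε) : ∃ S : ℕ, ∀ s : ℕ, Odd s → S ≤ s →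
    (cp p - ε) * Real.sqrt ((s : ℝ) / Real.log s) ≤ (Nat.card {j : ℕ | Odd j ∧ 3 ≤ j ∧ j ≤ s ∧ ZetaPIrrational p j} : ℝ) := by
  have hp := hpf.out
  have hA := Ap_pos hp
  have hC := Cinf_pos (ellp p) hp
  -- choose y
  have hlim : Tendsto (fun n : ℕ => Real.sqrt (4 * Ap p * Cq p (ellp p) ((Nat.primesBelow n).erase p) / (1 + 1 / ((n : ℝ) + 1)) ^ 4)) atTop (nhds (cp p)) := by
    have h1 := ((Cq_tendsto (ellp p) hp).const_mul (4 * Ap p)).div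
      (((tendsto_one_div_add_atTop_nhds_zero_nat (𝕜 := ℝ)).const_add 1).pow 4) (by norm_num)
    have h2 := (Real.continuous_sqrt.tendsto _).comp h1
    rw [cp_eq]
    simpa [Function.comp_def] using h2
  obtain ⟨y, hy⟩ := (hlim.eventually (lt_mem_nhds (show cp p - ε / 2 < cp p by linarith))).exists
  set Q := (Nat.primesBelow y).erase p with hQdef
  have hQ : ∀ q ∈ Q, q.Prime := fun q hq => Nat.prime_of_mem_primesBelow (Finset.mem_of_mem_erase hq)
  have hpQ : p ∉ Q := Finset.notMem_erase p _
  set δ : ℝ := 1 / ((y : ℝ) + 1) with hδdef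
  have hδ : 0 < δ := by positivity
  clear_value Q δ
  obtain ⟨c, hc0, hc⟩ := omega_bound δ hδ
  obtain ⟨S, hS⟩ := asymp (Cq p (ellp p) Q) (Ap p) (PQ p (ellp p) Q) (ff p Q 0) c δ (ellp p * Real.log p) (ε / 2)
    (Cq_pos _ hp hQ) hA (one_le_ff hp hQ 0) hδ (by linarith)
  refine ⟨S, fun s _ hs => ?_⟩
  obtain ⟨B, hB0, hs1, hF, hW0, hcost, hfin⟩ := hS s hs
  have hFc := FF_card_ub (one_le_ellp p) hp hQ hpQ hB0.le
  have hcore := core (p := p) (one_le_ellp p) (Ψ := Psi p (ellp p) Q B) (fun b hb => by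
      rw [mem_Psi hp hQ hB0.le] at hb
      exact ⟨hb.1.ne', hb.2.1⟩) s (by
      have : (2 : ℝ) * ((FF p (Psi p (ellp p) Q B)).card : ℝ) ≤ s := by linarith
      exact_mod_cast this) hs1 ((1 + δ) * Real.log (B * ff p Q 0) + c) (fun b hb => by
      rw [mem_Psi hp hQ hB0.le] at hb
      refine (hc b hb.1.ne').trans ?_
      have h1 : (b : ℝ) ≤ B * ff p Q 0 := hb.2.2.trans (mul_le_mul_of_nonneg_left (ff_le_zero hp hQ b) hB0.le)
      have h2 : Real.log b ≤ Real.log (B * ff p Q 0) := Real.log_le_log (by exact_mod_cast hb.1) h1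
      have := mul_le_mul_of_nonneg_left h2 (by linarith : 0 ≤ 1 + δ)
      linarith) (lt_of_le_of_lt (mul_le_mul_of_nonneg_right hFc hW0) hcost)
  have h3 := Psi_card_lb (l := ellp p) hp hQ hpQ hB0.le
  have h4 : ((Psi p (ellp p) Q B).card : ℝ) ≤ (Nat.card {j : ℕ | Odd j ∧ 3 ≤ j ∧ j ≤ s ∧ ZetaPIrrational p j} : ℝ) := by
    exact_mod_cast hcore
  have h5 : (cp p - ε) * Real.sqrt ((s : ℝ) / Real.log s) ≤
      (Real.sqrt (4 * Ap p * Cq p (ellp p) Q / (1 + δ) ^ 4) - ε / 2) * Real.sqrt ((s : ℝ) / Real.log s) :=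
    mul_le_mul_of_nonneg_right (by linarith) (Real.sqrt_nonneg _)
  linarith
end PZ

/-- Theorem A: for any `ε > 0` and all sufficiently large odd
integers `s`, at least `(c_p - ε)√(s/log s)` of the `p`-adic zeta values
`ζ_p(3), ζ_p(5), …, ζ_p(s)` are irrational. -/
theorem many_padic_odd_zeta_values_irrational
    (p : ℕ) [Fact p.Prime] (ε : ℝ) (hε : 0 < ε) :
    ∃ S : ℕ, ∀ s : ℕ, Odd s → S ≤ s →
      (cp p - ε) * Real.sqrt ((s : ℝ) / Real.log s) ≤
        (Nat.card {j : ℕ | Odd j ∧ 3 ≤ j ∧ j ≤ s ∧ ZetaPIrrational p j} : ℝ) := by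
  exact PZ.main p ε hε
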